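/- arXiv:2509.22629 — 2 statements merged into one kernel-verified Lean document; each statement's English description precedes it below -/
import Mathlib

section
/- Let m, k, r, s ∈ ℕ with r ≥ 2 and s < k ≤ m, and suppose m ≥ δ·r^{C(k+s)}. Set R = 2^{−5}pm and let 0 ≤ R′ ≤ R/16. Let F be a graph with v(F) = s+1 < m, fix w ∈ V(F), let F⁻ = F − w, and let G̃′ ⊆ G̃ be graphs on a common vertex set U of size m. Suppose that ℑ_{F, G̃′, G̃} is (p, R′)-Janson and that ℑ_{F⁻, G̃′, G̃}[W] is (p, R)-Janson for every W ⊆ U with |W| ≥ m/(8r). Then, for a new vertex v ∉ U, the number of sets A ⊆ U for which there exists B ⊆ A with |B| ≥ m/(4r) such that ℑ_{F, G̃′⊕_v B, G̃⊕_v A} is not (p, R′+1)-Janson is at most exp(−m/(2^6 r))·2^m. -/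
open scoped Classical

noncomputable section

/-- Total mass `e(ν)` of a measure `ν` on the hypergraph `G`. -/
def eMass {V : Type*} (G : Finset (Finset V)) (ν : Finset V → ℝ) : ℝ := ∑ E ∈ G, ν E

/-- Degree `d_ν(L)` of a set `L` in the measure `ν`. -/
def dMass {V : Type*} (G : Finset (Finset V)) (ν : Finset V → ℝ) (L : Finset V) : ℝ :=
  ∑ E ∈ G.filter (fun E => L ⊆ E), ν E

/-- `Λ_p(ν) = Σ_{L ⊆ V, |L| ≥ 2} d_ν(L)² p^{−|L|}`. -/
def lamP {V : Type*} [Fintype V] (p : ℝ) (G : Finset (Finset V)) (ν : Finset V → ℝ) : ℝ :=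
  ∑ L ∈ (Finset.univ : Finset (Finset V)).filter (fun L => 2 ≤ L.card),
    dMass G ν L ^ 2 / p ^ L.card

/-- `ν` is a (nonnegative) measure supported on the edges of `G`. -/
def IsMeasureOn {V : Type*} (G : Finset (Finset V)) (ν : Finset V → ℝ) : Prop :=
  (∀ E, 0 ≤ ν E) ∧ ∀ E, E ∉ G → ν E = 0

/-- The induced subhypergraph `G[X]`. -/
def indHG {V : Type*} (G : Finset (Finset V)) (X : Finset V) : Finset (Finset V) :=
  G.filter (fun E => E ⊆ X)

/-- `G` is `(p,R)`-Janson: for `R > 0` there is a measure `ν` on `G` with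
`Λ_p(ν) < e(ν)²/R`; for `R = 0` every hypergraph is `(p,R)`-Janson. -/
def IsJanson {V : Type*} [Fintype V] (p R : ℝ) (G : Finset (Finset V)) : Prop :=
  0 < R → ∃ ν : Finset V → ℝ, IsMeasureOn G ν ∧ lamP p G ν < eMass G ν ^ 2 / R

/-- The hypergraph `ℑ_{F,G',G}` of copies of `F` whose induced subgraph in `G'` and `G`
coincide and are isomorphic to `F`. -/
def copyHG {W V : Type*} [Fintype V] (F : SimpleGraph W) (G' G : SimpleGraph V) :
    Finset (Finset V) :=
  Finset.univ.filter fun L : Finset V =>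
    (∀ x ∈ L, ∀ y ∈ L, G'.Adj x y ↔ G.Adj x y) ∧
    Nonempty (F ≃g G.induce (L : Set V))

/-- `G ⊕_v A`: the graph on `V ∪ {v}` (modelled as `Option V`, with `v = none ∉ V`)
obtained from `G` by joining the new vertex to exactly the vertices of `A`. -/
def extendGraph {V : Type*} (G : SimpleGraph V) (A : Finset V) : SimpleGraph (Option V) :=
  SimpleGraph.fromRel (fun x y =>
    match x, y with
    | some a, some b => G.Adj a b
    | some a, none => a ∈ A
    | none, some _ => False
    | none, none => False)

/-- The weight of the set `a` under independent sampling of each `i` with probability `ρ i`. -/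
def bernoulliWeight {ι : Type*} [Fintype ι] [DecidableEq ι] (ρ : ι → ℝ) (a : Finset ι) : ℝ :=
  ∏ i, if i ∈ a then ρ i else 1 - ρ i

section Bernoulli

variable {ι : Type*} [Fintype ι] [DecidableEq ι]

lemma sum_prod_ite_mem (x y : ι → ℝ) :
    ∑ a : Finset ι, ∏ i, (if i ∈ a then x i else y i) = ∏ i, (x i + y i) := by
  rw [Fintype.prod_add]
  refine Finset.sum_congr rfl fun a _ => ?_
  rw [Finset.prod_ite]
  congr 1
  · exact Finset.prod_congr (by ext; simp) fun _ _ => rfl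
  · exact Finset.prod_congr (by ext; simp) fun _ _ => rfl

lemma sum_bernoulliWeight (ρ : ι → ℝ) : ∑ a, bernoulliWeight ρ a = 1 := by
  unfold bernoulliWeight
  rw [sum_prod_ite_mem]
  simp

lemma bernoulliWeight_nonneg {ρ : ι → ℝ} (h0 : ∀ i, 0 ≤ ρ i) (h1 : ∀ i, ρ i ≤ 1) (a : Finset ι) :
    0 ≤ bernoulliWeight ρ a :=
  Finset.prod_nonneg fun i _ => by
    split_ifs
    · exact h0 i
    · linarith [h1 i]

lemma bernoulliWeight_mul (ρ : ι → ℝ) (a b : Finset ι) :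
    bernoulliWeight ρ a * bernoulliWeight ρ b =
      bernoulliWeight ρ (a ⊓ b) * bernoulliWeight ρ (a ⊔ b) := by
  unfold bernoulliWeight
  rw [← Finset.prod_mul_distrib, ← Finset.prod_mul_distrib]
  refine Finset.prod_congr rfl fun i _ => ?_
  by_cases ha : i ∈ a <;> by_cases hb : i ∈ b <;> simp [ha, hb, mul_comm]

lemma sum_eq_sum_not_mem_add (i : ι) (g : Finset ι → ℝ) :
    ∑ a, g a = ∑ a ∈ (Finset.univ.erase i).powerset, (g a + g (insert i a)) := by
  have h : (Finset.univ : Finset (Finset ι)) =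
      (insert i ((Finset.univ : Finset ι).erase i)).powerset := by
    rw [Finset.insert_erase (Finset.mem_univ i), Finset.powerset_univ]
  rw [h, Finset.sum_powerset_insert (Finset.notMem_erase i _), Finset.sum_add_distrib]

lemma bernoulliWeight_split (ρ : ι → ℝ) {i : ι} {a : Finset ι} (ha : i ∉ a) :
    ∃ c, bernoulliWeight ρ a = (1 - ρ i) * c ∧ bernoulliWeight ρ (insert i a) = ρ i * c := by
  refine ⟨∏ j ∈ Finset.univ.erase i, if j ∈ a then ρ j else 1 - ρ j, ?_, ?_⟩
  · unfold bernoulliWeight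
    rw [← Finset.mul_prod_erase _ _ (Finset.mem_univ i), if_neg ha]
  · unfold bernoulliWeight
    rw [← Finset.mul_prod_erase _ _ (Finset.mem_univ i), if_pos (Finset.mem_insert_self i a)]
    congr 1
    refine Finset.prod_congr rfl fun j hj => ?_
    simp [Finset.mem_insert, Finset.ne_of_mem_erase hj]

lemma sum_bernoulliWeight_mem (ρ : ι → ℝ) (i : ι) (f : Finset ι → ℝ) :
    ∑ a, bernoulliWeight ρ a * (if i ∈ a then f a else 0) =
      ρ i * ∑ a, bernoulliWeight ρ a * f (insert i a) := by
  rw [sum_eq_sum_not_mem_add i, sum_eq_sum_not_mem_add i, Finset.mul_sum]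
  refine Finset.sum_congr rfl fun a ha => ?_
  have hia : i ∉ a := fun h => by simpa using Finset.mem_powerset.1 ha h
  obtain ⟨c, h1, h2⟩ := bernoulliWeight_split ρ hia
  simp only [hia, if_false, Finset.mem_insert_self, if_true, Finset.insert_idem, h1, h2]
  ring

lemma sum_bernoulliWeight_subset (ρ : ι → ℝ) (E : Finset ι) (f : Finset ι → ℝ) :
    ∑ a, bernoulliWeight ρ a * (if E ⊆ a then f a else 0) =
      (∏ i ∈ E, ρ i) * ∑ a, bernoulliWeight ρ a * f (a ∪ E) := by
  induction E using Finset.induction_on generalizing f with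
  | empty => simp
  | insert i E hi ih =>
    have h : ∀ a : Finset ι, (if insert i E ⊆ a then f a else 0) =
        if i ∈ a then (if E ⊆ a then f a else 0) else 0 := by
      intro a
      by_cases h1 : i ∈ a <;> by_cases h2 : E ⊆ a <;> simp [Finset.insert_subset_iff, h1, h2]
    simp_rw [h]
    rw [sum_bernoulliWeight_mem, Finset.prod_insert hi, mul_assoc]
    congr 1
    have h' : ∀ a : Finset ι, (if E ⊆ insert i a then f (insert i a) else 0) =
        if E ⊆ a then f (insert i a) else 0 := by
      intro a
      simp only [Finset.subset_insert_iff_of_notMem hi]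
    simp_rw [h']
    rw [ih (fun a => f (insert i a))]
    simp

/-- Harris' inequality for two decreasing functions with values in `[0, 1]`. -/
lemma harris_antitone {ρ : ι → ℝ} (h0 : ∀ i, 0 ≤ ρ i) (h1 : ∀ i, ρ i ≤ 1)
    {f g : Finset ι → ℝ} (hf : Antitone f) (hg : Antitone g) (hf1 : ∀ a, f a ≤ 1)
    (hg1 : ∀ a, g a ≤ 1) :
    (∑ a, bernoulliWeight ρ a * f a) * (∑ a, bernoulliWeight ρ a * g a) ≤
      ∑ a, bernoulliWeight ρ a * (f a * g a) := by
  have key := fkg (fun a => 1 - f a) (fun a => 1 - g a) (bernoulliWeight ρ)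
    (fun a => bernoulliWeight_nonneg h0 h1 a) (fun a => sub_nonneg.2 (hf1 a))
    (fun a => sub_nonneg.2 (hg1 a)) (fun a b hab => sub_le_sub_left (hf hab) 1)
    (fun a b hab => sub_le_sub_left (hg hab) 1) (fun a b => (bernoulliWeight_mul ρ a b).le)
  have e1 : ∀ u : Finset ι → ℝ, ∑ a, bernoulliWeight ρ a * (1 - u a) =
      1 - ∑ a, bernoulliWeight ρ a * u a := by
    intro u
    simp only [mul_sub, mul_one, Finset.sum_sub_distrib, sum_bernoulliWeight]
  have e2 : ∑ a, bernoulliWeight ρ a * ((1 - f a) * (1 - g a)) =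
      1 - ∑ a, bernoulliWeight ρ a * f a - ∑ a, bernoulliWeight ρ a * g a +
        ∑ a, bernoulliWeight ρ a * (f a * g a) := by
    have h : ∀ a, bernoulliWeight ρ a * ((1 - f a) * (1 - g a)) = bernoulliWeight ρ a -
        bernoulliWeight ρ a * f a - bernoulliWeight ρ a * g a +
          bernoulliWeight ρ a * (f a * g a) := fun a => by ring
    simp only [h, Finset.sum_sub_distrib, Finset.sum_add_distrib, sum_bernoulliWeight]
  rw [e1, e1, e2, sum_bernoulliWeight] at key
  nlinarith [key]

end Bernoulli

section Janson

variable {ι : Type*} [DecidableEq ι]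

/-- The weighted number of the sets `e k`, `k ∈ K`, contained in `a`, each normalised by its
probability under independent sampling. -/
def normalizedCount {κ : Type*} (ρ : ι → ℝ) (K : Finset κ) (e : κ → Finset ι) (ν : κ → ℝ)
    (a : Finset ι) : ℝ :=
  ∑ k ∈ K, if e k ⊆ a then ν k / ∏ i ∈ e k, ρ i else 0

/-- The pair correlation term in Janson's inequality. -/
def jansonDelta {κ : Type*} (ρ : ι → ℝ) (K : Finset κ) (e : κ → Finset ι) (ν : κ → ℝ) : ℝ :=
  ∑ k ∈ K, ∑ l ∈ K,
    if (e k ∩ e l).Nonempty then ν k * ν l / ∏ i ∈ e k ∩ e l, ρ i else 0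

variable {κ : Type*} {ρ : ι → ℝ} {K : Finset κ} {e : κ → Finset ι} {ν : κ → ℝ}

lemma normalizedCount_mono (h0 : ∀ i, 0 ≤ ρ i) (hν : ∀ k ∈ K, 0 ≤ ν k) :
    Monotone (normalizedCount ρ K e ν) := by
  intro a b hab
  refine Finset.sum_le_sum fun k hk => ?_
  have : 0 ≤ ν k / ∏ i ∈ e k, ρ i := div_nonneg (hν k hk) (Finset.prod_nonneg fun i _ => h0 i)
  by_cases h : e k ⊆ a
  · rw [if_pos h, if_pos (h.trans hab)]
  · rw [if_neg h]
    split_ifs <;> simp [this]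

lemma normalizedCount_nonneg (h0 : ∀ i, 0 ≤ ρ i) (hν : ∀ k ∈ K, 0 ≤ ν k) (a : Finset ι) :
    0 ≤ normalizedCount ρ K e ν a := by
  refine Finset.sum_nonneg fun k hk => ?_
  split_ifs
  · exact div_nonneg (hν k hk) (Finset.prod_nonneg fun i _ => h0 i)
  · rfl

variable [Fintype ι]

lemma sum_bernoulliWeight_subset_union (h : ∀ k ∈ K, ∀ i ∈ e k, 0 < ρ i) {k l : κ}
    (hl : l ∈ K) :
    ∑ a, bernoulliWeight ρ a * (if e l ⊆ a ∪ e k then ν l / ∏ i ∈ e l, ρ i else 0) =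
      ν l / ∏ i ∈ e k ∩ e l, ρ i := by
  have hsub : ∀ a : Finset ι, e l ⊆ a ∪ e k ↔ e l \ e k ⊆ a := by
    intro a
    rw [sdiff_le_iff, Finset.sup_eq_union, Finset.union_comm]
  simp_rw [hsub]
  rw [sum_bernoulliWeight_subset ρ (e l \ e k) (fun _ => ν l / ∏ i ∈ e l, ρ i),
    ← Finset.sum_mul, sum_bernoulliWeight, one_mul]
  have h1 : ∏ i ∈ e l, ρ i = (∏ i ∈ e l \ e k, ρ i) * ∏ i ∈ e k ∩ e l, ρ i := by
    rw [Finset.inter_comm, mul_comm, Finset.prod_inter_mul_prod_sdiff]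
  have h2 : ∏ i ∈ e l \ e k, ρ i ≠ 0 :=
    (Finset.prod_pos fun i hi => h l hl i (Finset.mem_sdiff.1 hi).1).ne'
  have h3 : ∏ i ∈ e k ∩ e l, ρ i ≠ 0 :=
    (Finset.prod_pos fun i hi => h l hl i (Finset.mem_inter.1 hi).2).ne'
  rw [h1]
  field_simp

lemma laplace_edge_bound (h0 : ∀ i, 0 ≤ ρ i) (h1 : ∀ i, ρ i ≤ 1) (hν : ∀ k ∈ K, 0 ≤ ν k)
    (hpos : ∀ k ∈ K, ∀ i ∈ e k, 0 < ρ i) {t : ℝ} (ht : 0 ≤ t) (k : κ) :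
    (1 - t * ∑ l ∈ K, if (e k ∩ e l).Nonempty then ν l / ∏ i ∈ e k ∩ e l, ρ i else 0) *
        ∑ a, bernoulliWeight ρ a * Real.exp (-t * normalizedCount ρ K e ν a) ≤
      ∑ a, bernoulliWeight ρ a * Real.exp (-t * normalizedCount ρ K e ν (a ∪ e k)) := by
  set K₁ := K.filter fun l => (e k ∩ e l).Nonempty with hK₁
  set K₂ := K.filter fun l => ¬ (e k ∩ e l).Nonempty with hK₂
  have hν₁ : ∀ l ∈ K₁, 0 ≤ ν l := fun l hl => hν l (Finset.mem_filter.1 hl).1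
  have hν₂ : ∀ l ∈ K₂, 0 ≤ ν l := fun l hl => hν l (Finset.mem_filter.1 hl).1
  have hw := bernoulliWeight_nonneg h0 h1
  have hsplit : ∀ a, normalizedCount ρ K e ν a =
      normalizedCount ρ K₁ e ν a + normalizedCount ρ K₂ e ν a := by
    intro a
    unfold normalizedCount
    rw [hK₁, hK₂, Finset.sum_filter_add_sum_filter_not]
  have hind : ∀ a, normalizedCount ρ K₂ e ν (a ∪ e k) = normalizedCount ρ K₂ e ν a := by
    intro a
    refine Finset.sum_congr rfl fun l hl => ?_
    have hd : Disjoint (e l) (e k) := by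
      rw [Finset.disjoint_iff_inter_eq_empty, Finset.inter_comm]
      exact Finset.not_nonempty_iff_eq_empty.1 (Finset.mem_filter.1 hl).2
    have : e l ⊆ a ∪ e k ↔ e l ⊆ a :=
      ⟨fun h => hd.left_le_of_le_sup_right h, fun h => h.trans Finset.subset_union_left⟩
    simp only [this]
  have hA : 1 - t * ∑ l ∈ K, (if (e k ∩ e l).Nonempty then ν l / ∏ i ∈ e k ∩ e l, ρ i else 0) ≤
      ∑ a, bernoulliWeight ρ a * Real.exp (-t * normalizedCount ρ K₁ e ν (a ∪ e k)) := by
    have h2 : ∑ a, bernoulliWeight ρ a * normalizedCount ρ K₁ e ν (a ∪ e k) =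
        ∑ l ∈ K, if (e k ∩ e l).Nonempty then ν l / ∏ i ∈ e k ∩ e l, ρ i else 0 := by
      rw [← Finset.sum_filter]
      unfold normalizedCount
      simp_rw [Finset.mul_sum]
      rw [Finset.sum_comm]
      refine Finset.sum_congr rfl fun l hl => ?_
      exact sum_bernoulliWeight_subset_union hpos (Finset.mem_filter.1 hl).1
    rw [← h2, ← sum_bernoulliWeight ρ, Finset.mul_sum, ← Finset.sum_sub_distrib]
    refine Finset.sum_le_sum fun a _ => ?_
    have := Real.add_one_le_exp (-t * normalizedCount ρ K₁ e ν (a ∪ e k))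
    nlinarith [hw a]
  have hA0 : 0 ≤ ∑ a, bernoulliWeight ρ a * Real.exp (-t * normalizedCount ρ K₁ e ν (a ∪ e k)) :=
    Finset.sum_nonneg fun a _ => mul_nonneg (hw a) (Real.exp_pos _).le
  have hφ0 : 0 ≤ ∑ a, bernoulliWeight ρ a * Real.exp (-t * normalizedCount ρ K e ν a) :=
    Finset.sum_nonneg fun a _ => mul_nonneg (hw a) (Real.exp_pos _).le
  have hB : ∑ a, bernoulliWeight ρ a * Real.exp (-t * normalizedCount ρ K e ν a) ≤
      ∑ a, bernoulliWeight ρ a * Real.exp (-t * normalizedCount ρ K₂ e ν a) := by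
    refine Finset.sum_le_sum fun a _ => mul_le_mul_of_nonneg_left (Real.exp_le_exp.2 ?_) (hw a)
    have := normalizedCount_nonneg (e := e) h0 hν₁ a
    rw [hsplit]
    nlinarith
  have hanti : ∀ {u : Finset ι → ℝ}, Monotone u → Antitone fun a => Real.exp (-t * u a) :=
    fun hu a b hab => Real.exp_le_exp.2 (by nlinarith [hu hab])
  have hle : ∀ {u : ℝ}, 0 ≤ u → Real.exp (-t * u) ≤ 1 :=
    fun hu => Real.exp_le_one_iff.2 (by nlinarith)
  have hH := harris_antitone h0 h1
    (f := fun a => Real.exp (-t * normalizedCount ρ K₁ e ν (a ∪ e k)))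
    (g := fun a => Real.exp (-t * normalizedCount ρ K₂ e ν a))
    (hanti fun a b hab => normalizedCount_mono h0 hν₁ (Finset.union_subset_union_left hab))
    (hanti (normalizedCount_mono h0 hν₂)) (fun a => hle (normalizedCount_nonneg h0 hν₁ _))
    (fun a => hle (normalizedCount_nonneg h0 hν₂ _))
  refine (mul_le_mul_of_nonneg_right hA hφ0).trans ((mul_le_mul_of_nonneg_left hB hA0).trans
    (hH.trans (Finset.sum_le_sum fun a _ => mul_le_mul_of_nonneg_left (le_of_eq ?_) (hw a))))
  rw [hsplit (a ∪ e k), hind, ← Real.exp_add]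
  congr 1
  ring

/-- Janson's inequality, in the form of a bound on the Laplace transform of the lower tail. -/
lemma janson_laplace (h0 : ∀ i, 0 ≤ ρ i) (h1 : ∀ i, ρ i ≤ 1) (hν : ∀ k ∈ K, 0 ≤ ν k)
    (hpos : ∀ k ∈ K, ∀ i ∈ e k, 0 < ρ i) {t : ℝ} (ht : 0 ≤ t) :
    ∑ a, bernoulliWeight ρ a * Real.exp (-t * normalizedCount ρ K e ν a) ≤
      Real.exp (-t * ∑ k ∈ K, ν k + t ^ 2 / 2 * jansonDelta ρ K e ν) := by
  set X := normalizedCount ρ K e ν with hX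
  set M := ∑ k ∈ K, ν k with hM
  set D := jansonDelta ρ K e ν with hD
  set φ : ℝ → ℝ := fun t => ∑ a, bernoulliWeight ρ a * Real.exp (-t * X a) with hφ
  have hφ' : ∀ t, HasDerivAt φ (∑ a, bernoulliWeight ρ a * (Real.exp (-t * X a) * (-X a))) t := by
    intro t
    refine HasDerivAt.fun_sum fun a _ => HasDerivAt.const_mul _ ?_
    have : HasDerivAt (fun t : ℝ => -t * X a) (-X a) t := by
      simpa using ((hasDerivAt_id t).neg).mul_const (X a)
    exact this.exp
  have hkey : ∀ t, 0 ≤ t → (M - t * D) * φ t ≤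
      ∑ a, bernoulliWeight ρ a * (Real.exp (-t * X a) * X a) := by
    intro t ht
    have e1 : ∑ a, bernoulliWeight ρ a * (Real.exp (-t * X a) * X a) =
        ∑ k ∈ K, ν k * ∑ a, bernoulliWeight ρ a * Real.exp (-t * X (a ∪ e k)) := by
      have : ∀ a, bernoulliWeight ρ a * (Real.exp (-t * X a) * X a) =
          ∑ k ∈ K, bernoulliWeight ρ a *
            (if e k ⊆ a then Real.exp (-t * X a) * (ν k / ∏ i ∈ e k, ρ i) else 0) := by
        intro a
        rw [← Finset.mul_sum]
        congr 1
        nth_rewrite 2 [hX]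
        unfold normalizedCount
        rw [Finset.mul_sum]
        exact Finset.sum_congr rfl fun k _ => by split_ifs <;> simp
      simp_rw [this]
      rw [Finset.sum_comm]
      refine Finset.sum_congr rfl fun k hk => ?_
      rw [sum_bernoulliWeight_subset ρ (e k)
        (fun a => Real.exp (-t * X a) * (ν k / ∏ i ∈ e k, ρ i))]
      have hne : ∏ i ∈ e k, ρ i ≠ 0 := (Finset.prod_pos fun i hi => hpos k hk i hi).ne'
      simp_rw [← mul_assoc]
      rw [← Finset.sum_mul]
      field_simp
    have e2 : (M - t * D) * φ t = ∑ k ∈ K, ν k *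
        ((1 - t * ∑ l ∈ K, if (e k ∩ e l).Nonempty then ν l / ∏ i ∈ e k ∩ e l, ρ i else 0) *
          φ t) := by
      rw [Finset.sum_congr rfl fun k _ => (mul_assoc (ν k) _ (φ t)).symm, ← Finset.sum_mul]
      congr 1
      rw [hM, hD]
      unfold jansonDelta
      rw [Finset.mul_sum, ← Finset.sum_sub_distrib]
      refine Finset.sum_congr rfl fun k _ => ?_
      rw [mul_sub, mul_one, Finset.mul_sum, Finset.mul_sum, Finset.mul_sum]
      congr 1
      refine Finset.sum_congr rfl fun l _ => ?_
      split_ifs <;> ring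
    rw [e1, e2]
    exact Finset.sum_le_sum fun k hk =>
      mul_le_mul_of_nonneg_left (laplace_edge_bound h0 h1 hν hpos ht k) (hν k hk)
  set ψ : ℝ → ℝ := fun t => φ t * Real.exp (t * M - t ^ 2 / 2 * D) with hψ
  have hψ' : ∀ t, HasDerivAt ψ
      ((∑ a, bernoulliWeight ρ a * (Real.exp (-t * X a) * (-X a))) *
          Real.exp (t * M - t ^ 2 / 2 * D) +
        φ t * (Real.exp (t * M - t ^ 2 / 2 * D) * (M - t * D))) t := by
    intro t
    refine (hφ' t).mul (HasDerivAt.exp ?_)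
    have h1 : HasDerivAt (fun t : ℝ => t * M) M t := by
      simpa using (hasDerivAt_id t).mul_const M
    have h2 : HasDerivAt (fun t : ℝ => t ^ 2 / 2 * D) (t * D) t := by
      have := (((hasDerivAt_id t).pow 2).div_const 2).mul_const D
      exact this.congr_deriv (by norm_num)
    exact h1.sub h2
  have hmono : AntitoneOn ψ (Set.Ici 0) := by
    refine antitoneOn_of_deriv_nonpos (convex_Ici 0)
      (fun t _ => (hψ' t).continuousAt.continuousWithinAt)
      (fun t _ => (hψ' t).differentiableAt.differentiableWithinAt) fun t ht => ?_
    rw [interior_Ici] at ht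
    rw [(hψ' t).deriv]
    have e3 : ∑ a, bernoulliWeight ρ a * (Real.exp (-t * X a) * (-X a)) =
        -∑ a, bernoulliWeight ρ a * (Real.exp (-t * X a) * X a) := by
      rw [← Finset.sum_neg_distrib]
      exact Finset.sum_congr rfl fun a _ => by ring
    rw [e3]
    nlinarith [hkey t (le_of_lt ht), Real.exp_pos (t * M - t ^ 2 / 2 * D)]
  have h := hmono (Set.mem_Ici.2 le_rfl) (Set.mem_Ici.2 ht) ht
  have hψ0 : ψ 0 = 1 := by simp [hψ, hφ, sum_bernoulliWeight]
  rw [hψ0] at h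
  have e4 : Real.exp (-t * M + t ^ 2 / 2 * D) = (Real.exp (t * M - t ^ 2 / 2 * D))⁻¹ := by
    rw [← Real.exp_neg]
    congr 1
    ring
  rw [e4, ← one_div, le_div_iff₀ (Real.exp_pos _)]
  exact h

end Janson

/-- The members of the family `Ω` which have the same trace on `T` as `ω`. -/
def traceClass {ι : Type*} [DecidableEq ι] (Ω : Finset (Finset ι)) (T ω : Finset ι) :
    Finset (Finset ι) :=
  Ω.filter fun ω' => ω' ∩ T = ω ∩ T

/-- The average of `g` over the family `Ω`. -/
def familyAvg {ι : Type*} (Ω : Finset (Finset ι)) (g : Finset ι → ℝ) : ℝ :=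
  (∑ ω ∈ Ω, g ω) / Ω.card

/-- The Shannon entropy of the trace on `T` of a uniformly random member of `Ω`. -/
def traceEntropy {ι : Type*} [DecidableEq ι] (Ω : Finset (Finset ι)) (T : Finset ι) : ℝ :=
  familyAvg Ω fun ω => Real.log (Ω.card / (traceClass Ω T ω).card)

/-- The mutual information between membership of `i` and the trace on `T`. -/
def traceInfo {ι : Type*} [DecidableEq ι] (Ω : Finset (Finset ι)) (i : ι) (T : Finset ι) : ℝ :=
  traceEntropy Ω {i} + traceEntropy Ω T - traceEntropy Ω (insert i T)

section Entropy

variable {ι : Type*}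

lemma familyAvg_add (Ω : Finset (Finset ι)) (f g : Finset ι → ℝ) :
    familyAvg Ω (fun ω => f ω + g ω) = familyAvg Ω f + familyAvg Ω g := by
  simp only [familyAvg, Finset.sum_add_distrib, add_div]

lemma familyAvg_sub (Ω : Finset (Finset ι)) (f g : Finset ι → ℝ) :
    familyAvg Ω (fun ω => f ω - g ω) = familyAvg Ω f - familyAvg Ω g := by
  simp only [familyAvg, Finset.sum_sub_distrib, sub_div]

lemma familyAvg_const {Ω : Finset (Finset ι)} (hΩ : Ω.Nonempty) (c : ℝ) :
    familyAvg Ω (fun _ => c) = c := by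
  have : (Ω.card : ℝ) ≠ 0 := by exact_mod_cast hΩ.card_pos.ne'
  simp only [familyAvg, Finset.sum_const, nsmul_eq_mul]
  field_simp

lemma familyAvg_mono {Ω : Finset (Finset ι)} {f g : Finset ι → ℝ} (h : ∀ ω ∈ Ω, f ω ≤ g ω) :
    familyAvg Ω f ≤ familyAvg Ω g :=
  div_le_div_of_nonneg_right (Finset.sum_le_sum h) (Nat.cast_nonneg _)

lemma familyAvg_congr {Ω : Finset (Finset ι)} {f g : Finset ι → ℝ} (h : ∀ ω ∈ Ω, f ω = g ω) :
    familyAvg Ω f = familyAvg Ω g := by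
  unfold familyAvg
  rw [Finset.sum_congr rfl h]

lemma familyAvg_const_mul (Ω : Finset (Finset ι)) (c : ℝ) (f : Finset ι → ℝ) :
    familyAvg Ω (fun ω => c * f ω) = c * familyAvg Ω f := by
  simp only [familyAvg, ← Finset.mul_sum, mul_div_assoc]

lemma familyAvg_sum {κ : Type*} (Ω : Finset (Finset ι)) (s : Finset κ) (f : κ → Finset ι → ℝ) :
    familyAvg Ω (fun ω => ∑ k ∈ s, f k ω) = ∑ k ∈ s, familyAvg Ω (f k) := by
  simp only [familyAvg]
  rw [Finset.sum_comm, Finset.sum_div]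

lemma log_le_div_sub_one_add_log {x S : ℝ} (hx : 0 < x) (hS : 0 < S) :
    Real.log x ≤ x / S - 1 + Real.log S := by
  have := Real.log_le_sub_one_of_pos (div_pos hx hS)
  rw [Real.log_div hx.ne' hS.ne'] at this
  linarith

variable [DecidableEq ι] {Ω : Finset (Finset ι)}

lemma mem_traceClass {T ω ω' : Finset ι} :
    ω' ∈ traceClass Ω T ω ↔ ω' ∈ Ω ∧ ω' ∩ T = ω ∩ T := Finset.mem_filter

lemma traceClass_eq {T ω ω' : Finset ι} (h : ω' ∩ T = ω ∩ T) :
    traceClass Ω T ω' = traceClass Ω T ω := by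
  unfold traceClass
  rw [h]

lemma traceClass_card_pos {T ω : Finset ι} (h : ω ∈ Ω) :
    (0 : ℝ) < (traceClass Ω T ω).card := by
  exact_mod_cast Finset.card_pos.2 ⟨ω, mem_traceClass.2 ⟨h, rfl⟩⟩

lemma traceClass_traceClass (T Z ω ω' : Finset ι) (h : ω' ∈ traceClass Ω Z ω) :
    traceClass (traceClass Ω Z ω) T ω' = traceClass Ω (T ∪ Z) ω' := by
  have h2 := (mem_traceClass.1 h).2
  ext x
  simp only [mem_traceClass, Finset.inter_union_distrib_left]
  constructor
  · rintro ⟨⟨h0, h3⟩, h4⟩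
    exact ⟨h0, by rw [h4, h3, h2]⟩
  · rintro ⟨h0, h3⟩
    have h5 : ∀ R ⊆ T ∪ Z, x ∩ R = ω' ∩ R := by
      intro R hR
      ext y
      have := congrArg (fun s => y ∈ s) h3
      simp only [Finset.mem_union, Finset.mem_inter, eq_iff_iff] at this ⊢
      have hy : y ∈ R → y ∈ T ∨ y ∈ Z := fun h => Finset.mem_union.1 (hR h)
      tauto
    exact ⟨⟨h0, (h5 Z Finset.subset_union_right).trans h2⟩, h5 T Finset.subset_union_left⟩

lemma familyAvg_traceClass (Z : Finset ι) (g : Finset ι → ℝ) :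
    familyAvg Ω (fun ω => familyAvg (traceClass Ω Z ω) g) = familyAvg Ω g := by
  unfold familyAvg
  congr 1
  have h1 : ∀ ω ∈ Ω, (∑ ω' ∈ traceClass Ω Z ω, g ω') / ((traceClass Ω Z ω).card : ℝ) =
      ∑ ω' ∈ Ω, if ω' ∩ Z = ω ∩ Z then g ω' / (traceClass Ω Z ω').card else 0 := by
    intro ω _
    rw [← Finset.sum_filter, Finset.sum_div]
    refine Finset.sum_congr rfl fun ω' h' => ?_
    rw [traceClass_eq (mem_traceClass.1 h').2]
  rw [Finset.sum_congr rfl h1, Finset.sum_comm]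
  refine Finset.sum_congr rfl fun ω' h' => ?_
  rw [← Finset.sum_filter, Finset.sum_const, nsmul_eq_mul]
  have h2 : (Ω.filter fun ω => ω' ∩ Z = ω ∩ Z) = traceClass Ω Z ω' :=
    Finset.filter_congr fun _ _ => eq_comm
  rw [h2]
  have := (traceClass_card_pos (T := Z) h').ne'
  field_simp

/-- The Gibbs variational inequality for the trace on `Z`. -/
lemma traceEntropy_add_familyAvg_log_le (hΩ : Ω.Nonempty) (Z : Finset ι) {π : Finset ι → ℝ}
    (h0 : ∀ t, 0 ≤ π t) (hpos : ∀ ω ∈ Ω, 0 < π (ω ∩ Z)) :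
    traceEntropy Ω Z + familyAvg Ω (fun ω => Real.log (π (ω ∩ Z))) ≤
      Real.log (∑ t ∈ Z.powerset, π t) := by
  set S := ∑ t ∈ Z.powerset, π t with hSdef
  obtain ⟨ω₀, hω₀⟩ := hΩ
  have hS : 0 < S := Finset.sum_pos' (fun t _ => h0 t)
    ⟨ω₀ ∩ Z, Finset.mem_powerset.2 Finset.inter_subset_right, hpos _ hω₀⟩
  have hn : (0 : ℝ) < Ω.card := by exact_mod_cast Finset.card_pos.2 ⟨ω₀, hω₀⟩
  have h1 : ∀ ω ∈ Ω, Real.log (Ω.card / (traceClass Ω Z ω).card) + Real.log (π (ω ∩ Z)) ≤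
      (Ω.card / S) * (π (ω ∩ Z) / (traceClass Ω Z ω).card) + (Real.log S - 1) := by
    intro ω hω
    have hN := traceClass_card_pos (T := Z) hω
    rw [← Real.log_mul (div_pos hn hN).ne' (hpos ω hω).ne']
    have := log_le_div_sub_one_add_log (mul_pos (div_pos hn hN) (hpos ω hω)) hS
    refine this.trans (le_of_eq ?_)
    field_simp
    ring
  have h2 : ∑ ω ∈ Ω, π (ω ∩ Z) / (traceClass Ω Z ω).card ≤ S := by
    have hmap : ∀ ω ∈ Ω, ω ∩ Z ∈ Z.powerset :=
      fun ω _ => Finset.mem_powerset.2 Finset.inter_subset_right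
    rw [← Finset.sum_fiberwise_of_maps_to hmap]
    refine Finset.sum_le_sum fun t _ => ?_
    rcases (Ω.filter fun ω => ω ∩ Z = t).eq_empty_or_nonempty with he | ⟨ω₁, hω₁⟩
    · rw [he, Finset.sum_empty]
      exact h0 t
    · have hω₁' := Finset.mem_filter.1 hω₁
      have hcls : (Ω.filter fun ω => ω ∩ Z = t) = traceClass Ω Z ω₁ := by
        unfold traceClass
        rw [hω₁'.2]
      have : ∀ ω ∈ Ω.filter (fun ω => ω ∩ Z = t), π (ω ∩ Z) / (traceClass Ω Z ω).card =
          π t / (traceClass Ω Z ω₁).card := by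
        intro ω hω
        have hω' := Finset.mem_filter.1 hω
        rw [hω'.2, traceClass_eq (hω'.2.trans hω₁'.2.symm)]
      rw [Finset.sum_congr rfl this, Finset.sum_const, nsmul_eq_mul, hcls]
      have := (traceClass_card_pos (T := Z) hω₁'.1).ne'
      exact le_of_eq (by field_simp)
  unfold traceEntropy
  rw [← familyAvg_add]
  refine (familyAvg_mono h1).trans ?_
  rw [familyAvg_add, familyAvg_const ⟨ω₀, hω₀⟩, familyAvg_const_mul]
  unfold familyAvg
  have h3 : (Ω.card / S) * ((∑ ω ∈ Ω, π (ω ∩ Z) / (traceClass Ω Z ω).card) / Ω.card) ≤ 1 := by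
    rw [div_mul_div_comm, div_le_one (by positivity)]
    nlinarith
  linarith

lemma traceEntropy_le (hΩ : Ω.Nonempty) (Z : Finset ι) :
    traceEntropy Ω Z ≤ Z.card * Real.log 2 := by
  have := traceEntropy_add_familyAvg_log_le hΩ Z (π := fun _ => 1) (fun _ => zero_le_one)
    fun _ _ => zero_lt_one
  simpa [familyAvg, Finset.card_powerset, Real.log_pow] using this

lemma traceEntropy_nonneg (Z : Finset ι) : 0 ≤ traceEntropy Ω Z := by
  refine div_nonneg (Finset.sum_nonneg fun ω hω => Real.log_nonneg ?_) (Nat.cast_nonneg _)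
  rw [one_le_div (traceClass_card_pos hω)]
  exact_mod_cast Finset.card_le_card (Finset.filter_subset _ _)

lemma traceEntropy_empty : traceEntropy Ω ∅ = 0 := by
  unfold traceEntropy familyAvg
  rw [Finset.sum_eq_zero, zero_div]
  intro ω hω
  have : traceClass Ω ∅ ω = Ω := Finset.filter_true_of_mem fun _ _ => by simp
  rw [this, div_self (by exact_mod_cast (Finset.card_pos.2 ⟨ω, hω⟩).ne'), Real.log_one]

lemma sum_traceClass_card_ratio_le (T₁ T₂ : Finset ι) :
    ∑ ω ∈ Ω, ((traceClass Ω T₁ ω).card * (traceClass Ω T₂ ω).card : ℝ) /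
      ((traceClass Ω (T₁ ∪ T₂) ω).card * (traceClass Ω (T₁ ∩ T₂) ω).card) ≤ Ω.card := by
  have hcard : ∀ T ω : Finset ι, ((traceClass Ω T ω).card : ℝ) =
      ∑ x ∈ Ω, if x ∩ T = ω ∩ T then 1 else 0 := by
    intro T ω
    rw [traceClass, Finset.card_filter]
    push_cast
    rfl
  have h1 : ∀ ω ∈ Ω, ((traceClass Ω T₁ ω).card * (traceClass Ω T₂ ω).card : ℝ) /
      ((traceClass Ω (T₁ ∪ T₂) ω).card * (traceClass Ω (T₁ ∩ T₂) ω).card) =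
      ∑ x ∈ Ω, ∑ y ∈ Ω, if x ∩ T₁ = ω ∩ T₁ ∧ y ∩ T₂ = ω ∩ T₂ then
        1 / ((traceClass Ω (T₁ ∪ T₂) ω).card * (traceClass Ω (T₁ ∩ T₂) x).card : ℝ) else 0 := by
    intro ω _
    rw [hcard T₁, hcard T₂, Finset.sum_mul_sum, Finset.sum_div]
    refine Finset.sum_congr rfl fun x _ => ?_
    rw [Finset.sum_div]
    refine Finset.sum_congr rfl fun y _ => ?_
    by_cases hx : x ∩ T₁ = ω ∩ T₁
    · have : x ∩ (T₁ ∩ T₂) = ω ∩ (T₁ ∩ T₂) := by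
        rw [← Finset.inter_assoc, hx, Finset.inter_assoc]
      rw [traceClass_eq this]
      by_cases hy : y ∩ T₂ = ω ∩ T₂ <;> simp [hx, hy]
    · simp [hx]
  rw [Finset.sum_congr rfl h1, Finset.sum_comm]
  have h2 : ∀ x ∈ Ω, (∑ ω ∈ Ω, ∑ y ∈ Ω, if x ∩ T₁ = ω ∩ T₁ ∧ y ∩ T₂ = ω ∩ T₂ then
        1 / ((traceClass Ω (T₁ ∪ T₂) ω).card * (traceClass Ω (T₁ ∩ T₂) x).card : ℝ) else 0) ≤ 1 := by
    intro x hx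
    rw [Finset.sum_comm]
    have hN := traceClass_card_pos (T := T₁ ∩ T₂) hx
    have h3 : ∀ y ∈ Ω, (∑ ω ∈ Ω, if x ∩ T₁ = ω ∩ T₁ ∧ y ∩ T₂ = ω ∩ T₂ then
        1 / ((traceClass Ω (T₁ ∪ T₂) ω).card * (traceClass Ω (T₁ ∩ T₂) x).card : ℝ) else 0) ≤
        if y ∩ (T₁ ∩ T₂) = x ∩ (T₁ ∩ T₂) then 1 / ((traceClass Ω (T₁ ∩ T₂) x).card : ℝ) else 0 := by
      intro y _
      rw [← Finset.sum_filter]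
      rcases (Ω.filter fun ω => x ∩ T₁ = ω ∩ T₁ ∧ y ∩ T₂ = ω ∩ T₂).eq_empty_or_nonempty with
        he | ⟨ω₁, hω₁⟩
      · rw [he, Finset.sum_empty]
        split_ifs <;> positivity
      · obtain ⟨hm, hx1, hy1⟩ := Finset.mem_filter.1 hω₁
        have hxy : y ∩ (T₁ ∩ T₂) = x ∩ (T₁ ∩ T₂) := by
          rw [← Finset.inter_assoc x, hx1, Finset.inter_comm T₁, ← Finset.inter_assoc y, hy1,
            Finset.inter_assoc, Finset.inter_assoc, Finset.inter_comm T₁]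
        rw [if_pos hxy]
        have hcls : (Ω.filter fun ω => x ∩ T₁ = ω ∩ T₁ ∧ y ∩ T₂ = ω ∩ T₂) =
            traceClass Ω (T₁ ∪ T₂) ω₁ := by
          refine Finset.filter_congr fun ω _ => ?_
          rw [hx1, hy1]
          constructor
          · rintro ⟨h1, h2⟩
            rw [Finset.inter_union_distrib_left, Finset.inter_union_distrib_left, h1, h2]
          · intro h
            constructor
            · have := congrArg (· ∩ T₁) h
              simp only [Finset.inter_assoc, Finset.union_inter_cancel_left] at this
              exact this.symm
            · have := congrArg (· ∩ T₂) h
              simp only [Finset.inter_assoc, Finset.union_inter_cancel_right] at this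
              exact this.symm
        have hc : ∀ ω ∈ traceClass Ω (T₁ ∪ T₂) ω₁,
            1 / ((traceClass Ω (T₁ ∪ T₂) ω).card * (traceClass Ω (T₁ ∩ T₂) x).card : ℝ) =
            1 / ((traceClass Ω (T₁ ∪ T₂) ω₁).card * (traceClass Ω (T₁ ∩ T₂) x).card : ℝ) := by
          intro ω hω
          rw [traceClass_eq (mem_traceClass.1 hω).2]
        rw [hcls, Finset.sum_congr rfl hc, Finset.sum_const, nsmul_eq_mul]
        have := (traceClass_card_pos (T := T₁ ∪ T₂) hm).ne'
        exact le_of_eq (by field_simp)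
    refine (Finset.sum_le_sum h3).trans (le_of_eq ?_)
    rw [← Finset.sum_filter, Finset.sum_const, nsmul_eq_mul]
    exact mul_one_div_cancel hN.ne'
  refine (Finset.sum_le_sum h2).trans (le_of_eq ?_)
  simp

lemma traceEntropy_submodular (T₁ T₂ : Finset ι) :
    traceEntropy Ω (T₁ ∪ T₂) + traceEntropy Ω (T₁ ∩ T₂) ≤
      traceEntropy Ω T₁ + traceEntropy Ω T₂ := by
  rcases Ω.eq_empty_or_nonempty with rfl | hΩ
  · simp [traceEntropy, familyAvg]
  have hn : (0 : ℝ) < Ω.card := by exact_mod_cast hΩ.card_pos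
  have h1 : familyAvg Ω (fun ω => 1 - ((traceClass Ω T₁ ω).card * (traceClass Ω T₂ ω).card : ℝ) /
      ((traceClass Ω (T₁ ∪ T₂) ω).card * (traceClass Ω (T₁ ∩ T₂) ω).card)) ≤
      traceEntropy Ω T₁ + traceEntropy Ω T₂ -
        (traceEntropy Ω (T₁ ∪ T₂) + traceEntropy Ω (T₁ ∩ T₂)) := by
    unfold traceEntropy
    rw [← familyAvg_add, ← familyAvg_add, ← familyAvg_sub]
    refine familyAvg_mono fun ω hω => ?_
    have a := traceClass_card_pos (T := T₁) hω
    have b := traceClass_card_pos (T := T₂) hω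
    have c := traceClass_card_pos (T := T₁ ∪ T₂) hω
    have d := traceClass_card_pos (T := T₁ ∩ T₂) hω
    have := Real.log_le_sub_one_of_pos (div_pos (mul_pos a b) (mul_pos c d))
    rw [Real.log_div (mul_pos a b).ne' (mul_pos c d).ne', Real.log_mul a.ne' b.ne',
      Real.log_mul c.ne' d.ne'] at this
    rw [Real.log_div hn.ne' a.ne', Real.log_div hn.ne' b.ne', Real.log_div hn.ne' c.ne',
      Real.log_div hn.ne' d.ne']
    linarith
  rw [familyAvg_sub, familyAvg_const hΩ] at h1
  have h2 := sum_traceClass_card_ratio_le (Ω := Ω) T₁ T₂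
  have h3 := (div_le_one hn).2 h2
  unfold familyAvg at h1
  linarith

lemma traceInfo_mono (i : ι) {S T : Finset ι} (h : S ⊆ T) :
    traceInfo Ω i S ≤ traceInfo Ω i T := by
  unfold traceInfo
  by_cases hi : i ∈ T
  · rw [Finset.insert_eq_of_mem hi]
    by_cases hS : i ∈ S
    · rw [Finset.insert_eq_of_mem hS]
      linarith
    · have h3 : traceEntropy Ω S ≤ traceEntropy Ω (insert i S) := by
        unfold traceEntropy
        refine familyAvg_mono fun ω hω => Real.log_le_log ?_ ?_
        · have := traceClass_card_pos (T := S) hω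
          have : (0 : ℝ) < Ω.card := by exact_mod_cast Finset.card_pos.2 ⟨ω, hω⟩
          positivity
        · refine div_le_div_of_nonneg_left (Nat.cast_nonneg _) (traceClass_card_pos hω) ?_
          refine Nat.cast_le.2 (Finset.card_le_card fun x hx => ?_)
          have hx' := mem_traceClass.1 hx
          refine mem_traceClass.2 ⟨hx'.1, ?_⟩
          have := congrArg (· ∩ S) hx'.2
          simpa [Finset.inter_assoc, Finset.inter_eq_right.2 (Finset.subset_insert i S)] using this
      linarith
  · have h1 := traceEntropy_submodular (Ω := Ω) (insert i S) T
    rw [Finset.insert_union, Finset.union_eq_right.2 h, Finset.insert_inter_of_notMem hi,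
      Finset.inter_eq_left.2 h] at h1
    linarith

/-- The total correlation is at most the sum of the informations about each element. -/
lemma sum_traceEntropy_sub_le (Z : Finset ι) :
    ∑ i ∈ Z, traceEntropy Ω {i} - traceEntropy Ω Z ≤ ∑ i ∈ Z, traceInfo Ω i (Z.erase i) := by
  induction Z using Finset.induction_on with
  | empty => simp [traceEntropy_empty]
  | insert i Z hi ih =>
    rw [Finset.sum_insert hi, Finset.sum_insert hi, Finset.erase_insert hi]
    have h1 : ∑ j ∈ Z, traceInfo Ω j (Z.erase j) ≤ ∑ j ∈ Z, traceInfo Ω j ((insert i Z).erase j) :=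
      Finset.sum_le_sum fun j _ =>
        traceInfo_mono j (Finset.erase_subset_erase j (Finset.subset_insert i Z))
    have h2 : traceInfo Ω i Z =
      traceEntropy Ω {i} + traceEntropy Ω Z - traceEntropy Ω (insert i Z) := rfl
    linarith

lemma familyAvg_traceEntropy_traceClass (Z T : Finset ι) :
    familyAvg Ω (fun ω => traceEntropy (traceClass Ω Z ω) T) =
      traceEntropy Ω (T ∪ Z) - traceEntropy Ω Z := by
  have h1 : ∀ ω ∈ Ω, traceEntropy (traceClass Ω Z ω) T = familyAvg (traceClass Ω Z ω) fun ω' =>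
      Real.log ((traceClass Ω Z ω').card / (traceClass Ω (T ∪ Z) ω').card) := by
    intro ω _
    refine familyAvg_congr fun ω' h' => ?_
    rw [traceClass_traceClass T Z ω ω' h', traceClass_eq (mem_traceClass.1 h').2]
  rw [familyAvg_congr h1, familyAvg_traceClass]
  unfold traceEntropy
  rw [← familyAvg_sub]
  refine familyAvg_congr fun ω hω => ?_
  have hn : (0 : ℝ) < Ω.card := by exact_mod_cast Finset.card_pos.2 ⟨ω, hω⟩
  have a := (traceClass_card_pos (T := T ∪ Z) hω).ne'
  have b := (traceClass_card_pos (T := Z) hω).ne'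
  rw [Real.log_div b a, Real.log_div hn.ne' a, Real.log_div hn.ne' b]
  ring

variable [Fintype ι]

/-- Every family contains a large subfamily in which the trace on any set `Z` carries little
information about single elements, compared with its entropy. -/
lemma exists_subfamily_sum_traceInfo_le (hΩ : Ω.Nonempty) {α : ℝ} (hα : 0 < α) :
    ∃ Ω' ⊆ Ω, Ω'.Nonempty ∧
      Real.log Ω.card - Fintype.card ι * Real.log 2 / α ≤ Real.log Ω'.card ∧
      ∀ Z, ∑ i, traceInfo Ω' i Z ≤ α * traceEntropy Ω' Z := by
  set G : Finset (Finset ι) → ℝ := fun Ω' => ∑ i, traceEntropy Ω' {i} - α * Real.log Ω'.card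
    with hG
  obtain ⟨Ω', hmem, hmin⟩ := Finset.exists_min_image (Ω.powerset.filter Finset.Nonempty) G
    ⟨Ω, Finset.mem_filter.2 ⟨Finset.mem_powerset_self Ω, hΩ⟩⟩
  obtain ⟨hsub, hne⟩ := Finset.mem_filter.1 hmem
  rw [Finset.mem_powerset] at hsub
  refine ⟨Ω', hsub, hne, ?_, fun Z => ?_⟩
  · have h1 := hmin Ω (Finset.mem_filter.2 ⟨Finset.mem_powerset_self Ω, hΩ⟩)
    have h2 : 0 ≤ ∑ i, traceEntropy Ω' {i} := Finset.sum_nonneg fun i _ => traceEntropy_nonneg _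
    have h3 : ∑ i, traceEntropy Ω {i} ≤ Fintype.card ι * Real.log 2 := by
      calc ∑ i, traceEntropy Ω {i} ≤ ∑ _i : ι, Real.log 2 :=
            Finset.sum_le_sum fun i _ => by simpa using traceEntropy_le hΩ {i}
        _ = Fintype.card ι * Real.log 2 := by simp
    simp only [hG] at h1
    rw [sub_le_iff_le_add, ← sub_le_iff_le_add', le_div_iff₀ hα]
    linarith
  · have h1 : familyAvg Ω' (fun _ => G Ω') ≤ familyAvg Ω' (fun ω => G (traceClass Ω' Z ω)) := by
      refine familyAvg_mono fun ω hω => hmin _ (Finset.mem_filter.2 ⟨?_, ω, ?_⟩)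
      · exact Finset.mem_powerset.2 ((Finset.filter_subset _ _).trans hsub)
      · exact mem_traceClass.2 ⟨hω, rfl⟩
    have h2 : familyAvg Ω' (fun ω => Real.log (traceClass Ω' Z ω).card) =
        Real.log Ω'.card - traceEntropy Ω' Z := by
      unfold traceEntropy
      rw [← familyAvg_const hne (Real.log Ω'.card), ← familyAvg_sub]
      refine familyAvg_congr fun ω hω => ?_
      have hn : (Ω'.card : ℝ) ≠ 0 := by exact_mod_cast hne.card_pos.ne'
      rw [Real.log_div hn (traceClass_card_pos hω).ne']
      ring
    simp only [hG] at h1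
    rw [familyAvg_const hne, familyAvg_sub, familyAvg_sum, familyAvg_const_mul, h2] at h1
    simp_rw [familyAvg_traceEntropy_traceClass] at h1
    have h3 : ∑ i, traceInfo Ω' i Z = ∑ i, traceEntropy Ω' {i} -
        ∑ i : ι, (traceEntropy Ω' ({i} ∪ Z) - traceEntropy Ω' Z) := by
      rw [← Finset.sum_sub_distrib]
      refine Finset.sum_congr rfl fun i _ => ?_
      unfold traceInfo
      rw [Finset.insert_eq]
      ring
    rw [h3]
    linarith

end Entropy

/-- The proportion of the members of `Ω` which contain `i`. -/
def marginal {ι : Type*} [DecidableEq ι] (Ω : Finset (Finset ι)) (i : ι) : ℝ :=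
  familyAvg Ω fun ω => if i ∈ ω then 1 else 0

section EntropyJanson

variable {ι : Type*} [DecidableEq ι] {Ω : Finset (Finset ι)}

lemma marginal_nonneg (i : ι) : 0 ≤ marginal Ω i :=
  div_nonneg (Finset.sum_nonneg fun _ _ => by split_ifs <;> norm_num) (Nat.cast_nonneg _)

lemma marginal_le_one (i : ι) : marginal Ω i ≤ 1 := by
  refine div_le_one_of_le₀ ?_ (Nat.cast_nonneg _)
  calc ∑ ω ∈ Ω, (if i ∈ ω then (1 : ℝ) else 0) ≤ ∑ ω ∈ Ω, (1 : ℝ) :=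
        Finset.sum_le_sum fun _ _ => by split_ifs <;> norm_num
    _ = Ω.card := by simp

lemma traceClass_singleton_card_div {i : ι} {ω : Finset ι} (hω : ω ∈ Ω) :
    ((traceClass Ω {i} ω).card : ℝ) / Ω.card =
      if i ∈ ω then marginal Ω i else 1 - marginal Ω i := by
  have hn : (Ω.card : ℝ) ≠ 0 := by exact_mod_cast (Finset.card_pos.2 ⟨ω, hω⟩).ne'
  have hiff : ∀ x : Finset ι, x ∩ {i} = ω ∩ {i} ↔ (i ∈ x ↔ i ∈ ω) := by
    intro x
    constructor
    · intro h
      simpa using congrArg (fun s => i ∈ s) h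
    · intro h
      ext y
      simp only [Finset.mem_inter, Finset.mem_singleton]
      constructor <;> rintro ⟨h1, rfl⟩ <;> simp_all
  have hcard : ((traceClass Ω {i} ω).card : ℝ) = ∑ x ∈ Ω, if (i ∈ x ↔ i ∈ ω) then 1 else 0 := by
    unfold traceClass
    rw [Finset.card_filter]
    push_cast
    exact Finset.sum_congr rfl fun x _ => by simp only [hiff]
  rw [hcard]
  unfold marginal familyAvg
  by_cases hi : i ∈ ω
  · simp [hi]
  · simp only [hi, iff_false, if_false]
    rw [eq_sub_iff_add_eq, ← add_div, ← Finset.sum_add_distrib, div_eq_one_iff_eq hn]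
    rw [Finset.sum_congr rfl (g := fun _ => (1 : ℝ)) fun x _ => by split_ifs <;> simp_all]
    simp

lemma ite_marginal_pos {i : ι} {ω : Finset ι} (hω : ω ∈ Ω) :
    0 < if i ∈ ω then marginal Ω i else 1 - marginal Ω i := by
  rw [← traceClass_singleton_card_div hω]
  exact div_pos (traceClass_card_pos hω) (by exact_mod_cast Finset.card_pos.2 ⟨ω, hω⟩)

lemma traceEntropy_singleton (i : ι) :
    traceEntropy Ω {i} =
      -familyAvg Ω fun ω => Real.log (if i ∈ ω then marginal Ω i else 1 - marginal Ω i) := by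
  rw [← neg_one_mul, ← familyAvg_const_mul]
  refine familyAvg_congr fun ω hω => ?_
  rw [← traceClass_singleton_card_div hω, neg_one_mul, ← Real.log_inv, inv_div]

variable [Fintype ι]

lemma sum_bernoulliWeight_const_card (q : ℝ) :
    ∑ Z : Finset ι, bernoulliWeight (fun _ => q) Z * (Z.card : ℝ) = q * Fintype.card ι := by
  have h : ∀ Z : Finset ι, bernoulliWeight (fun _ => q) Z * (Z.card : ℝ) =
      ∑ i, bernoulliWeight (fun _ => q) Z * if i ∈ Z then 1 else 0 := by
    intro Z
    rw [← Finset.mul_sum]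
    simp
  simp_rw [h]
  rw [Finset.sum_comm]
  simp_rw [sum_bernoulliWeight_mem (fun _ => q) _ (fun _ => (1 : ℝ)), mul_one,
    sum_bernoulliWeight]
  simp [mul_comm]

/-- If traces carry little information, then a sparse random set has small expected total
correlation. -/
lemma sum_bernoulliWeight_totalCorrelation_le (hΩ : Ω.Nonempty) {α q : ℝ} (hα : 0 ≤ α)
    (hq0 : 0 ≤ q) (hq1 : q ≤ 1)
    (h : ∀ Z, ∑ i, traceInfo Ω i Z ≤ α * traceEntropy Ω Z) :
    ∑ Z, bernoulliWeight (fun _ => q) Z * (∑ i ∈ Z, traceEntropy Ω {i} - traceEntropy Ω Z) ≤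
      q ^ 2 * α * (Fintype.card ι * Real.log 2) := by
  have hw : ∀ Z : Finset ι, 0 ≤ bernoulliWeight (fun _ => q) Z :=
    bernoulliWeight_nonneg (fun _ => hq0) (fun _ => hq1)
  calc ∑ Z, bernoulliWeight (fun _ => q) Z * (∑ i ∈ Z, traceEntropy Ω {i} - traceEntropy Ω Z)
      ≤ ∑ Z, bernoulliWeight (fun _ => q) Z * ∑ i ∈ Z, traceInfo Ω i (Z.erase i) :=
        Finset.sum_le_sum fun Z _ =>
          mul_le_mul_of_nonneg_left (sum_traceEntropy_sub_le Z) (hw Z)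
    _ = ∑ Z, ∑ i, bernoulliWeight (fun _ => q) Z *
          (if i ∈ Z then traceInfo Ω i (Z.erase i) else 0) := by
        refine Finset.sum_congr rfl fun Z _ => ?_
        rw [← Finset.mul_sum]
        simp
    _ = ∑ i, q * ∑ Z, bernoulliWeight (fun _ => q) Z * traceInfo Ω i ((insert i Z).erase i) := by
        rw [Finset.sum_comm]
        exact Finset.sum_congr rfl fun i _ =>
          sum_bernoulliWeight_mem (fun _ => q) i (fun Z => traceInfo Ω i (Z.erase i))
    _ ≤ ∑ i, q * ∑ Z, bernoulliWeight (fun _ => q) Z * traceInfo Ω i Z := by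
        refine Finset.sum_le_sum fun i _ => mul_le_mul_of_nonneg_left
          (Finset.sum_le_sum fun Z _ => mul_le_mul_of_nonneg_left (traceInfo_mono i ?_) (hw Z)) hq0
        exact Finset.erase_insert_subset i Z
    _ = q * ∑ Z, bernoulliWeight (fun _ => q) Z * ∑ i, traceInfo Ω i Z := by
        rw [← Finset.mul_sum, Finset.sum_comm]
        simp_rw [Finset.mul_sum]
    _ ≤ q * ∑ Z : Finset ι, bernoulliWeight (fun _ => q) Z * (α * (Z.card * Real.log 2)) :=
        mul_le_mul_of_nonneg_left (Finset.sum_le_sum fun Z _ => mul_le_mul_of_nonneg_left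
          ((h Z).trans (mul_le_mul_of_nonneg_left (traceEntropy_le hΩ Z) hα)) (hw Z)) hq0
    _ = q * (α * Real.log 2 * ∑ Z : Finset ι, bernoulliWeight (fun _ => q) Z * (Z.card : ℝ)) := by
        congr 1
        rw [Finset.mul_sum]
        exact Finset.sum_congr rfl fun Z _ => by ring
    _ = q ^ 2 * α * (Fintype.card ι * Real.log 2) := by
        rw [sum_bernoulliWeight_const_card]
        ring

/-- Sampling each element of a `q`-random set `Z` with probabilities `b` amounts to sampling
with probabilities `q b`. -/
lemma sum_bernoulliWeight_thinning (q : ℝ) (b : ι → ℝ) (g : Finset ι → ℝ) :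
    ∑ Z, bernoulliWeight (fun _ => q) Z *
        ∑ a ∈ Z.powerset, (∏ i ∈ Z, if i ∈ a then b i else 1 - b i) * g a =
      ∑ a, bernoulliWeight (fun i => q * b i) a * g a := by
  have h1 : ∀ Z : Finset ι, bernoulliWeight (fun _ => q) Z *
        ∑ a ∈ Z.powerset, (∏ i ∈ Z, if i ∈ a then b i else 1 - b i) * g a =
      ∑ a, (∏ i, if i ∈ Z then (if i ∈ a then q * b i else q * (1 - b i)) else
        if i ∈ a then 0 else 1 - q) * g a := by
    intro Z
    rw [Finset.mul_sum, ← Finset.sum_filter_add_sum_filter_not Finset.univ (fun a => a ⊆ Z),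
      Finset.sum_eq_zero (s := Finset.univ.filter fun a => ¬ a ⊆ Z), add_zero]
    · refine Finset.sum_congr (by ext; simp) fun a ha => ?_
      rw [← mul_assoc]
      congr 1
      have haZ : a ⊆ Z := (Finset.mem_filter.1 ha).2
      rw [← Finset.prod_filter_mul_prod_filter_not Finset.univ (fun i => i ∈ Z) (fun i =>
        if i ∈ Z then (if i ∈ a then q * b i else q * (1 - b i)) else if i ∈ a then 0 else 1 - q)]
      unfold bernoulliWeight
      rw [← Finset.prod_filter_mul_prod_filter_not Finset.univ (fun i => i ∈ Z) (fun i =>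
        if i ∈ Z then q else 1 - q)]
      have e0 : Finset.univ.filter (fun i => i ∈ Z) = Z := by ext; simp
      rw [e0, mul_right_comm, ← Finset.prod_mul_distrib]
      congr 1
      · refine Finset.prod_congr rfl fun i hi => ?_
        rw [if_pos hi, if_pos hi]
        split_ifs <;> rfl
      · refine Finset.prod_congr rfl fun i hi => ?_
        have hi' := (Finset.mem_filter.1 hi).2
        rw [if_neg hi', if_neg hi', if_neg fun h => hi' (haZ h)]
    · intro a ha
      obtain ⟨i, hia, hiZ⟩ := Finset.not_subset.1 (Finset.mem_filter.1 ha).2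
      rw [Finset.prod_eq_zero (Finset.mem_univ i) (by rw [if_neg hiZ, if_pos hia]), zero_mul]
  simp_rw [h1]
  rw [Finset.sum_comm]
  refine Finset.sum_congr rfl fun a _ => ?_
  rw [← Finset.sum_mul, sum_prod_ite_mem]
  congr 1
  refine Finset.prod_congr rfl fun i _ => ?_
  split_ifs <;> ring

variable {κ : Type*} {K : Finset κ} {e : κ → Finset ι} {ν : κ → ℝ}

lemma sum_bernoulliWeight_normalizedCount_inter {q : ℝ} (hq : q ≠ 0) (b : ι → ℝ) (ω : Finset ι) :
    ∑ Z, bernoulliWeight (fun _ => q) Z *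
        normalizedCount (fun i => q * b i) K e ν (ω ∩ Z) =
      normalizedCount b K e ν ω := by
  unfold normalizedCount
  simp_rw [Finset.mul_sum]
  rw [Finset.sum_comm]
  refine Finset.sum_congr rfl fun k _ => ?_
  by_cases h : e k ⊆ ω
  · have h1 : ∀ Z, e k ⊆ ω ∩ Z ↔ e k ⊆ Z := fun Z => by simp [Finset.subset_inter_iff, h]
    simp only [h1]
    rw [sum_bernoulliWeight_subset (fun _ => q) (e k)
      (fun _ => ν k / ∏ i ∈ e k, q * b i), ← Finset.sum_mul, sum_bernoulliWeight, one_mul,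
      if_pos h, Finset.prod_mul_distrib, Finset.prod_const]
    field_simp
  · have h1 : ∀ Z, ¬ e k ⊆ ω ∩ Z := fun Z h' => h (h'.trans Finset.inter_subset_left)
    simp [h1, h]

/-- If the traces of `Ω` carry little information, then the weighted number of edges in a typical
member of `Ω` is not much smaller than it would be under independent sampling. -/
lemma janson_of_traceInfo_le (hΩ : Ω.Nonempty) {α q t : ℝ} (hα : 0 ≤ α) (hq0 : 0 < q)
    (hq1 : q ≤ 1) (h : ∀ Z, ∑ i, traceInfo Ω i Z ≤ α * traceEntropy Ω Z)
    (hν : ∀ k ∈ K, 0 ≤ ν k) (hpos : ∀ k ∈ K, ∀ i ∈ e k, 0 < marginal Ω i) (ht : 0 ≤ t) :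
    t * ∑ k ∈ K, ν k - t ^ 2 / 2 * jansonDelta (fun i => q * marginal Ω i) K e ν ≤
      t * familyAvg Ω (normalizedCount (marginal Ω) K e ν) +
        q ^ 2 * α * (Fintype.card ι * Real.log 2) := by
  set b := marginal Ω with hb
  set X := normalizedCount (fun i => q * b i) K e ν with hX
  set c := -t * ∑ k ∈ K, ν k + t ^ 2 / 2 * jansonDelta (fun i => q * b i) K e ν with hc
  have hw : ∀ Z : Finset ι, 0 ≤ bernoulliWeight (fun _ => q) Z :=
    bernoulliWeight_nonneg (fun _ => hq0.le) (fun _ => hq1)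
  set S : Finset ι → ℝ := fun Z =>
    ∑ a ∈ Z.powerset, (∏ i ∈ Z, if i ∈ a then b i else 1 - b i) * Real.exp (-t * X a) with hS
  have hbnn : ∀ (a : Finset ι) i, 0 ≤ if i ∈ a then b i else 1 - b i := by
    intro a i
    split_ifs
    · exact marginal_nonneg i
    · exact sub_nonneg.2 (marginal_le_one i)
  have hpi : ∀ (Z : Finset ι), ∀ ω ∈ Ω,
      0 < (∏ i ∈ Z, if i ∈ ω ∩ Z then b i else 1 - b i) := by
    intro Z ω hω
    refine Finset.prod_pos fun i hi => ?_
    simp only [Finset.mem_inter, hi, and_true]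
    exact ite_marginal_pos hω
  have h1 : ∀ Z, -(∑ i ∈ Z, traceEntropy Ω {i} - traceEntropy Ω Z) -
      t * familyAvg Ω (fun ω => X (ω ∩ Z)) ≤ S Z / Real.exp c - 1 + c := by
    intro Z
    have hg := traceEntropy_add_familyAvg_log_le hΩ Z
      (π := fun a => (∏ i ∈ Z, if i ∈ a then b i else 1 - b i) * Real.exp (-t * X a))
      (fun a => mul_nonneg (Finset.prod_nonneg fun i _ => hbnn a i) (Real.exp_pos _).le)
      (fun ω hω => mul_pos (hpi Z ω hω) (Real.exp_pos _))
    have hSpos : 0 < S Z := by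
      obtain ⟨ω, hω⟩ := hΩ
      refine Finset.sum_pos'
        (fun a _ => mul_nonneg (Finset.prod_nonneg fun i _ => hbnn a i) (Real.exp_pos _).le)
        ⟨ω ∩ Z, Finset.mem_powerset.2 Finset.inter_subset_right,
          mul_pos (hpi Z ω hω) (Real.exp_pos _)⟩
    have hl := log_le_div_sub_one_add_log hSpos (Real.exp_pos c)
    rw [Real.log_exp] at hl
    have he : familyAvg Ω (fun ω => Real.log
        ((∏ i ∈ Z, if i ∈ ω ∩ Z then b i else 1 - b i) * Real.exp (-t * X (ω ∩ Z)))) =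
        -∑ i ∈ Z, traceEntropy Ω {i} - t * familyAvg Ω (fun ω => X (ω ∩ Z)) := by
      have h2 : ∀ ω ∈ Ω, Real.log
          ((∏ i ∈ Z, if i ∈ ω ∩ Z then b i else 1 - b i) * Real.exp (-t * X (ω ∩ Z))) =
          ∑ i ∈ Z, Real.log (if i ∈ ω then b i else 1 - b i) - t * X (ω ∩ Z) := by
        intro ω hω
        rw [Real.log_mul (hpi Z ω hω).ne' (Real.exp_pos _).ne', Real.log_exp, Real.log_prod]
        · rw [neg_mul, ← sub_eq_add_neg]
          congr 1
          exact Finset.sum_congr rfl fun i hi => by simp [hi]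
        · intro i hi
          simp only [Finset.mem_inter, hi, and_true]
          exact (ite_marginal_pos hω).ne'
      rw [familyAvg_congr h2, familyAvg_sub, familyAvg_sum, familyAvg_const_mul,
        ← Finset.sum_neg_distrib]
      congr 1
      exact Finset.sum_congr rfl fun i _ => by rw [traceEntropy_singleton, neg_neg]
    rw [he] at hg
    linarith
  have h2 := Finset.sum_le_sum fun Z (_ : Z ∈ Finset.univ) => mul_le_mul_of_nonneg_left (h1 Z) (hw Z)
  have hthin : ∑ Z, bernoulliWeight (fun _ => q) Z * S Z ≤ Real.exp c := by
    rw [hS, sum_bernoulliWeight_thinning]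
    refine janson_laplace (fun i => mul_nonneg hq0.le (marginal_nonneg i)) (fun i => ?_) hν
      (fun k hk i hi => mul_pos hq0 (hpos k hk i hi)) ht
    exact mul_le_one₀ hq1 (marginal_nonneg i) (marginal_le_one i)
  have hR : ∑ Z, bernoulliWeight (fun _ => q) Z * (S Z / Real.exp c - 1 + c) ≤ c := by
    have e1 : ∀ Z : Finset ι, bernoulliWeight (fun _ => q) Z * (S Z / Real.exp c - 1 + c) =
        (bernoulliWeight (fun _ => q) Z * S Z) / Real.exp c +
          bernoulliWeight (fun _ => q) Z * (c - 1) := fun Z => by ring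
    simp_rw [e1]
    rw [Finset.sum_add_distrib, ← Finset.sum_div, ← Finset.sum_mul, sum_bernoulliWeight]
    have := (div_le_one (Real.exp_pos c)).2 hthin
    linarith
  have hX' : ∑ Z, bernoulliWeight (fun _ => q) Z * familyAvg Ω (fun ω => X (ω ∩ Z)) =
      familyAvg Ω (normalizedCount b K e ν) := by
    simp_rw [← familyAvg_const_mul]
    rw [← familyAvg_sum]
    exact familyAvg_congr fun ω _ => sum_bernoulliWeight_normalizedCount_inter hq0.ne' b ω
  have hL : ∑ Z, bernoulliWeight (fun _ => q) Z *
      (-(∑ i ∈ Z, traceEntropy Ω {i} - traceEntropy Ω Z) -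
        t * familyAvg Ω (fun ω => X (ω ∩ Z))) =
      -∑ Z, bernoulliWeight (fun _ => q) Z * (∑ i ∈ Z, traceEntropy Ω {i} - traceEntropy Ω Z) -
        t * familyAvg Ω (normalizedCount b K e ν) := by
    rw [← hX', Finset.mul_sum, ← Finset.sum_neg_distrib, ← Finset.sum_sub_distrib]
    exact Finset.sum_congr rfl fun Z _ => by ring
  rw [hL] at h2
  have h3 := sum_bernoulliWeight_totalCorrelation_le hΩ hα hq0.le hq1 h
  linarith [h2.trans hR]

end EntropyJanson

/-- The sum of the squares of the vertex degrees of `ν`. -/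
def vertexEnergy {V : Type*} [Fintype V] (ν : Finset V → ℝ) : ℝ :=
  ∑ v, dMass Finset.univ ν {v} ^ 2

section Measures

variable {V : Type*}

lemma IsMeasureOn.dMass_eq [Fintype V] {H : Finset (Finset V)} {ν : Finset V → ℝ}
    (h : IsMeasureOn H ν) (L : Finset V) : dMass H ν L = dMass Finset.univ ν L := by
  refine Finset.sum_subset (Finset.filter_subset_filter _ (Finset.subset_univ _)) ?_
  intro E h1 h2
  exact h.2 E fun hE => h2 (Finset.mem_filter.2 ⟨hE, (Finset.mem_filter.1 h1).2⟩)

lemma IsMeasureOn.lamP_eq [Fintype V] {H : Finset (Finset V)} {ν : Finset V → ℝ}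
    (h : IsMeasureOn H ν) (p : ℝ) : lamP p H ν = lamP p Finset.univ ν := by
  unfold lamP
  simp_rw [h.dMass_eq]

lemma IsMeasureOn.eMass_eq [Fintype V] {H : Finset (Finset V)} {ν : Finset V → ℝ}
    (h : IsMeasureOn H ν) : eMass H ν = ∑ E, ν E :=
  Finset.sum_subset (Finset.subset_univ _) fun E _ hE => h.2 E hE

variable [Fintype V] {p : ℝ} {ν μ : Finset V → ℝ}

lemma dMass_nonneg (hν : ∀ E, 0 ≤ ν E) (L : Finset V) : 0 ≤ dMass Finset.univ ν L :=
  Finset.sum_nonneg fun E _ => hν E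

lemma dMass_mono (h : ∀ E, ν E ≤ μ E) (L : Finset V) :
    dMass Finset.univ ν L ≤ dMass Finset.univ μ L :=
  Finset.sum_le_sum fun E _ => h E

lemma dMass_add (ν μ : Finset V → ℝ) (L : Finset V) :
    dMass Finset.univ (fun E => ν E + μ E) L = dMass Finset.univ ν L + dMass Finset.univ μ L :=
  Finset.sum_add_distrib

lemma dMass_mul (c : ℝ) (ν : Finset V → ℝ) (L : Finset V) :
    dMass Finset.univ (fun E => c * ν E) L = c * dMass Finset.univ ν L :=
  (Finset.mul_sum _ _ _).symm

lemma lamP_nonneg (hp : 0 < p) (ν : Finset V → ℝ) : 0 ≤ lamP p Finset.univ ν :=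
  Finset.sum_nonneg fun L _ => by positivity

lemma lamP_mul (c : ℝ) (ν : Finset V → ℝ) :
    lamP p Finset.univ (fun E => c * ν E) = c ^ 2 * lamP p Finset.univ ν := by
  unfold lamP
  rw [Finset.mul_sum]
  refine Finset.sum_congr rfl fun L _ => ?_
  rw [dMass_mul]
  ring

lemma lamP_mono (hp : 0 < p) (hν : ∀ E, 0 ≤ ν E) (h : ∀ E, ν E ≤ μ E) :
    lamP p Finset.univ ν ≤ lamP p Finset.univ μ := by
  refine Finset.sum_le_sum fun L _ => div_le_div_of_nonneg_right ?_ (by positivity)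
  exact pow_le_pow_left₀ (dMass_nonneg hν L) (dMass_mono h L) 2

lemma vertexEnergy_mul (c : ℝ) (ν : Finset V → ℝ) :
    vertexEnergy (fun E => c * ν E) = c ^ 2 * vertexEnergy ν := by
  unfold vertexEnergy
  rw [Finset.mul_sum]
  refine Finset.sum_congr rfl fun L _ => ?_
  rw [dMass_mul]
  ring

lemma vertexEnergy_mono (hν : ∀ E, 0 ≤ ν E) (h : ∀ E, ν E ≤ μ E) :
    vertexEnergy ν ≤ vertexEnergy μ :=
  Finset.sum_le_sum fun _ _ => pow_le_pow_left₀ (dMass_nonneg hν _) (dMass_mono h _) 2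

lemma vertexEnergy_nonneg (ν : Finset V → ℝ) : 0 ≤ vertexEnergy ν :=
  Finset.sum_nonneg fun _ _ => sq_nonneg _

lemma sum_dMass_mul (𝓛 : Finset (Finset V)) (ν f : Finset V → ℝ) :
    ∑ L ∈ 𝓛, dMass Finset.univ ν L * f L = ∑ E, ν E * ∑ L ∈ 𝓛.filter (fun L => L ⊆ E), f L := by
  unfold dMass
  simp_rw [Finset.sum_mul, Finset.mul_sum, Finset.sum_filter]
  rw [Finset.sum_comm]

lemma sum_dMass_singleton_mul (ν : Finset V → ℝ) (f : V → ℝ) :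
    ∑ v, dMass Finset.univ ν {v} * f v = ∑ E, ν E * ∑ v ∈ E, f v := by
  unfold dMass
  simp_rw [Finset.sum_mul, Finset.mul_sum, Finset.sum_filter]
  rw [Finset.sum_comm]
  refine Finset.sum_congr rfl fun E _ => ?_
  rw [← Finset.sum_filter]
  exact Finset.sum_congr (by ext; simp) fun _ _ => rfl

lemma IsJanson.exists_prob {R : ℝ} {H : Finset (Finset V)} (hp : 0 < p) (hR : 0 < R)
    (h : IsJanson p R H) : ∃ ν : Finset V → ℝ, IsMeasureOn H ν ∧ ∑ E, ν E = 1 ∧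
      lamP p Finset.univ ν < 1 / R := by
  obtain ⟨ν, hν, hlam⟩ := h hR
  rw [hν.lamP_eq, hν.eMass_eq] at hlam
  have he0 : 0 ≤ ∑ E, ν E := Finset.sum_nonneg fun E _ => hν.1 E
  have he : 0 < ∑ E, ν E := by
    refine lt_of_le_of_ne he0 fun h0 => ?_
    rw [← h0] at hlam
    have := lamP_nonneg hp ν
    norm_num at hlam
    linarith
  refine ⟨fun E => (∑ E, ν E)⁻¹ * ν E, ⟨fun E => mul_nonneg (inv_nonneg.2 he0) (hν.1 E),
    fun E hE => by simp [hν.2 E hE]⟩, ?_, ?_⟩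
  · rw [← Finset.mul_sum, inv_mul_cancel₀ he.ne']
  · rw [lamP_mul, inv_pow, inv_mul_lt_iff₀ (by positivity), mul_one_div]
    exact hlam

lemma isJanson_of_prob {R : ℝ} {H : Finset (Finset V)} (h : IsMeasureOn H ν)
    (hlam : lamP p Finset.univ ν < (∑ E, ν E) ^ 2 / R) : IsJanson p R H :=
  fun _ => ⟨ν, h, by rwa [h.lamP_eq, h.eMass_eq]⟩

lemma lamP_convex (hp : 0 < p) {t : ℝ} (ht0 : 0 ≤ t) (ht1 : t ≤ 1) (ν μ : Finset V → ℝ) :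
    lamP p Finset.univ (fun E => (1 - t) * ν E + t * μ E) ≤
      (1 - t) * lamP p Finset.univ ν + t * lamP p Finset.univ μ := by
  unfold lamP
  rw [Finset.mul_sum, Finset.mul_sum, ← Finset.sum_add_distrib]
  refine Finset.sum_le_sum fun L _ => ?_
  rw [dMass_add, dMass_mul, dMass_mul, ← mul_div_assoc, ← mul_div_assoc, ← add_div]
  refine div_le_div_of_nonneg_right ?_ (by positivity)
  have : 0 ≤ (1 - t) * t * (dMass Finset.univ ν L - dMass Finset.univ μ L) ^ 2 :=
    mul_nonneg (mul_nonneg (by linarith) ht0) (sq_nonneg _)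
  nlinarith

lemma continuous_dMass (L : Finset V) :
    Continuous fun ν : Finset V → ℝ => dMass Finset.univ ν L :=
  continuous_finsetSum _ fun E _ => continuous_apply E

/-- If all large induced subhypergraphs of a uniform hypergraph are Janson, then there is a
witnessing measure in which the vertex degrees are well spread. -/
lemma exists_prob_vertexEnergy_le {s : ℕ} {H : Finset (Finset V)} (hunif : ∀ E ∈ H, E.card = s)
    {R N τ : ℝ} (hp : 0 < p) (hR : 0 < R) (hτ : 0 < τ)
    (hH : ∀ W : Finset V, N ≤ W.card → IsJanson p R (indHG H W)) {W : Finset V}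
    (hW : N + s / τ ≤ W.card) :
    ∃ ν : Finset V → ℝ, IsMeasureOn (indHG H W) ν ∧ ∑ E, ν E = 1 ∧
      lamP p Finset.univ ν ≤ 1 / R ∧ vertexEnergy ν ≤ τ * s := by
  set S : Set (Finset V → ℝ) := {ν | (∀ E, 0 ≤ ν E) ∧ (∀ E, E ∉ indHG H W → ν E = 0) ∧
    ∑ E, ν E = 1 ∧ lamP p Finset.univ ν ≤ 1 / R} with hS
  have hne : S.Nonempty := by
    have hs : (0 : ℝ) ≤ s / τ := by positivity
    obtain ⟨ν, h1, h2, h3⟩ := (hH W (by linarith)).exists_prob hp hR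
    exact ⟨ν, h1.1, h1.2, h2, h3.le⟩
  have hcomp : IsCompact S := by
    have hsub : S ⊆ Set.Icc (fun _ => 0) (fun _ => 1) := by
      intro ν hν
      refine ⟨fun E => hν.1 E, fun E => ?_⟩
      change ν E ≤ 1
      rw [← hν.2.2.1]
      exact Finset.single_le_sum (fun E _ => hν.1 E) (Finset.mem_univ E)
    refine IsCompact.of_isClosed_subset isCompact_Icc ?_ hsub
    have c1 : IsClosed {ν : Finset V → ℝ | ∀ E, 0 ≤ ν E} := by
      simp only [Set.ofPred_forall]
      exact isClosed_iInter fun E => isClosed_le continuous_const (continuous_apply E)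
    have c2 : IsClosed {ν : Finset V → ℝ | ∀ E, E ∉ indHG H W → ν E = 0} := by
      simp only [Set.ofPred_forall]
      exact isClosed_iInter fun E => isClosed_iInter fun _ =>
        isClosed_eq (continuous_apply E) continuous_const
    have c3 : IsClosed {ν : Finset V → ℝ | ∑ E, ν E = 1} :=
      isClosed_eq (continuous_finsetSum _ fun E _ => continuous_apply E) continuous_const
    have c4 : IsClosed {ν : Finset V → ℝ | lamP p Finset.univ ν ≤ 1 / R} :=
      isClosed_le (continuous_finsetSum _ fun L _ => ((continuous_dMass L).pow 2).div_const _)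
        continuous_const
    exact c1.inter (c2.inter (c3.inter c4))
  obtain ⟨ν, hνS, hmin⟩ := hcomp.exists_isMinOn hne (f := vertexEnergy)
    (continuous_finsetSum _ fun v _ => (continuous_dMass {v}).pow 2).continuousOn
  obtain ⟨hν0, hνH, hν1, hνlam⟩ := hνS
  refine ⟨ν, ⟨hν0, hνH⟩, hν1, hνlam, ?_⟩
  have hdeg : ∀ μ : Finset V → ℝ, (∀ E, E ∉ H → μ E = 0) → ∑ E, μ E = 1 →
      ∑ v, dMass Finset.univ μ {v} = s := by
    intro μ hμ hμ1
    have h1 := sum_dMass_singleton_mul μ (fun _ => (1 : ℝ))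
    simp only [mul_one, Finset.sum_const, nsmul_eq_mul] at h1
    rw [h1]
    have h2 : ∀ E ∈ Finset.univ, μ E * (E.card : ℝ) = μ E * s := by
      intro E _
      by_cases hE : E ∈ H
      · rw [hunif E hE]
      · rw [hμ E hE, zero_mul, zero_mul]
    rw [Finset.sum_congr rfl h2, ← Finset.sum_mul, hμ1, one_mul]
  have hHind : ∀ {X : Finset V} {E : Finset V}, E ∉ H → E ∉ indHG H X :=
    fun hE h => hE (Finset.mem_filter.1 h).1
  set B := Finset.univ.filter fun v => τ < dMass Finset.univ ν {v} with hB
  have hBcard : (B.card : ℝ) ≤ s / τ := by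
    rw [le_div_iff₀ hτ, ← hdeg ν (fun E hE => hνH E (hHind hE)) hν1]
    calc (B.card : ℝ) * τ = ∑ v ∈ B, τ := by simp
      _ ≤ ∑ v ∈ B, dMass Finset.univ ν {v} :=
          Finset.sum_le_sum fun v hv => (Finset.mem_filter.1 hv).2.le
      _ ≤ ∑ v, dMass Finset.univ ν {v} :=
          Finset.sum_le_sum_of_subset_of_nonneg (Finset.subset_univ _) fun v _ _ =>
            dMass_nonneg hν0 _
  have hWB : N ≤ ((W \ B).card : ℝ) := by
    have : (W.card : ℝ) ≤ (W \ B).card + B.card := by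
      have := Finset.card_le_card_sdiff_add_card (s := W) (t := B)
      exact_mod_cast this
    linarith
  obtain ⟨μ, hμ, hμ1, hμlam⟩ := (hH _ hWB).exists_prob hp hR
  have hμW : ∀ E, E ∉ indHG H W → μ E = 0 := by
    intro E hE
    refine hμ.2 E fun h => hE ?_
    have := Finset.mem_filter.1 h
    exact Finset.mem_filter.2 ⟨this.1, this.2.trans Finset.sdiff_subset⟩
  set I := ∑ v, dMass Finset.univ ν {v} * dMass Finset.univ μ {v} with hI
  have hIle : I ≤ τ * s := by
    rw [← hdeg μ (fun E hE => hμ.2 E (hHind hE)) hμ1, Finset.mul_sum]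
    refine Finset.sum_le_sum fun v _ => ?_
    by_cases hv : v ∈ B
    · have : dMass Finset.univ μ {v} = 0 := by
        refine Finset.sum_eq_zero fun E hE => hμ.2 E fun h => ?_
        have h1 := (Finset.mem_filter.1 hE).2 (Finset.mem_singleton_self v)
        exact (Finset.mem_sdiff.1 ((Finset.mem_filter.1 h).2 h1)).2 hv
      rw [this, mul_zero, mul_zero]
    · have : dMass Finset.univ ν {v} ≤ τ := by simpa [hB] using hv
      exact mul_le_mul_of_nonneg_right this (dMass_nonneg hμ.1 _)
  have hexp : ∀ t : ℝ, vertexEnergy (fun E => (1 - t) * ν E + t * μ E) =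
      (1 - t) ^ 2 * vertexEnergy ν + 2 * t * (1 - t) * I + t ^ 2 * vertexEnergy μ := by
    intro t
    unfold vertexEnergy
    rw [hI, Finset.mul_sum, Finset.mul_sum, Finset.mul_sum, ← Finset.sum_add_distrib,
      ← Finset.sum_add_distrib]
    refine Finset.sum_congr rfl fun v _ => ?_
    rw [dMass_add, dMass_mul, dMass_mul]
    ring
  have hineq : ∀ t : ℝ, 0 < t → t ≤ 1 →
      (2 - t) * vertexEnergy ν ≤ 2 * (1 - t) * I + t * vertexEnergy μ := by
    intro t ht0 ht1
    have h1 : vertexEnergy ν ≤ vertexEnergy (fun E => (1 - t) * ν E + t * μ E) := by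
      refine hmin ⟨fun E => ?_, fun E hE => ?_, ?_, ?_⟩
      · exact add_nonneg (mul_nonneg (by linarith) (hν0 E)) (mul_nonneg ht0.le (hμ.1 E))
      · simp only [hνH E hE, hμW E hE, mul_zero, add_zero]
      · rw [Finset.sum_add_distrib, ← Finset.mul_sum, ← Finset.mul_sum, hν1, hμ1]
        ring
      · refine (lamP_convex hp ht0.le ht1 ν μ).trans ?_
        nlinarith
    rw [hexp] at h1
    refine le_of_mul_le_mul_left ?_ ht0
    nlinarith
  have hlim : vertexEnergy ν ≤ I := by
    by_contra hlt
    push Not at hlt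
    set d := vertexEnergy ν - I with hd
    have hd0 : 0 < d := by linarith
    have hμ0 := vertexEnergy_nonneg μ
    have hν0' := vertexEnergy_nonneg ν
    set c := vertexEnergy ν + |I| + vertexEnergy μ + d with hc
    have hc0 : 0 < c := by positivity
    have ht1 : d / c ≤ 1 := by
      rw [div_le_one hc0, hc]
      have := abs_nonneg I
      linarith
    have h1 := hineq (d / c) (by positivity) ht1
    have h2 : d / c * (vertexEnergy ν - 2 * I + vertexEnergy μ) ≥ 2 * d := by linarith
    have h3 : d / c * (vertexEnergy ν - 2 * I + vertexEnergy μ) < 2 * d := by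
      have h4 : d / c * (2 * c) = 2 * d := by field_simp
      rw [← h4]
      refine mul_lt_mul_of_pos_left ?_ (by positivity)
      have := neg_abs_le I
      linarith
    linarith
  exact hlim.trans hIle

end Measures

/-- The bilinear form whose quadratic form is `Λ_p`. -/
def lamCross {V : Type*} [Fintype V] (p : ℝ) (ν μ : Finset V → ℝ) : ℝ :=
  ∑ L ∈ (Finset.univ : Finset (Finset V)).filter (fun L => 2 ≤ L.card),
    dMass Finset.univ ν L * (dMass Finset.univ μ L / p ^ L.card)

/-- The measure on subsets of `V ∪ {none}` given by `ν` on the sets containing `none` and by `ν₀`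
on the others. -/
def linkMeasure {V : Type*} (ν₀ ν : Finset V → ℝ) (E : Finset (Option V)) : ℝ :=
  if none ∈ E then ν E.eraseNone else ν₀ E.eraseNone

section Link

variable {V : Type*} {p : ℝ}

lemma map_some_subset_insertNone {L E : Finset V} :
    L.map Function.Embedding.some ⊆ Finset.insertNone E ↔ L ⊆ E := by
  constructor
  · intro h x hx
    simpa using h (Finset.mem_map_of_mem Function.Embedding.some hx)
  · intro h x hx
    obtain ⟨y, hy, rfl⟩ := Finset.mem_map.1 hx
    simpa using h hy

lemma not_insertNone_subset_map_some {L E : Finset V} :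
    ¬ Finset.insertNone L ⊆ E.map Function.Embedding.some := by
  intro h
  simpa using h (Finset.none_mem_insertNone)

lemma insertNone_subset_insertNone {L E : Finset V} :
    Finset.insertNone L ⊆ Finset.insertNone E ↔ L ⊆ E :=
  Finset.insertNone.le_iff_le

lemma linkMeasure_map_some (ν₀ ν : Finset V → ℝ) (L : Finset V) :
    linkMeasure ν₀ ν (L.map Function.Embedding.some) = ν₀ L := by
  simp [linkMeasure]

lemma linkMeasure_insertNone (ν₀ ν : Finset V → ℝ) (L : Finset V) :
    linkMeasure ν₀ ν (Finset.insertNone L) = ν L := by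
  simp [linkMeasure]

variable [Fintype V]

lemma sum_finset_option (f : Finset (Option V) → ℝ) :
    ∑ E, f E = ∑ L : Finset V, f (L.map Function.Embedding.some) +
      ∑ L : Finset V, f (Finset.insertNone L) := by
  rw [← Finset.sum_filter_add_sum_filter_not Finset.univ (fun E => none ∉ E)]
  congr 1
  · refine Finset.sum_nbij' Finset.eraseNone (fun L => L.map Function.Embedding.some)
      (fun _ _ => Finset.mem_univ _) (fun L _ => by simp) (fun E hE => ?_) (fun L _ => by simp)
      (fun E hE => ?_)
    all_goals
      have := (Finset.mem_filter.1 hE).2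
      simp [Finset.map_some_eraseNone, Finset.erase_eq_of_notMem this]
  · refine Finset.sum_nbij' Finset.eraseNone (fun L => Finset.insertNone L)
      (fun _ _ => Finset.mem_univ _) (fun L _ => by simp) (fun E hE => ?_) (fun L _ => by simp)
      (fun E hE => ?_)
    all_goals
      have : none ∈ E := not_not.1 (Finset.mem_filter.1 hE).2
      simp [Finset.insertNone_eraseNone, Finset.insert_eq_of_mem this]

lemma dMass_linkMeasure_map_some (ν₀ ν : Finset V → ℝ) (L : Finset V) :
    dMass Finset.univ (linkMeasure ν₀ ν) (L.map Function.Embedding.some) =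
      dMass Finset.univ ν₀ L + dMass Finset.univ ν L := by
  unfold dMass
  simp only [Finset.sum_filter]
  rw [sum_finset_option]
  simp only [Finset.map_subset_map, map_some_subset_insertNone, linkMeasure_map_some,
    linkMeasure_insertNone]

lemma dMass_linkMeasure_insertNone (ν₀ ν : Finset V → ℝ) (L : Finset V) :
    dMass Finset.univ (linkMeasure ν₀ ν) (Finset.insertNone L) = dMass Finset.univ ν L := by
  unfold dMass
  simp only [Finset.sum_filter]
  rw [sum_finset_option]
  simp only [not_insertNone_subset_map_some, insertNone_subset_insertNone, linkMeasure_insertNone,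
    if_false, Finset.sum_const_zero, zero_add]

lemma sum_card_pos_eq (f : Finset V → ℝ) :
    ∑ L ∈ Finset.univ.filter (fun L : Finset V => 1 ≤ L.card), f L =
      ∑ v, f {v} + ∑ L ∈ Finset.univ.filter (fun L : Finset V => 2 ≤ L.card), f L := by
  rw [← Finset.sum_filter_add_sum_filter_not _ (fun L : Finset V => L.card = 1),
    Finset.filter_filter, Finset.filter_filter]
  congr 1
  · symm
    refine Finset.sum_bij (fun v _ => {v}) (fun v _ => by simp) (fun _ _ _ _ h => by simpa using h)
      (fun L hL => ?_) (fun _ _ => rfl)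
    obtain ⟨v, rfl⟩ := Finset.card_eq_one.1 (Finset.mem_filter.1 hL).2.2
    exact ⟨v, Finset.mem_univ v, rfl⟩
  · refine Finset.sum_congr (Finset.filter_congr fun L _ => ?_) fun _ _ => rfl
    omega

lemma sum_dMass_sq_card_pos (ν : Finset V → ℝ) :
    ∑ L ∈ Finset.univ.filter (fun L : Finset V => 1 ≤ L.card),
      dMass Finset.univ ν L ^ 2 / p ^ L.card =
      vertexEnergy ν / p + lamP p Finset.univ ν := by
  rw [sum_card_pos_eq]
  unfold vertexEnergy lamP
  simp [Finset.sum_div]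

lemma lamP_linkMeasure (ν₀ ν : Finset V → ℝ) :
    lamP p Finset.univ (linkMeasure ν₀ ν) = lamP p Finset.univ ν₀ + 2 * lamCross p ν ν₀ +
      lamP p Finset.univ ν + (vertexEnergy ν / p + lamP p Finset.univ ν) / p := by
  rw [← sum_dMass_sq_card_pos]
  have h1 : lamP p Finset.univ (linkMeasure ν₀ ν) =
      ∑ L ∈ Finset.univ.filter (fun L : Finset V => 2 ≤ L.card),
        (dMass Finset.univ ν₀ L + dMass Finset.univ ν L) ^ 2 / p ^ L.card +
      ∑ L ∈ Finset.univ.filter (fun L : Finset V => 1 ≤ L.card),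
        dMass Finset.univ ν L ^ 2 / p ^ (L.card + 1) := by
    unfold lamP
    simp only [Finset.sum_filter]
    rw [sum_finset_option]
    simp only [Finset.card_map, dMass_linkMeasure_map_some, dMass_linkMeasure_insertNone,
      Finset.card_insertNone, Nat.succ_le_succ_iff]
  rw [h1]
  congr 1
  · unfold lamP lamCross
    rw [Finset.mul_sum, ← Finset.sum_add_distrib, ← Finset.sum_add_distrib]
    refine Finset.sum_congr rfl fun L _ => ?_
    ring
  · rw [Finset.sum_div]
    refine Finset.sum_congr rfl fun L _ => ?_
    rw [div_div, ← pow_succ]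

/-- A measure on the link of the new vertex which does not interact much with a measure witnessing
the `(p, R)`-Janson property yields the `(p, R + 1)`-Janson property. -/
lemma isJanson_of_linkMeasure {R : ℝ} (hR : 0 ≤ R) {𝓗 : Finset (Finset (Option V))}
    {J : Finset (Finset V)} {ν₀ ν : Finset V → ℝ}
    (hJ : ∀ L ∈ J, L.map Function.Embedding.some ∈ 𝓗)
    (h₀ : 0 < R → IsMeasureOn J ν₀ ∧ ∑ E, ν₀ E = 1 ∧ lamP p Finset.univ ν₀ < 1 / R ∧
      lamCross p ν ν₀ ≤ 3 / (4 * R))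
    (hν : ∀ E, 0 ≤ ν E) (hsupp : ∀ E, Finset.insertNone E ∉ 𝓗 → ν E = 0) (h1 : ∑ E, ν E = 1)
    (hK : lamP p Finset.univ ν + (vertexEnergy ν / p + lamP p Finset.univ ν) / p ≤ 1 / 16) :
    IsJanson p (R + 1) 𝓗 := by
  have hmeas : ∀ (c : ℝ) (μ : Finset V → ℝ), 0 ≤ c → IsMeasureOn J μ →
      IsMeasureOn 𝓗 (linkMeasure μ fun E => c * ν E) := by
    intro c μ hc hμ
    refine ⟨fun E => ?_, fun E hE => ?_⟩
    · unfold linkMeasure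
      split_ifs
      · exact mul_nonneg hc (hν _)
      · exact hμ.1 _
    · unfold linkMeasure
      split_ifs with h
      · refine mul_eq_zero_of_right c (hsupp _ ?_)
        rwa [Finset.insertNone_eraseNone, Finset.insert_eq_of_mem h]
      · refine hμ.2 _ fun h' => hE ?_
        have := hJ _ h'
        rwa [Finset.map_some_eraseNone, Finset.erase_eq_of_notMem h] at this
  have hsum : ∀ (c : ℝ) (μ : Finset V → ℝ),
      ∑ E, linkMeasure μ (fun E => c * ν E) E = ∑ E, μ E + c := by
    intro c μ
    rw [sum_finset_option]
    simp only [linkMeasure_map_some, linkMeasure_insertNone]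
    rw [← Finset.mul_sum, h1, mul_one]
  rcases hR.eq_or_lt with rfl | hRpos
  · have h0 : IsMeasureOn J (fun _ => (0 : ℝ)) := ⟨fun _ => le_rfl, fun _ _ => rfl⟩
    refine isJanson_of_prob (hmeas 1 _ zero_le_one h0) ?_
    rw [hsum, lamP_linkMeasure]
    have z : ∀ L : Finset V, dMass Finset.univ (fun _ => (0 : ℝ)) L = 0 := by simp [dMass]
    have z1 : lamP p Finset.univ (fun _ : Finset V => (0 : ℝ)) = 0 := by simp [lamP, z]
    have z2 : lamCross p ν (fun _ => 0) = 0 := by simp [lamCross, z]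
    have e1 : (fun E => 1 * ν E) = ν := funext fun E => one_mul _
    rw [e1, z1, z2, Finset.sum_const_zero]
    norm_num
    linarith
  · obtain ⟨hJ₀, hs₀, hl₀, hcr⟩ := h₀ hRpos
    refine isJanson_of_prob (hmeas (4 / R) _ (by positivity) hJ₀) ?_
    have hcross : lamCross p (fun E => 4 / R * ν E) ν₀ = 4 / R * lamCross p ν ν₀ := by
      unfold lamCross
      rw [Finset.mul_sum]
      exact Finset.sum_congr rfl fun L _ => by rw [dMass_mul, mul_assoc]
    rw [hsum, lamP_linkMeasure, hs₀, hcross, lamP_mul, vertexEnergy_mul]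
    have e1 : lamP p Finset.univ ν₀ + 2 * (4 / R * lamCross p ν ν₀) +
        (4 / R) ^ 2 * lamP p Finset.univ ν +
        ((4 / R) ^ 2 * vertexEnergy ν / p + (4 / R) ^ 2 * lamP p Finset.univ ν) / p =
        lamP p Finset.univ ν₀ + (8 / R) * lamCross p ν ν₀ + (16 / R ^ 2) *
          (lamP p Finset.univ ν + (vertexEnergy ν / p + lamP p Finset.univ ν) / p) := by
      ring
    rw [e1]
    have h2 : (8 / R) * lamCross p ν ν₀ ≤ (8 / R) * (3 / (4 * R)) :=
      mul_le_mul_of_nonneg_left hcr (by positivity)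
    have h3 : (16 / R ^ 2) *
          (lamP p Finset.univ ν + (vertexEnergy ν / p + lamP p Finset.univ ν) / p) ≤
          (16 / R ^ 2) * (1 / 16) := mul_le_mul_of_nonneg_left hK (by positivity)
    have h4 : 1 / R + (8 / R) * (3 / (4 * R)) + (16 / R ^ 2) * (1 / 16) ≤
        (1 + 4 / R) ^ 2 / (R + 1) := by
      rw [le_div_iff₀ (by positivity)]
      field_simp
      nlinarith
    linarith

lemma lamCross_eq_sum (ν μ : Finset V → ℝ) :
    lamCross p ν μ = ∑ E, ν E * ∑ L ∈ (Finset.univ.filter (fun L : Finset V => 2 ≤ L.card)).filter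
      (fun L => L ⊆ E), dMass Finset.univ μ L / p ^ L.card :=
  sum_dMass_mul _ _ _

lemma lamCross_le (hp : 0 < p) (ν μ : Finset V → ℝ) :
    lamCross p ν μ ≤ 2 * lamP p Finset.univ ν + lamP p Finset.univ μ / 8 := by
  unfold lamCross lamP
  rw [Finset.mul_sum, Finset.sum_div, ← Finset.sum_add_distrib]
  refine Finset.sum_le_sum fun L _ => ?_
  have : 2 * (dMass Finset.univ ν L ^ 2 / p ^ L.card) + dMass Finset.univ μ L ^ 2 / p ^ L.card / 8 -
      dMass Finset.univ ν L * (dMass Finset.univ μ L / p ^ L.card) =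
      2 * (dMass Finset.univ ν L - dMass Finset.univ μ L / 4) ^ 2 / p ^ L.card := by ring
  have h : 0 ≤ 2 * (dMass Finset.univ ν L - dMass Finset.univ μ L / 4) ^ 2 / p ^ L.card := by
    positivity
  linarith

/-- There is a well-spread measure on `H[W]` such that every hypergraph on `V ∪ {none}` extending
`J`, and whose link at `none` has non-negligible measure, is `(p, R' + 1)`-Janson. -/
lemma exists_measure_forall_isJanson {s : ℕ} {H J : Finset (Finset V)}
    (hunif : ∀ E ∈ H, E.card = s) {R R' N τ : ℝ} (hp : 0 < p) (hR : 0 < R) (hτ : 0 < τ)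
    (hR'0 : 0 ≤ R') (hR' : 16 * R' ≤ R) (hJ : IsJanson p R' J)
    (hH : ∀ W : Finset V, N ≤ W.card → IsJanson p R (indHG H W)) {W : Finset V}
    (hW : N + s / τ ≤ W.card) :
    ∃ ν : Finset V → ℝ, IsMeasureOn (indHG H W) ν ∧ 2 / 3 ≤ ∑ E, ν E ∧
      lamP p Finset.univ ν ≤ 1 / R ∧ vertexEnergy ν ≤ τ * s ∧
      ∀ 𝓗 : Finset (Finset (Option V)), (∀ L ∈ J, L.map Function.Embedding.some ∈ 𝓗) →
        ∀ θ : ℝ, 0 < θ → θ ≤ ∑ E ∈ Finset.univ.filter (fun E => Finset.insertNone E ∈ 𝓗), ν E →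
        1 / R + (τ * s / p + 1 / R) / p ≤ θ ^ 2 / 16 → IsJanson p (R' + 1) 𝓗 := by
  obtain ⟨ν', hν', hν'1, hlam, hQ⟩ := exists_prob_vertexEnergy_le hunif hp hR hτ hH hW
  obtain ⟨ν₀, hν₀⟩ : ∃ ν₀ : Finset V → ℝ, 0 < R' →
      (IsMeasureOn J ν₀ ∧ ∑ E, ν₀ E = 1 ∧ lamP p Finset.univ ν₀ < 1 / R') := by
    rcases hR'0.eq_or_lt with h | h
    · exact ⟨0, fun h' => absurd h h'.ne⟩
    · obtain ⟨ν₀, h1, h2, h3⟩ := hJ.exists_prob hp h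
      exact ⟨ν₀, fun _ => ⟨h1, h2, h3⟩⟩
  set g : Finset V → ℝ := fun E => ∑ L ∈ (Finset.univ.filter
    (fun L : Finset V => 2 ≤ L.card)).filter (fun L => L ⊆ E),
      dMass Finset.univ ν₀ L / p ^ L.card with hg
  set ν : Finset V → ℝ := fun E => if 0 < R' ∧ 3 / (4 * R') < g E then 0 else ν' E with hνdef
  have hν0 : ∀ E, 0 ≤ ν E := fun E => by
    simp only [hνdef]
    split_ifs
    · rfl
    · exact hν'.1 E
  have hνle : ∀ E, ν E ≤ ν' E := fun E => by
    simp only [hνdef]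
    split_ifs
    · exact hν'.1 E
    · rfl
  have hlamν : lamP p Finset.univ ν ≤ 1 / R := (lamP_mono hp hν0 hνle).trans hlam
  have hQν : vertexEnergy ν ≤ τ * s := (vertexEnergy_mono hν0 hνle).trans hQ
  have hmass : 2 / 3 ≤ ∑ E, ν E := by
    rcases hR'0.eq_or_lt with h | h
    · have : ν = ν' := by
        funext E
        simp [hνdef, ← h]
      rw [this, hν'1]
      norm_num
    · obtain ⟨h1, h2, h3⟩ := hν₀ h
      have hg0 : ∀ E, 0 ≤ g E := fun E => Finset.sum_nonneg fun L _ =>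
        div_nonneg (dMass_nonneg h1.1 L) (by positivity)
      have hcr : lamCross p ν' ν₀ ≤ 1 / (4 * R') := by
        have h4 : 1 / R ≤ 1 / (16 * R') := one_div_le_one_div_of_le (by positivity) hR'
        have h5 := lamCross_le hp ν' ν₀
        have h6 : 2 * (1 / (16 * R')) + 1 / R' / 8 = 1 / (4 * R') := by
          field_simp
          norm_num
        linarith
      rw [lamCross_eq_sum] at hcr
      have h7 : ∀ E, 3 / (4 * R') * (ν' E - ν E) ≤ ν' E * g E := by
        intro E
        simp only [hνdef]
        split_ifs with hE
        · rw [sub_zero, mul_comm]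
          exact mul_le_mul_of_nonneg_left hE.2.le (hν'.1 E)
        · rw [sub_self, mul_zero]
          exact mul_nonneg (hν'.1 E) (hg0 E)
      have h8 := (Finset.sum_le_sum fun E (_ : E ∈ Finset.univ) => h7 E).trans hcr
      rw [← Finset.mul_sum, Finset.sum_sub_distrib, hν'1] at h8
      have h9 : 3 / (4 * R') * (1 / 3) = 1 / (4 * R') := by
        field_simp
      rw [← h9] at h8
      have := le_of_mul_le_mul_left h8 (by positivity)
      linarith
  refine ⟨ν, ⟨hν0, fun E hE => ?_⟩, hmass, hlamν, hQν, ?_⟩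
  · exact le_antisymm ((hνle E).trans_eq (hν'.2 E hE)) (hν0 E)
  intro 𝓗 hJ𝓗 θ hθ hθle hbound
  set M := ∑ E ∈ Finset.univ.filter (fun E => Finset.insertNone E ∈ 𝓗), ν E with hM
  have hM0 : 0 < M := hθ.trans_le hθle
  set η : Finset V → ℝ := fun E => if Finset.insertNone E ∈ 𝓗 then M⁻¹ * ν E else 0 with hη
  have hη0 : ∀ E, 0 ≤ η E := fun E => by
    simp only [hη]
    split_ifs
    · exact mul_nonneg (inv_nonneg.2 hM0.le) (hν0 E)
    · rfl
  have hηle : ∀ E, η E ≤ M⁻¹ * ν E := fun E => by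
    simp only [hη]
    split_ifs
    · rfl
    · exact mul_nonneg (inv_nonneg.2 hM0.le) (hν0 E)
  have hη1 : ∑ E, η E = 1 := by
    simp only [hη]
    rw [← Finset.sum_filter, ← Finset.mul_sum, ← hM, inv_mul_cancel₀ hM0.ne']
  refine isJanson_of_linkMeasure (p := p) (ν₀ := ν₀) (ν := η) hR'0 hJ𝓗 (fun h => ?_) hη0
    (fun E hE => by simp only [hη, if_neg hE]) hη1 ?_
  · obtain ⟨h1, h2, h3⟩ := hν₀ h
    refine ⟨h1, h2, h3, ?_⟩
    rw [lamCross_eq_sum]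
    calc ∑ E, η E * g E ≤ ∑ E, η E * (3 / (4 * R')) := by
          refine Finset.sum_le_sum fun E _ => ?_
          by_cases hE : 3 / (4 * R') < g E
          · have : η E = 0 := by simp [hη, hνdef, h, hE]
            rw [this, zero_mul, zero_mul]
          · exact mul_le_mul_of_nonneg_left (not_lt.1 hE) (hη0 E)
      _ = 3 / (4 * R') := by rw [← Finset.sum_mul, hη1, one_mul]
  · have h1 : lamP p Finset.univ η ≤ M⁻¹ ^ 2 * (1 / R) := by
      refine (lamP_mono hp hη0 hηle).trans ?_
      rw [lamP_mul]
      exact mul_le_mul_of_nonneg_left hlamν (by positivity)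
    have h2 : vertexEnergy η ≤ M⁻¹ ^ 2 * (τ * s) := by
      refine (vertexEnergy_mono hη0 hηle).trans ?_
      rw [vertexEnergy_mul]
      exact mul_le_mul_of_nonneg_left hQν (by positivity)
    calc lamP p Finset.univ η + (vertexEnergy η / p + lamP p Finset.univ η) / p
        ≤ M⁻¹ ^ 2 * (1 / R) + (M⁻¹ ^ 2 * (τ * s) / p + M⁻¹ ^ 2 * (1 / R)) / p := by gcongr
      _ = M⁻¹ ^ 2 * (1 / R + (τ * s / p + 1 / R) / p) := by ring
      _ ≤ M⁻¹ ^ 2 * (θ ^ 2 / 16) := by gcongr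
      _ ≤ M⁻¹ ^ 2 * (M ^ 2 / 16) := by gcongr
      _ = 1 / 16 := by field_simp

/-- The pair correlation term of a measure on sets is controlled by its vertex energy and `Λ_p`. -/
lemma jansonDelta_le {ι : Type*} [DecidableEq ι] {ρ : ι → ℝ} {K : Finset (Finset V)}
    {e : Finset V → Finset ι} {ν : Finset V → ℝ} (hp : 0 < p)
    (hν : ∀ E, 0 ≤ ν E) (hρ : ∀ E ∈ K, ∀ i ∈ e E, p ≤ ρ i) (f : ι → V)
    (he : ∀ E ∈ K, ∀ E' ∈ K, Set.InjOn f (e E ∩ e E' : Finset ι))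
    (hf : ∀ E ∈ K, ∀ i ∈ e E, f i ∈ E) :
    jansonDelta ρ K e ν ≤ vertexEnergy ν / p + lamP p Finset.univ ν := by
  have h1 : ∀ E ∈ K, ∀ E' ∈ K,
      (if (e E ∩ e E').Nonempty then ν E * ν E' / ∏ i ∈ e E ∩ e E', ρ i else 0) ≤
      ∑ L ∈ Finset.univ.filter (fun L : Finset V => 1 ≤ L.card),
        if L ⊆ E ∧ L ⊆ E' then ν E * ν E' / p ^ L.card else 0 := by
    intro E hE E' hE'
    have hnn : ∀ L ∈ Finset.univ.filter (fun L : Finset V => 1 ≤ L.card),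
        0 ≤ if L ⊆ E ∧ L ⊆ E' then ν E * ν E' / p ^ L.card else 0 := by
      intro L _
      split_ifs
      · exact div_nonneg (mul_nonneg (hν E) (hν E')) (by positivity)
      · rfl
    split_ifs with hne
    · set L := (e E ∩ e E').image f with hL
      have hLcard : L.card = (e E ∩ e E').card := Finset.card_image_of_injOn (he E hE E' hE')
      have hLmem : L ∈ Finset.univ.filter (fun L : Finset V => 1 ≤ L.card) := by
        refine Finset.mem_filter.2 ⟨Finset.mem_univ _, ?_⟩
        rw [hLcard]
        exact hne.card_pos
      refine le_trans ?_ (Finset.single_le_sum hnn hLmem)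
      have hLE : L ⊆ E ∧ L ⊆ E' := by
        constructor <;> intro x hx <;> obtain ⟨i, hi, rfl⟩ := Finset.mem_image.1 hx
        · exact hf E hE i (Finset.mem_inter.1 hi).1
        · exact hf E' hE' i (Finset.mem_inter.1 hi).2
      rw [if_pos hLE, hLcard]
      refine div_le_div_of_nonneg_left (mul_nonneg (hν E) (hν E')) (by positivity) ?_
      rw [← Finset.prod_const]
      exact Finset.prod_le_prod (fun _ _ => hp.le) fun i hi => hρ E hE i (Finset.mem_inter.1 hi).1
    · exact Finset.sum_nonneg hnn
  have h2 : ∀ E E' : Finset V, 0 ≤ ∑ L ∈ Finset.univ.filter (fun L : Finset V => 1 ≤ L.card),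
        if L ⊆ E ∧ L ⊆ E' then ν E * ν E' / p ^ L.card else 0 := by
    intro E E'
    refine Finset.sum_nonneg fun L _ => ?_
    split_ifs
    · exact div_nonneg (mul_nonneg (hν E) (hν E')) (by positivity)
    · rfl
  rw [← sum_dMass_sq_card_pos]
  unfold jansonDelta
  calc _ ≤ ∑ E ∈ K, ∑ E' ∈ K, ∑ L ∈ Finset.univ.filter (fun L : Finset V => 1 ≤ L.card),
        (if L ⊆ E ∧ L ⊆ E' then ν E * ν E' / p ^ L.card else 0) :=
        Finset.sum_le_sum fun E hE => Finset.sum_le_sum fun E' hE' => h1 E hE E' hE'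
    _ ≤ ∑ E, ∑ E', ∑ L ∈ Finset.univ.filter (fun L : Finset V => 1 ≤ L.card),
        (if L ⊆ E ∧ L ⊆ E' then ν E * ν E' / p ^ L.card else 0) := by
        refine (Finset.sum_le_sum_of_subset_of_nonneg (Finset.subset_univ K) fun E _ _ =>
          Finset.sum_nonneg fun E' _ => h2 E E').trans (Finset.sum_le_sum fun E _ => ?_)
        exact Finset.sum_le_sum_of_subset_of_nonneg (Finset.subset_univ K) fun E' _ _ => h2 E E'
    _ = ∑ L ∈ Finset.univ.filter (fun L : Finset V => 1 ≤ L.card), ∑ E, ∑ E',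
        (if L ⊆ E ∧ L ⊆ E' then ν E * ν E' / p ^ L.card else 0) := by
        rw [Finset.sum_comm]
        rw [Finset.sum_congr rfl fun E _ => Finset.sum_comm, Finset.sum_comm]
        refine Finset.sum_congr rfl fun L _ => ?_
        exact Finset.sum_comm
    _ = _ := by
        refine Finset.sum_congr rfl fun L _ => ?_
        unfold dMass
        rw [sq, Finset.sum_filter, Finset.sum_mul_sum, Finset.sum_div]
        refine Finset.sum_congr rfl fun E _ => ?_
        rw [Finset.sum_div]
        refine Finset.sum_congr rfl fun E' _ => ?_
        by_cases a : L ⊆ E <;> by_cases b : L ⊆ E' <;> simp [a, b]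

end Link

section ExtendGraph

variable {V W : Type*}

lemma extendGraph_adj_some_some {G : SimpleGraph V} {A : Finset V} {x y : V} :
    (extendGraph G A).Adj (some x) (some y) ↔ G.Adj x y := by
  simp only [extendGraph, SimpleGraph.fromRel_adj, ne_eq, Option.some.injEq, G.adj_comm y x, or_self,
    and_iff_right_iff_imp]
  exact fun h => h.ne

lemma extendGraph_adj_some_none {G : SimpleGraph V} {A : Finset V} {x : V} :
    (extendGraph G A).Adj (some x) none ↔ x ∈ A := by
  simp [extendGraph]

lemma extendGraph_adj_none_some {G : SimpleGraph V} {A : Finset V} {x : V} :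
    (extendGraph G A).Adj none (some x) ↔ x ∈ A := by
  rw [SimpleGraph.adj_comm, extendGraph_adj_some_none]

lemma mem_copyHG_iff [Fintype V] {F : SimpleGraph W} {G' G : SimpleGraph V} {L : Finset V} :
    L ∈ copyHG F G' G ↔ (∀ x ∈ L, ∀ y ∈ L, G'.Adj x y ↔ G.Adj x y) ∧
      ∃ f : W → V, Function.Injective f ∧ (∀ x, x ∈ L ↔ ∃ a, f a = x) ∧
        ∀ a b, G.Adj (f a) (f b) ↔ F.Adj a b := by
  simp only [copyHG, Finset.mem_filter, Finset.mem_univ, true_and]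
  refine and_congr_right fun _ => ⟨fun ⟨φ⟩ => ?_, fun ⟨f, hinj, hL, hf⟩ => ?_⟩
  · refine ⟨fun a => (φ a).1, fun a b h => φ.injective (Subtype.ext h), fun x => ?_, fun a b => ?_⟩
    · refine ⟨fun hx => ⟨φ.symm ⟨x, hx⟩, by simp⟩, ?_⟩
      rintro ⟨a, rfl⟩
      exact (φ a).2
    · rw [← φ.map_adj_iff]
      rfl
  · refine ⟨⟨Equiv.ofBijective (fun a => (⟨f a, (hL _).2 ⟨a, rfl⟩⟩ : (L : Set V))) ⟨?_, ?_⟩, ?_⟩⟩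
    · intro a b h
      exact hinj (congrArg Subtype.val h)
    · rintro ⟨x, hx⟩
      obtain ⟨a, ha⟩ := (hL x).1 hx
      exact ⟨a, Subtype.ext ha⟩
    · intro a b
      exact hf a b

lemma card_of_mem_copyHG [Fintype V] [Fintype W] {F : SimpleGraph W} {G' G : SimpleGraph V}
    {L : Finset V} (hL : L ∈ copyHG F G' G) : L.card = Fintype.card W := by
  obtain ⟨-, f, hinj, hf, -⟩ := mem_copyHG_iff.1 hL
  have : L = Finset.univ.image f := by
    ext x
    simp [hf]
  rw [this, Finset.card_image_of_injective _ hinj, Finset.card_univ]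

lemma map_some_mem_copyHG [Fintype V] {F : SimpleGraph W} {G' G : SimpleGraph V} {L : Finset V}
    (hL : L ∈ copyHG F G' G) (B A : Finset V) :
    L.map Function.Embedding.some ∈ copyHG F (extendGraph G' B) (extendGraph G A) := by
  obtain ⟨h, f, hinj, hf, hadj⟩ := mem_copyHG_iff.1 hL
  refine mem_copyHG_iff.2 ⟨?_, fun a => some (f a), fun a b hab => hinj (Option.some.inj hab),
    fun x => ?_, fun a b => ?_⟩
  · intro x hx y hy
    obtain ⟨x, hxL, rfl⟩ := Finset.mem_map.1 hx
    obtain ⟨y, hyL, rfl⟩ := Finset.mem_map.1 hy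
    exact extendGraph_adj_some_some.trans ((h x hxL y hyL).trans extendGraph_adj_some_some.symm)
  · simp only [Finset.mem_map, hf, Function.Embedding.some_apply]
    constructor
    · rintro ⟨_, ⟨a, rfl⟩, rfl⟩
      exact ⟨a, rfl⟩
    · rintro ⟨a, rfl⟩
      exact ⟨_, ⟨a, rfl⟩, rfl⟩
  · rw [extendGraph_adj_some_some, hadj]

/-- Every copy `E` of `F - w` has a subset `P` such that `E ∪ {v}` is a copy of `F` as soon as
the neighbourhood of `v` meets `E` exactly in `P`. -/
lemma exists_subset_insertNone_mem_copyHG [Fintype V] {F : SimpleGraph W} {w : W}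
    {G' G : SimpleGraph V} {E : Finset V} (hE : E ∈ copyHG (F.induce ({w}ᶜ : Set W)) G' G) :
    ∃ P : Finset V, ∀ A B : Finset V, B ⊆ A → (∀ x ∈ E, x ∈ P → x ∈ B) →
      (∀ x ∈ E, x ∉ P → x ∉ A) →
        Finset.insertNone E ∈ copyHG F (extendGraph G' B) (extendGraph G A) := by
  obtain ⟨h, f, hinj, hf, hadj⟩ := mem_copyHG_iff.1 hE
  refine ⟨Finset.univ.filter fun x => ∃ a, F.Adj w a.1 ∧ f a = x, fun A B hBA hPB hPA => ?_⟩
  have hiff : ∀ x ∈ E, (x ∈ B ↔ x ∈ A) := by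
    intro x hx
    refine ⟨fun hB => hBA hB, fun hA => ?_⟩
    by_contra hB
    exact hPA x hx (fun hP => hB (hPB x hx hP)) hA
  have hAadj : ∀ a, f a ∈ A ↔ F.Adj w a.1 := by
    intro a
    have ha : f a ∈ E := (hf _).2 ⟨a, rfl⟩
    constructor
    · intro hA
      by_contra hwa
      refine hPA _ ha (fun hP => hwa ?_) hA
      obtain ⟨b, hb, hba⟩ := (Finset.mem_filter.1 hP).2
      rwa [← hinj hba]
    · intro hwa
      exact (hiff _ ha).1 (hPB _ ha (Finset.mem_filter.2 ⟨Finset.mem_univ _, a, hwa, rfl⟩))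
  obtain ⟨g, hgw, hg⟩ : ∃ g : W → Option V, g w = none ∧ ∀ a : ({w}ᶜ : Set W), g a = some (f a) :=
    ⟨fun a => if ha : a ∈ ({w}ᶜ : Set W) then some (f ⟨a, ha⟩) else none, dif_neg (by simp),
      fun a => dif_pos a.2⟩
  have hcases : ∀ a : W, a = w ∨ ∃ b : ({w}ᶜ : Set W), a = b := fun a =>
    (em (a = w)).imp_right fun ha => ⟨⟨a, ha⟩, rfl⟩
  refine mem_copyHG_iff.2 ⟨?_, g, ?_, ?_, ?_⟩
  · rintro (_ | x) hx (_ | y) hy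
    · simp
    · rw [extendGraph_adj_none_some, extendGraph_adj_none_some]
      exact hiff y (by simpa using hy)
    · rw [extendGraph_adj_some_none, extendGraph_adj_some_none]
      exact hiff x (by simpa using hx)
    · rw [extendGraph_adj_some_some, extendGraph_adj_some_some]
      exact h x (by simpa using hx) y (by simpa using hy)
  · intro a b hab
    rcases hcases a with rfl | ⟨a, rfl⟩ <;> rcases hcases b with rfl | ⟨b, rfl⟩
    · rfl
    · simp [hgw, hg] at hab
    · simp [hgw, hg] at hab
    · rw [hg, hg, Option.some.injEq] at hab
      rw [hinj hab]
  · rintro (_ | x)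
    · exact ⟨fun _ => ⟨w, hgw⟩, fun _ => by simp⟩
    · simp only [Finset.some_mem_insertNone, hf]
      constructor
      · rintro ⟨a, rfl⟩
        exact ⟨a, hg a⟩
      · rintro ⟨a, ha⟩
        rcases hcases a with rfl | ⟨a, rfl⟩
        · simp [hgw] at ha
        · rw [hg] at ha
          exact ⟨_, Option.some.inj ha⟩
  · intro a b
    rcases hcases a with rfl | ⟨a, rfl⟩ <;> rcases hcases b with rfl | ⟨b, rfl⟩
    · simp [hgw]
    · rw [hgw, hg, extendGraph_adj_none_some, hAadj]
    · rw [hgw, hg, extendGraph_adj_some_none, hAadj, F.adj_comm]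
    · rw [hg, hg, extendGraph_adj_some_some, hadj]
      rfl

end ExtendGraph

section DenseSubfamily

variable {ι : Type*} [DecidableEq ι] {Ω : Finset (Finset ι)}

lemma traceEntropy_eq_log_card_of_injOn (hΩ : Ω.Nonempty) {Z : Finset ι}
    (hZ : Set.InjOn (fun ω => ω ∩ Z) (Ω : Set (Finset ι))) :
    traceEntropy Ω Z = Real.log Ω.card := by
  unfold traceEntropy
  rw [← familyAvg_const hΩ (Real.log Ω.card)]
  refine familyAvg_congr fun ω hω => ?_
  have : traceClass Ω Z ω = {ω} := by
    ext x
    simp only [mem_traceClass, Finset.mem_singleton]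
    refine ⟨fun h => hZ h.1 hω h.2, ?_⟩
    rintro rfl
    exact ⟨hω, rfl⟩
  rw [this, Finset.card_singleton, Nat.cast_one, div_one]

/-- A large family has few coordinates with small marginals. -/
lemma card_le_of_marginal_le (hΩ : Ω.Nonempty) {Z T : Finset ι} (hTZ : T ⊆ Z)
    (hZ : Set.InjOn (fun ω => ω ∩ Z) (Ω : Set (Finset ι)))
    (hT : ∀ i ∈ T, marginal Ω i ≤ 1 / 64) :
    (T.card : ℝ) / 2 ≤ Z.card * Real.log 2 - Real.log Ω.card := by
  set c : ι → ℝ := fun i => if i ∈ T then 1 / 8 else 1 with hc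
  have hcpos : ∀ i, 0 < c i := fun i => by
    simp only [hc]
    split_ifs <;> norm_num
  have key := traceEntropy_add_familyAvg_log_le hΩ Z (π := fun t => ∏ i ∈ t, c i)
    (fun t => Finset.prod_nonneg fun i _ => (hcpos i).le)
    (fun ω _ => Finset.prod_pos fun i _ => hcpos i)
  rw [traceEntropy_eq_log_card_of_injOn hΩ hZ, ← Finset.prod_one_add,
    Real.log_prod fun i _ => (add_pos one_pos (hcpos i)).ne'] at key
  have h1 : ∀ ω : Finset ι, Real.log (∏ i ∈ ω ∩ Z, c i) =
      ∑ i ∈ T, (-Real.log 8) * (if i ∈ ω then 1 else 0) := by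
    intro ω
    rw [Real.log_prod fun i _ => (hcpos i).ne']
    have h2 : ∀ i, Real.log (c i) = if i ∈ T then -Real.log 8 else 0 := by
      intro i
      simp only [hc]
      split_ifs
      · rw [one_div, Real.log_inv]
      · exact Real.log_one
    simp only [h2, mul_ite, mul_one, mul_zero]
    rw [← Finset.sum_filter, ← Finset.sum_filter]
    refine Finset.sum_congr ?_ fun _ _ => rfl
    ext i
    simp only [Finset.mem_filter, Finset.mem_inter]
    exact ⟨fun h => ⟨h.2, h.1.1⟩, fun h => ⟨⟨h.2, hTZ h.1⟩, h.1⟩⟩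
  have h3 : familyAvg Ω (fun ω => Real.log (∏ i ∈ ω ∩ Z, c i)) =
      ∑ i ∈ T, (-Real.log 8) * marginal Ω i := by
    simp only [h1]
    rw [familyAvg_sum]
    simp only [familyAvg_const_mul]
    rfl
  have hl8 : Real.log 8 = 3 * Real.log 2 := by
    rw [show (8 : ℝ) = 2 ^ 3 by norm_num, Real.log_pow]
    norm_num
  have h2pos : 0 < Real.log 2 := Real.log_pos one_lt_two
  have h4 : -(T.card * (3 * Real.log 2 / 64)) ≤ ∑ i ∈ T, (-Real.log 8) * marginal Ω i := by
    rw [← mul_neg, ← nsmul_eq_mul]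
    refine Finset.card_nsmul_le_sum _ _ _ fun i hi => ?_
    rw [hl8]
    nlinarith [hT i hi]
  have h5 : ∑ i ∈ Z, Real.log (1 + c i) ≤ Z.card * Real.log 2 - T.card * (Real.log 2 - 1 / 8) := by
    have h6 : ∀ i, Real.log (1 + c i) ≤
        Real.log 2 - (if i ∈ T then Real.log 2 - 1 / 8 else 0) := by
      intro i
      simp only [hc]
      split_ifs
      · have := Real.log_le_sub_one_of_pos (show (0 : ℝ) < 1 + 1 / 8 by norm_num)
        linarith
      · norm_num
    refine (Finset.sum_le_sum fun i _ => h6 i).trans ?_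
    rw [Finset.sum_sub_distrib, Finset.sum_const, nsmul_eq_mul, ← Finset.sum_filter,
      Finset.filter_mem_eq_inter, Finset.inter_eq_right.2 hTZ, Finset.sum_const, nsmul_eq_mul]
  rw [h3] at key
  have h7 := Real.log_two_gt_d9
  have h8 : (0 : ℝ) ≤ T.card := Nat.cast_nonneg _
  nlinarith

end DenseSubfamily

/-- A large family of pairs `B ⊆ A` of subsets of `V`, encoded as subsets of `V × Bool`, contains a
subfamily with little information in its traces and with many vertices both of whose coordinates
have large marginals. -/
lemma exists_dense_subfamily {V : Type*} [Fintype V] {r : ℝ} (hr : 2 ≤ r)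
    {Ω : Finset (Finset (V × Bool))} (hΩ : Ω.Nonempty)
    (hinj : Set.InjOn (fun ω => ω ∩ Finset.univ.filter fun i : V × Bool => i.2 = false)
      (Ω : Set (Finset (V × Bool))))
    (hB : ∀ ω ∈ Ω, (Fintype.card V : ℝ) / (4 * r) ≤ ∑ v : V, if (v, true) ∈ ω then (1 : ℝ) else 0)
    (hlog : (Fintype.card V : ℝ) * Real.log 2 - Fintype.card V / (64 * r) ≤ Real.log Ω.card) :
    ∃ Ω' ⊆ Ω, Ω'.Nonempty ∧
      (∀ Z, ∑ i, traceInfo Ω' i Z ≤ 128 * r * Real.log 2 * traceEntropy Ω' Z) ∧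
      ∃ W : Finset V, 5 * (Fintype.card V : ℝ) / (32 * r) ≤ (W.card : ℝ) ∧
        ∀ v ∈ W, ∀ b, 1 / (32 * r) ≤ marginal Ω' (v, b) := by
  have h2pos : 0 < Real.log 2 := Real.log_pos one_lt_two
  have hr0 : 0 < r := by linarith
  obtain ⟨Ω', hsub, hne, hlog', hinfo⟩ := exists_subfamily_sum_traceInfo_le hΩ
    (α := 128 * r * Real.log 2) (by positivity)
  refine ⟨Ω', hsub, hne, hinfo, ?_⟩
  set n : ℝ := (Fintype.card V : ℝ) with hn
  set η : ℝ := 1 / (32 * r) with hη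
  set X := Finset.univ.filter fun v : V => marginal Ω' (v, true) < η with hX
  set Y := Finset.univ.filter fun v : V => marginal Ω' (v, false) < η with hY
  have hcard : (Fintype.card (V × Bool) : ℝ) * Real.log 2 / (128 * r * Real.log 2) =
      n / (64 * r) := by
    rw [Fintype.card_prod, Fintype.card_bool]
    push_cast
    rw [← hn]
    field_simp
    ring
  rw [hcard] at hlog'
  have hYcard : (Y.card : ℝ) ≤ n / (16 * r) := by
    have h := card_le_of_marginal_le (T := Y.map ⟨fun v => (v, false), Prod.mk_left_injective _⟩)
      hne (fun i hi => ?_) (hinj.mono (by exact_mod_cast hsub)) (fun i hi => ?_)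
    · have hZ : (Finset.univ.filter fun i : V × Bool => i.2 = false).card = Fintype.card V := by
        rw [← Finset.card_univ, ← Finset.card_map ⟨fun v : V => (v, false),
          Prod.mk_left_injective _⟩]
        congr 1
        ext ⟨v, b⟩
        cases b <;> simp
      rw [hZ, Finset.card_map, ← hn] at h
      have e : n / (16 * r) = 2 * (n / (64 * r) + n / (64 * r)) := by
        field_simp
        ring
      rw [e]
      linarith
    · obtain ⟨v, -, rfl⟩ := Finset.mem_map.1 hi
      simp
    · obtain ⟨v, hv, rfl⟩ := Finset.mem_map.1 hi
      refine (Finset.mem_filter.1 hv).2.le.trans ?_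
      rw [hη]
      exact one_div_le_one_div_of_le (by norm_num) (by linarith)
  have hXcard : n / (4 * r) ≤ (Xᶜ.card : ℝ) + n * η := by
    have h1 : n / (4 * r) ≤ ∑ v : V, marginal Ω' (v, true) := by
      unfold marginal
      rw [← familyAvg_sum, ← familyAvg_const hne (n / (4 * r))]
      exact familyAvg_mono fun ω hω => hB ω (hsub hω)
    refine h1.trans ?_
    calc ∑ v : V, marginal Ω' (v, true) ≤ ∑ v : V, ((if v ∈ Xᶜ then 1 else 0) + η) := by
          refine Finset.sum_le_sum fun v _ => ?_
          have hη0 : 0 ≤ η := by positivity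
          split_ifs with hv
          · linarith [marginal_le_one (Ω := Ω') (v, true)]
          · rw [Finset.mem_compl, not_not] at hv
            linarith [(Finset.mem_filter.1 hv).2]
      _ = (Xᶜ.card : ℝ) + n * η := by
          rw [Finset.sum_add_distrib, Finset.sum_const, nsmul_eq_mul, Finset.card_univ,
            Finset.sum_boole, Finset.filter_mem_eq_inter, Finset.univ_inter]
  refine ⟨Xᶜ \ Y, ?_, fun v hv b => ?_⟩
  · have h1 : (Xᶜ.card : ℝ) ≤ (Xᶜ \ Y).card + Y.card := by
      exact_mod_cast Finset.card_le_card_sdiff_add_card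
    have e : n / (4 * r) - n * η - n / (16 * r) = 5 * n / (32 * r) := by
      rw [hη]
      field_simp
      ring
    linarith
  · rw [Finset.mem_sdiff, Finset.mem_compl, hX, hY, Finset.mem_filter, Finset.mem_filter] at hv
    cases b
    · exact not_lt.1 fun h => hv.2 ⟨Finset.mem_univ _, h⟩
    · exact not_lt.1 fun h => hv.1 ⟨Finset.mem_univ _, h⟩

lemma pow_le_pow_of_le_card {m k r s : ℕ} (hr : 2 ≤ r) (hsk : s < k)
    (hm : (1 / (r : ℝ) ^ 50) * (r : ℝ) ^ (300 * (k + s)) ≤ m) :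
    2 ^ 67 * (k : ℝ) ^ 6 * r ^ 9 * (32 * r) ^ (2 * s) ≤ m := by
  have hr2 : (2 : ℝ) ≤ r := by exact_mod_cast hr
  have hr1 : (1 : ℝ) ≤ r := by linarith
  have hk : (k : ℝ) ≤ r ^ k := by
    have : k ≤ 2 ^ k := k.lt_two_pow_self.le
    calc (k : ℝ) ≤ 2 ^ k := by exact_mod_cast this
      _ ≤ r ^ k := by gcongr
  have h32 : (32 * r : ℝ) ≤ r ^ 6 := by
    calc (32 * r : ℝ) = 2 ^ 5 * r := by norm_num
      _ ≤ r ^ 5 * r := by gcongr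
      _ = r ^ 6 := by ring
  calc 2 ^ 67 * (k : ℝ) ^ 6 * r ^ 9 * (32 * r) ^ (2 * s)
      ≤ (r : ℝ) ^ 67 * (r ^ k) ^ 6 * r ^ 9 * (r ^ 6) ^ (2 * s) := by gcongr
    _ = (r : ℝ) ^ (76 + 6 * k + 12 * s) := by ring
    _ ≤ (r : ℝ) ^ (300 * (k + s) - 50) := pow_le_pow_right₀ hr1 (by omega)
    _ = (1 / (r : ℝ) ^ 50) * (r : ℝ) ^ (300 * (k + s)) := by
        rw [pow_sub₀ _ (by positivity) (by omega)]
        ring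
    _ ≤ m := hm

lemma energy_bound_le {m k r s p : ℝ} (hm : 0 < m) (hp : 0 < p) (hr : 2 ≤ r) (hs : 0 ≤ s)
    (hsk : s + 1 ≤ k) :
    32 * r * s ^ 2 / m / p + 1 / (p * m / 2 ^ 5) ≤ 32 * r * k ^ 2 / (p * m) := by
  have e : 32 * r * s ^ 2 / m / p + 1 / (p * m / 2 ^ 5) = 32 * (r * s ^ 2 + 1) / (p * m) := by
    field_simp
    ring
  have hk2 : s ^ 2 + 1 ≤ k ^ 2 := by nlinarith
  rw [e, mul_assoc 32 r]
  gcongr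
  nlinarith

lemma link_energy_le {m k r s : ℕ} (hr : 2 ≤ r) (hsk : s < k)
    (hm : (1 / (r : ℝ) ^ 50) * (r : ℝ) ^ (300 * (k + s)) ≤ m) {p : ℝ}
    (hp : p = 1 / (2 ^ 25 * (k : ℝ) ^ 2 * (r : ℝ) ^ 4)) :
    1 / (p * m / 2 ^ 5) + (32 * (r : ℝ) * s ^ 2 / m / p + 1 / (p * m / 2 ^ 5)) / p ≤
      ((1 / (32 * (r : ℝ))) ^ s / 12) ^ 2 / 16 := by
  have hr2 : (2 : ℝ) ≤ r := by exact_mod_cast hr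
  have hk1 : (s : ℝ) + 1 ≤ k := by exact_mod_cast hsk
  have hs0 : (0 : ℝ) ≤ s := Nat.cast_nonneg s
  have hr0 : (0 : ℝ) < r := by linarith
  have hk0 : (0 : ℝ) < k := by linarith
  have hbig := pow_le_pow_of_le_card hr hsk hm
  have hm0 : (0 : ℝ) < m := lt_of_lt_of_le (by positivity) hbig
  have hp0 : 0 < p := by rw [hp]; positivity
  have e : 1 / (p * m / 2 ^ 5) + (32 * (r : ℝ) * s ^ 2 / m / p + 1 / (p * m / 2 ^ 5)) / p =
      32 * (p + r * s ^ 2 + 1) / (p ^ 2 * m) := by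
    field_simp
    ring
  have hp1 : p ≤ 1 := by
    rw [hp, div_le_one (by positivity)]
    have : (1 : ℝ) ≤ (k : ℝ) ^ 2 := one_le_pow₀ (by linarith)
    have : (1 : ℝ) ≤ (r : ℝ) ^ 4 := one_le_pow₀ (by linarith)
    nlinarith
  rw [e]
  calc 32 * (p + r * s ^ 2 + 1) / (p ^ 2 * m) ≤ 32 * (r * k ^ 2) / (p ^ 2 * m) := by
        gcongr
        have hk2 : (s : ℝ) ^ 2 + 1 ≤ (k : ℝ) ^ 2 := by nlinarith
        nlinarith
    _ = 2 ^ 55 * (k : ℝ) ^ 6 * r ^ 9 / m := by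
        rw [hp]
        field_simp
        ring
    _ ≤ 1 / (2304 * (32 * r) ^ (2 * s)) := by
        rw [div_le_div_iff₀ hm0 (by positivity), one_mul]
        refine le_trans ?_ hbig
        have : (0 : ℝ) ≤ (k : ℝ) ^ 6 * r ^ 9 * (32 * r) ^ (2 * s) := by positivity
        nlinarith
    _ = ((1 / (32 * (r : ℝ))) ^ s / 12) ^ 2 / 16 := by
        rw [div_pow, one_div_pow, one_div_pow, ← pow_mul, mul_comm s 2]
        field_simp
        norm_num

/-- The gain from the Janson inequality exceeds the loss in entropy. -/
lemma entropy_loss_lt_janson_gain {m k r c D x p t : ℝ} (hm : 0 < m) (hk : 0 < k) (hr : 0 < r)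
    (hp : p = 1 / (2 ^ 25 * k ^ 2 * r ^ 4)) (hc : 2 / 3 ≤ c) (hD : D ≤ 32 * r * k ^ 2 / (p * m))
    (hx : x ≤ 1 / 12) (ht : t = p * m / (48 * r * k ^ 2)) :
    t * x + (32 * r * p) ^ 2 * (128 * r * Real.log 2) * (2 * m * Real.log 2) <
      t * c - t ^ 2 / 2 * D := by
  have hp0 : 0 < p := by rw [hp]; positivity
  have ht0 : 0 < t := by rw [ht]; positivity
  have h1 : t ^ 2 / 2 * D ≤ t * (1 / 3) := by
    calc t ^ 2 / 2 * D ≤ t ^ 2 / 2 * (32 * r * k ^ 2 / (p * m)) := by gcongr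
      _ = t * (1 / 3) := by
        rw [ht]
        field_simp
        norm_num
  have h2 : (32 * r * p) ^ 2 * (128 * r * Real.log 2) * (2 * m * Real.log 2) =
      t * (3 / 8 * Real.log 2 ^ 2) := by
    rw [ht, hp]
    field_simp
    norm_num
  have h3 : 3 / 8 * Real.log 2 ^ 2 < 1 / 4 := by
    nlinarith [Real.log_two_lt_d9, Real.log_two_gt_d9]
  rw [h2]
  nlinarith

/-- The encoding of a pair `B ⊆ A` of subsets of `V` as a subset of `V × Bool`. -/
def pairCode {V : Type*} [Fintype V] (A B : Finset V) : Finset (V × Bool) :=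
  Finset.univ.filter fun i => bif i.2 then i.1 ∈ B else i.1 ∉ A

/-- The encoding of the event that `E ∩ A = E ∩ B = E ∩ P`. -/
def patternCode {V : Type*} (P E : Finset V) : Finset (V × Bool) :=
  E.map ⟨fun v => (v, decide (v ∈ P)), fun _ _ h => congrArg Prod.fst h⟩

section Code

variable {V : Type*}

lemma mem_pairCode_true [Fintype V] {A B : Finset V} {v : V} :
    (v, true) ∈ pairCode A B ↔ v ∈ B := by
  simp [pairCode]

lemma mem_pairCode_false [Fintype V] {A B : Finset V} {v : V} :
    (v, false) ∈ pairCode A B ↔ v ∉ A := by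
  simp [pairCode]

lemma patternCode_subset_pairCode [Fintype V] {A B P E : Finset V}
    (h : patternCode P E ⊆ pairCode A B) :
    (∀ x ∈ E, x ∈ P → x ∈ B) ∧ ∀ x ∈ E, x ∉ P → x ∉ A := by
  have h' : ∀ x ∈ E, (x, decide (x ∈ P)) ∈ pairCode A B := fun x hx =>
    h (Finset.mem_map.2 ⟨x, hx, rfl⟩)
  refine ⟨fun x hx hP => ?_, fun x hx hP => ?_⟩
  · have := h' x hx
    rwa [decide_eq_true hP, mem_pairCode_true] at this
  · have := h' x hx
    rwa [decide_eq_false hP, mem_pairCode_false] at this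

lemma card_patternCode (P E : Finset V) : (patternCode P E).card = E.card :=
  Finset.card_map _

lemma fst_mem_of_mem_patternCode {P E : Finset V} {i : V × Bool} (hi : i ∈ patternCode P E) :
    i.1 ∈ E := by
  obtain ⟨v, hv, rfl⟩ := Finset.mem_map.1 hi
  exact hv

lemma injOn_fst_patternCode (P E : Finset V) :
    Set.InjOn Prod.fst (patternCode P E : Set (V × Bool)) := by
  rintro i hi j hj hij
  obtain ⟨v, -, rfl⟩ := Finset.mem_map.1 hi
  obtain ⟨v', -, rfl⟩ := Finset.mem_map.1 hj
  have : v = v' := hij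
  rw [this]

end Code

/-- The extension lemma on an arbitrary finite vertex set. -/
lemma card_filter_not_isJanson_le {V W : Type*} [Fintype V] [Fintype W] {m k r s : ℕ}
    (hV : Fintype.card V = m) (hW : Fintype.card W = s + 1) (hr : 2 ≤ r) (hsk : s < k)
    (hm : (1 / (r : ℝ) ^ 50) * (r : ℝ) ^ (300 * (k + s)) ≤ (m : ℝ)) {p R' : ℝ}
    (hp : p = 1 / (2 ^ 25 * (k : ℝ) ^ 2 * (r : ℝ) ^ 4)) (hR'0 : 0 ≤ R')
    (hR' : R' ≤ (p * (m : ℝ) / 2 ^ 5) / 16) (F : SimpleGraph W) (w : W) (G' G : SimpleGraph V)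
    (hFJanson : IsJanson p R' (copyHG F G' G))
    (hJanson : ∀ X : Finset V, (m : ℝ) / (8 * r) ≤ (X.card : ℝ) →
      IsJanson p (p * (m : ℝ) / 2 ^ 5) (indHG (copyHG (F.induce ({w}ᶜ : Set W)) G' G) X)) :
    ((Finset.univ.filter fun A : Finset V =>
        ∃ B ⊆ A, (m : ℝ) / (4 * r) ≤ (B.card : ℝ) ∧
          ¬ IsJanson p (R' + 1) (copyHG F (extendGraph G' B) (extendGraph G A))).card : ℝ)
      ≤ Real.exp (-(m : ℝ) / (2 ^ 6 * r)) * 2 ^ m := by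
  by_contra! hlt
  set bad := Finset.univ.filter fun A : Finset V =>
        ∃ B ⊆ A, (m : ℝ) / (4 * r) ≤ (B.card : ℝ) ∧
          ¬ IsJanson p (R' + 1) (copyHG F (extendGraph G' B) (extendGraph G A)) with hbad
  have hr2 : (2 : ℝ) ≤ r := by exact_mod_cast hr
  have hr0 : (0 : ℝ) < r := by linarith
  have hk1 : (s : ℝ) + 1 ≤ k := by exact_mod_cast hsk
  have hs0 : (0 : ℝ) ≤ s := Nat.cast_nonneg s
  have hk0 : (0 : ℝ) < k := by linarith
  have hm0 : (0 : ℝ) < m := lt_of_lt_of_le (by positivity) hm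
  have hp0 : 0 < p := by rw [hp]; positivity
  have hbad' : ∀ A, A ∈ bad → ∃ B ⊆ A, (m : ℝ) / (4 * r) ≤ (B.card : ℝ) ∧
      ¬ IsJanson p (R' + 1) (copyHG F (extendGraph G' B) (extendGraph G A)) := fun A hA =>
    (Finset.mem_filter.1 hA).2
  choose! f hfA hfcard hfJ using hbad'
  have htrace : ∀ A A' B B' : Finset V,
      pairCode A B ∩ (Finset.univ.filter fun i : V × Bool => i.2 = false) =
        pairCode A' B' ∩ (Finset.univ.filter fun i : V × Bool => i.2 = false) → A = A' := by
    intro A A' B B' h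
    ext v
    have := congrArg (fun S => (v, false) ∈ S) h
    simp only [Finset.mem_inter, mem_pairCode_false, Finset.mem_filter, Finset.mem_univ,
      and_true, eq_iff_iff] at this
    exact not_iff_not.1 this
  set Ω := bad.image fun A => pairCode A (f A) with hΩdef
  have hΩcard : Ω.card = bad.card := Finset.card_image_of_injective _ fun A A' h =>
    htrace A A' (f A) (f A') (congrArg (fun S => S ∩ _) h)
  have hbadpos : (0 : ℝ) < bad.card := lt_trans (by positivity) hlt
  have hΩne : Ω.Nonempty := Finset.card_pos.1 (by rw [hΩcard]; exact_mod_cast hbadpos)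
  obtain ⟨Ω', hΩ', hne, hinfo, X, hX, hmarg⟩ := exists_dense_subfamily hr2 hΩne
    (by
      intro ω hω ω' hω' h
      obtain ⟨A, -, rfl⟩ := Finset.mem_image.1 (Finset.mem_coe.1 hω)
      obtain ⟨A', -, rfl⟩ := Finset.mem_image.1 (Finset.mem_coe.1 hω')
      rw [htrace A A' (f A) (f A') h])
    (by
      intro ω hω
      obtain ⟨A, hA, rfl⟩ := Finset.mem_image.1 hω
      simp only [mem_pairCode_true]
      rw [Finset.sum_boole, Finset.filter_mem_eq_inter, Finset.univ_inter, hV]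
      exact hfcard A hA)
    (by
      rw [hV, hΩcard]
      have := Real.log_le_log (by positivity) hlt.le
      rw [Real.log_mul (Real.exp_pos _).ne' (by positivity), Real.log_exp, Real.log_pow] at this
      have e : -(m : ℝ) / (2 ^ 6 * r) = -(m / (64 * r)) := by norm_num [neg_div]
      linarith)
  rw [hV] at hX
  have hunif : ∀ E ∈ copyHG (F.induce ({w}ᶜ : Set W)) G' G, E.card = s := by
    intro E hE
    rw [card_of_mem_copyHG hE, Fintype.card_compl_set, hW]
    simp
  obtain ⟨τ, hτ, hsτ, hτs⟩ : ∃ τ : ℝ, 0 < τ ∧ s / τ ≤ m / (32 * r) ∧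
      τ * s = 32 * r * s ^ 2 / m := by
    rcases hs0.eq_or_lt with h | h
    · exact ⟨1, one_pos, by rw [← h, zero_div]; positivity, by rw [← h]; simp⟩
    · refine ⟨32 * r * s / m, by positivity, le_of_eq ?_, ?_⟩ <;> field_simp
  obtain ⟨ν, hν, hmass, hlam, henergy, hext⟩ := exists_measure_forall_isJanson (R' := R') hunif hp0
    (R := p * m / 2 ^ 5) (by positivity) hτ hR'0 (by linarith) hFJanson hJanson (W := X) (by
      refine le_trans ?_ hX
      have e : 5 * (m : ℝ) / (32 * r) = m / (8 * r) + m / (32 * r) := by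
        field_simp
        norm_num
      linarith)
  rw [hτs] at henergy hext
  have hP : ∀ E, E ∈ copyHG (F.induce ({w}ᶜ : Set W)) G' G → _ := fun E hE =>
    exists_subset_insertNone_mem_copyHG hE
  choose! P hP using hP
  set K := indHG (copyHG (F.induce ({w}ᶜ : Set W)) G' G) X with hK
  have hKmem : ∀ E ∈ K, E ∈ copyHG (F.induce ({w}ᶜ : Set W)) G' G := fun E hE =>
    (Finset.mem_filter.1 hE).1
  set e : Finset V → Finset (V × Bool) := fun E => patternCode (P E) E with he
  have hmarg' : ∀ E ∈ K, ∀ i ∈ e E, 1 / (32 * (r : ℝ)) ≤ marginal Ω' i := fun E hE i hi =>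
    hmarg i.1 ((Finset.mem_filter.1 hE).2 (fst_mem_of_mem_patternCode hi)) i.2
  set θ : ℝ := (1 / (32 * (r : ℝ))) ^ s / 12 with hθ
  have hθ0 : 0 < θ := by positivity
  have hsmall : ∀ ω ∈ Ω', ∑ E ∈ K, (if e E ⊆ ω then ν E else 0) ≤ θ := by
    intro ω hω
    obtain ⟨A, hA, rfl⟩ := Finset.mem_image.1 (hΩ' hω)
    by_contra! hθlt
    refine hfJ A hA (hext _ (fun L hL => map_some_mem_copyHG hL _ _) θ hθ0 (hθlt.le.trans ?_)
      (link_energy_le hr hsk hm hp))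
    rw [← Finset.sum_filter]
    refine Finset.sum_le_sum_of_subset_of_nonneg (fun E hE => ?_) fun E _ _ => hν.1 E
    obtain ⟨hEK, hEA⟩ := Finset.mem_filter.1 hE
    obtain ⟨h1, h2⟩ := patternCode_subset_pairCode hEA
    exact Finset.mem_filter.2 ⟨Finset.mem_univ _, hP E (hKmem E hEK) A (f A) (hfA A hA) h1 h2⟩
  have hcount : familyAvg Ω' (normalizedCount (marginal Ω') K e ν) ≤ 1 / 12 := by
    rw [← familyAvg_const hne (1 / 12)]
    refine familyAvg_mono fun ω hω => ?_
    have h1 : normalizedCount (marginal Ω') K e ν ω ≤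
        ∑ E ∈ K, (if e E ⊆ ω then ν E else 0) / (1 / (32 * (r : ℝ))) ^ s := by
      refine Finset.sum_le_sum fun E hE => ?_
      split_ifs
      · refine div_le_div_of_nonneg_left (hν.1 E) (by positivity) ?_
        rw [← hunif E (hKmem E hE), ← card_patternCode (P E) E, ← Finset.prod_const]
        exact Finset.prod_le_prod (fun _ _ => by positivity) (hmarg' E hE)
      · rw [zero_div]
    refine h1.trans ?_
    rw [← Finset.sum_div, div_le_iff₀ (by positivity)]
    refine (hsmall ω hω).trans_eq ?_
    rw [hθ]
    ring
  have hq1 : 32 * r * p ≤ 1 := by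
    rw [hp, mul_one_div, div_le_one (by positivity)]
    have h1 : (1 : ℝ) ≤ (k : ℝ) ^ 2 := one_le_pow₀ (by linarith)
    have h2 : (r : ℝ) ≤ (r : ℝ) ^ 4 := le_self_pow₀ (by linarith) (by norm_num)
    have h3 : (r : ℝ) ≤ (k : ℝ) ^ 2 * (r : ℝ) ^ 4 := by nlinarith
    linarith
  have hΔ : jansonDelta (fun i => 32 * r * p * marginal Ω' i) K e ν ≤
      32 * r * k ^ 2 / (p * m) := by
    refine (jansonDelta_le hp0 hν.1 (fun E hE i hi => ?_) Prod.fst (fun E _ E' _ => ?_)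
      (fun E _ i hi => fst_mem_of_mem_patternCode hi)).trans ?_
    · have h1 := mul_le_mul_of_nonneg_left (hmarg' E hE i hi) (show 0 ≤ 32 * r * p by positivity)
      refine le_trans (le_of_eq ?_) h1
      field_simp
    · exact (injOn_fst_patternCode (P E) E).mono (by
        exact_mod_cast Finset.inter_subset_left)
    · refine le_trans ?_ (energy_bound_le hm0 hp0 hr2 hs0 hk1)
      gcongr
  have hsumK : ∑ E ∈ K, ν E = ∑ E, ν E :=
    Finset.sum_subset (Finset.subset_univ K) fun E _ hE => hν.2 E hE
  have key := janson_of_traceInfo_le (t := p * m / (48 * r * k ^ 2)) hne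
    (α := 128 * r * Real.log 2)
    (by have := Real.log_pos one_lt_two; positivity) (show 0 < 32 * r * p by positivity) hq1 hinfo
    (fun E _ => hν.1 E) (fun E hE i hi => lt_of_lt_of_le (by positivity) (hmarg' E hE i hi))
    (by positivity)
  rw [hsumK, Fintype.card_prod, hV, Fintype.card_bool, Nat.cast_mul, Nat.cast_two,
    mul_comm (m : ℝ) 2] at key
  exact absurd key (not_le.2 (entropy_loss_lt_janson_gain hm0 hk0 hr0 hp hmass hΔ hcount rfl))

/-- **Lemma 5.1 (extension lemma, counting form).** With `C = 300`, `δ = r^{-50}`,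
`p = 2^{-25}k^{-2}r^{-4}` and `R = 2^{-5}pm`: suppose `m ≥ δ·r^{C(k+s)}`, `0 ≤ R' ≤ R/16`,
`ℑ_{F,G̃',G̃}` is `(p,R')`-Janson and `ℑ_{F⁻,G̃',G̃}[W]` is `(p,R)`-Janson for every `W ⊆ U`
with `|W| ≥ m/(8r)`.  Then the number of sets `A ⊆ U` admitting `B ⊆ A` with `|B| ≥ m/(4r)`
such that `ℑ_{F, G̃'⊕_v B, G̃⊕_v A}` is not `(p,R'+1)`-Janson is at most
`exp(-m/(2^6 r))·2^m`. -/
theorem extension_lemma (m k r s : ℕ) (hr : 2 ≤ r) (hsk : s < k) (hkm : k ≤ m)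
    (hm : (1 / (r : ℝ) ^ 50) * (r : ℝ) ^ (300 * (k + s)) ≤ (m : ℝ))
    (R' : ℝ) (hR'0 : 0 ≤ R')
    (hR' : R' ≤ ((1 / (2 ^ 25 * (k : ℝ) ^ 2 * (r : ℝ) ^ 4)) * (m : ℝ) / 2 ^ 5) / 16)
    (F : SimpleGraph (Fin (s + 1))) (w : Fin (s + 1)) (hsm : s + 1 < m)
    (G' G : SimpleGraph (Fin m)) (hGG : G' ≤ G)
    (hFJanson : IsJanson (1 / (2 ^ 25 * (k : ℝ) ^ 2 * (r : ℝ) ^ 4)) R' (copyHG F G' G))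
    (hJanson : ∀ W : Finset (Fin m), (m : ℝ) / (8 * r) ≤ (W.card : ℝ) →
      IsJanson (1 / (2 ^ 25 * (k : ℝ) ^ 2 * (r : ℝ) ^ 4))
        ((1 / (2 ^ 25 * (k : ℝ) ^ 2 * (r : ℝ) ^ 4)) * (m : ℝ) / 2 ^ 5)
        (indHG (copyHG (F.induce ({w}ᶜ : Set (Fin (s + 1)))) G' G) W)) :
    ((Finset.univ.filter fun A : Finset (Fin m) =>
        ∃ B ⊆ A, (m : ℝ) / (4 * r) ≤ (B.card : ℝ) ∧
          ¬ IsJanson (1 / (2 ^ 25 * (k : ℝ) ^ 2 * (r : ℝ) ^ 4)) (R' + 1)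
              (copyHG F (extendGraph G' B) (extendGraph G A))).card : ℝ)
      ≤ Real.exp (-(m : ℝ) / (2 ^ 6 * r)) * 2 ^ m := by
  exact card_filter_not_isJanson_le (Fintype.card_fin m) (Fintype.card_fin (s + 1)) hr hsk hm rfl hR'0 hR'
    F w G' G hFJanson hJanson

end
end

section
/- Let s, n ∈ ℕ with s ≤ n and let p, q, R > 0 satisfy q ≤ 1/16, p ≤ q/(2^{10}s²) and R ≥ 2^{−6}pn, and set η = 2^{−2s−2}. For every s-uniform hypergraph ℋ on an n-element vertex set V there exists a family 𝒳 of subsets of V with |𝒳| ≤ 4·(2/q)^{8qn} such that: (i) for every L ⊆ V such that ℋ[L] is not (p/q, ηR)-Janson, there is X ∈ 𝒳 with L ⊆ X; and (ii) for every X ∈ 𝒳, ℋ[X] is not (p, R)-Janson. -/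
open scoped Classical

noncomputable section

/-- `I` is an independent set of the hypergraph `G`: no edge of `G` is a subset of `I`. -/
def IndepIn {V : Type*} (G : Finset (Finset V)) (I : Finset V) : Prop := ∀ E ∈ G, ¬ E ⊆ I

section Restriction

variable {V : Type*}

/-- The restriction of `ν` to the edges satisfying `A`. -/
def restr (A : Finset V → Prop) (ν : Finset V → ℝ) (E : Finset V) : ℝ := if A E then ν E else 0

theorem restr_isMeasureOn {G : Finset (Finset V)} {ν : Finset V → ℝ} (h : IsMeasureOn G ν)
    (A : Finset V → Prop) : IsMeasureOn G (restr A ν) := by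
  constructor
  · intro E
    unfold restr
    split_ifs
    exacts [h.1 E, le_rfl]
  · intro E hE
    simp [restr, h.2 E hE]

theorem restr_le {ν : Finset V → ℝ} (h : ∀ E, 0 ≤ ν E) (A : Finset V → Prop) (E : Finset V) :
    restr A ν E ≤ ν E := by
  unfold restr
  split_ifs
  exacts [le_rfl, h E]

theorem IndepIn.mono {G : Finset (Finset V)} {S T : Finset V} (h : IndepIn G T) (hST : S ⊆ T) :
    IndepIn G S := fun E hE hES => h E hE (hES.trans hST)

end Restriction

section Measures

variable {V : Type*} [Fintype V]

/-- Degree of `T` in `ν`, all subsets of the vertex set being regarded as edges. -/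
def degAll (ν : Finset V → ℝ) (T : Finset V) : ℝ :=
  ∑ E ∈ (Finset.univ : Finset (Finset V)).filter (fun E => T ⊆ E), ν E

theorem degAll_add (μ ν : Finset V → ℝ) (x : ℝ) (T : Finset V) :
    degAll (fun E => μ E + x * ν E) T = degAll μ T + x * degAll ν T := by
  simp only [degAll, Finset.sum_add_distrib, Finset.mul_sum]

theorem degAll_nonneg {ν : Finset V → ℝ} (h : ∀ E, 0 ≤ ν E) (T : Finset V) : 0 ≤ degAll ν T :=
  Finset.sum_nonneg fun E _ => h E

theorem degAll_mono {μ ν : Finset V → ℝ} (h : ∀ E, μ E ≤ ν E) (T : Finset V) :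
    degAll μ T ≤ degAll ν T :=
  Finset.sum_le_sum fun E _ => h E

theorem degAll_empty (ν : Finset V → ℝ) : degAll ν ∅ = ∑ E, ν E := by
  simp [degAll]

theorem degAll_singleton (ν : Finset V → ℝ) (u : V) :
    degAll ν {u} = ∑ E, if u ∈ E then ν E else 0 := by
  simp only [degAll, Finset.sum_filter, Finset.singleton_subset_iff]

theorem dMass_eq_degAll {G : Finset (Finset V)} {ν : Finset V → ℝ} (h : ∀ E, E ∉ G → ν E = 0)
    (T : Finset V) : dMass G ν T = degAll ν T := by
  unfold dMass degAll
  apply Finset.sum_subset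
  · intro E hE
    simp only [Finset.mem_filter, Finset.mem_univ, true_and] at hE ⊢
    exact hE.2
  · intro E hE hE'
    apply h
    simp only [Finset.mem_filter, Finset.mem_univ, true_and, not_and] at hE hE'
    exact fun hG => hE' hG hE

theorem eMass_eq_degAll {G : Finset (Finset V)} {ν : Finset V → ℝ} (h : ∀ E, E ∉ G → ν E = 0) :
    eMass G ν = degAll ν ∅ := by
  rw [degAll_empty]
  exact Finset.sum_subset (Finset.subset_univ _) fun E _ hE => h E hE

/-- `Λ_p(ν)`, all subsets of the vertex set being regarded as edges. -/
def lamAll (p : ℝ) (ν : Finset V → ℝ) : ℝ :=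
  ∑ T ∈ (Finset.univ : Finset (Finset V)).filter (fun T => 2 ≤ T.card), degAll ν T ^ 2 / p ^ T.card

theorem lamP_eq_lamAll {G : Finset (Finset V)} {ν : Finset V → ℝ} (h : ∀ E, E ∉ G → ν E = 0)
    (p : ℝ) : lamP p G ν = lamAll p ν := by
  simp only [lamP, lamAll, dMass_eq_degAll h]

theorem lamAll_mono {p : ℝ} (hp : 0 < p) {μ ν : Finset V → ℝ} (h0 : ∀ E, 0 ≤ μ E)
    (h : ∀ E, μ E ≤ ν E) : lamAll p μ ≤ lamAll p ν := by
  unfold lamAll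
  gcongr with T
  · exact degAll_nonneg h0 T
  · exact degAll_mono h T

theorem lamAll_nonneg {p : ℝ} (hp : 0 < p) (ν : Finset V → ℝ) : 0 ≤ lamAll p ν :=
  Finset.sum_nonneg fun T _ => by positivity

theorem lamAll_mul_le {p a : ℝ} (hp : 0 < p) (ha : 1 ≤ a) (ν : Finset V → ℝ) :
    lamAll (a * p) ν ≤ lamAll p ν / a ^ 2 := by
  unfold lamAll
  rw [Finset.sum_div]
  apply Finset.sum_le_sum
  intro T hT
  have h2 : 2 ≤ T.card := (Finset.mem_filter.1 hT).2
  rw [div_div, mul_pow, mul_comm (p ^ _)]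
  gcongr

theorem isJanson_iff {p R : ℝ} (hR : 0 < R) {G : Finset (Finset V)} :
    IsJanson p R G ↔ ∃ ν : Finset V → ℝ, IsMeasureOn G ν ∧ R * lamAll p ν < degAll ν ∅ ^ 2 := by
  constructor
  · intro h
    obtain ⟨ν, hν, h⟩ := h hR
    refine ⟨ν, hν, ?_⟩
    rwa [lamP_eq_lamAll hν.2, eMass_eq_degAll hν.2, lt_div_iff₀ hR, mul_comm] at h
  · rintro ⟨ν, hν, h⟩ _
    refine ⟨ν, hν, ?_⟩
    rwa [lamP_eq_lamAll hν.2, eMass_eq_degAll hν.2, lt_div_iff₀ hR, mul_comm]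

theorem sum_degAll_singleton {s : ℕ} {ν : Finset V → ℝ} (h : ∀ E, ν E ≠ 0 → E.card = s) :
    ∑ u, degAll ν {u} = s * degAll ν ∅ := by
  simp only [degAll, Finset.sum_filter, Finset.singleton_subset_iff]
  rw [Finset.sum_comm, Finset.mul_sum]
  refine Finset.sum_congr rfl fun E _ => ?_
  by_cases h0 : ν E = 0
  · simp [h0]
  · simp [← h E h0]

end Measures

section KKT

variable {V : Type*} [Fintype V]

/-- The nonempty sets disjoint from `S`. -/
def avoiding (S : Finset V) : Finset (Finset V) :=
  Finset.univ.filter fun T => T ≠ ∅ ∧ Disjoint T S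

/-- The bilinear form `Σ_T d_μ(T) d_ν(T) P^{-|T|}` over nonempty `T` disjoint from `S`. -/
def crossForm (P : ℝ) (S : Finset V) (μ ν : Finset V → ℝ) : ℝ :=
  ∑ T ∈ avoiding S, degAll μ T * degAll ν T / P ^ T.card

/-- The concave functional `2e(μ) - Σ_T d_μ(T)² P^{-|T|}`. -/
def energy (P : ℝ) (S : Finset V) (μ : Finset V → ℝ) : ℝ :=
  2 * degAll μ ∅ - crossForm P S μ μ

theorem crossForm_add_add (P : ℝ) (S : Finset V) (μ ν : Finset V → ℝ) (x : ℝ) :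
    crossForm P S (fun E => μ E + x * ν E) (fun E => μ E + x * ν E) =
      crossForm P S μ μ + 2 * x * crossForm P S μ ν + x ^ 2 * crossForm P S ν ν := by
  simp only [crossForm, Finset.mul_sum, ← Finset.sum_add_distrib, degAll_add]
  refine Finset.sum_congr rfl fun T _ => ?_
  ring

theorem energy_add (P : ℝ) (S : Finset V) (μ ν : Finset V → ℝ) (x : ℝ) :
    energy P S (fun E => μ E + x * ν E) = energy P S μ +
      2 * x * (degAll ν ∅ - crossForm P S μ ν) - x ^ 2 * crossForm P S ν ν := by
  simp only [energy, crossForm_add_add, degAll_add]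
  ring

theorem degAll_empty_le_sum {G : Finset (Finset V)} {S : Finset V} (hS : IndepIn G S)
    {μ : Finset V → ℝ} (hμ : IsMeasureOn G μ) :
    degAll μ ∅ ≤ ∑ u ∈ Finset.univ.filter (fun u => u ∉ S), degAll μ {u} := by
  simp only [degAll_empty, degAll_singleton]
  rw [Finset.sum_comm]
  refine Finset.sum_le_sum fun E _ => ?_
  by_cases hE : E ∈ G
  · obtain ⟨u, hu, huS⟩ := Finset.not_subset.1 (hS E hE)
    calc μ E = if u ∈ E then μ E else 0 := by rw [if_pos hu]
      _ ≤ _ := Finset.single_le_sum (f := fun u => if u ∈ E then μ E else 0)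
          (fun v _ => by split_ifs; exacts [hμ.1 E, le_rfl]) (by simpa using huS)
  · simp [hμ.2 E hE]

theorem sum_singletons_le_crossForm {P : ℝ} (hP : 0 < P) (S : Finset V) (μ : Finset V → ℝ) :
    ∑ u ∈ Finset.univ.filter (fun u => u ∉ S), degAll μ {u} ^ 2 / P ≤ crossForm P S μ μ := by
  have : ∑ u ∈ Finset.univ.filter (fun u => u ∉ S), degAll μ {u} ^ 2 / P =
      ∑ T ∈ (Finset.univ.filter (fun u => u ∉ S)).image (fun u => ({u} : Finset V)),
        degAll μ T * degAll μ T / P ^ T.card := by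
    rw [Finset.sum_image (fun a _ b _ h => Finset.singleton_injective h)]
    refine Finset.sum_congr rfl fun u _ => ?_
    simp [pow_two]
  rw [this]
  apply Finset.sum_le_sum_of_subset_of_nonneg
  · intro T hT
    obtain ⟨u, hu, rfl⟩ := Finset.mem_image.1 hT
    simpa [avoiding] using hu
  · intro T _ _
    exact div_nonneg (mul_self_nonneg _) (by positivity)

theorem energy_le {P : ℝ} (hP : 0 < P) {G : Finset (Finset V)} {S : Finset V} (hS : IndepIn G S)
    {μ : Finset V → ℝ} (hμ : IsMeasureOn G μ) {x : ℝ} (hx : 0 ≤ x) :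
    energy P S μ + x * degAll μ ∅ ≤ ((2 + x) ^ 2 / 4) * (P * Fintype.card V) := by
  have h1 := degAll_empty_le_sum hS hμ
  have h2 := sum_singletons_le_crossForm hP S μ
  have h3 : ∑ u ∈ Finset.univ.filter (fun u => u ∉ S),
      ((2 + x) * degAll μ {u} - degAll μ {u} ^ 2 / P) ≤
        ((2 + x) ^ 2 / 4) * (P * Fintype.card V) := by
    calc _ ≤ ∑ u ∈ Finset.univ.filter (fun u => u ∉ S), ((2 + x) ^ 2 / 4) * P := by
          refine Finset.sum_le_sum fun u _ => ?_
          have : 0 ≤ (degAll μ {u} - (2 + x) / 2 * P) ^ 2 / P := by positivity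
          have e : (degAll μ {u} - (2 + x) / 2 * P) ^ 2 / P =
            degAll μ {u} ^ 2 / P - (2 + x) * degAll μ {u} + ((2 + x) ^ 2 / 4) * P := by
              field_simp; ring
          linarith
      _ ≤ ∑ u : V, ((2 + x) ^ 2 / 4) * P :=
          Finset.sum_le_sum_of_subset_of_nonneg (Finset.filter_subset _ _)
            fun _ _ _ => by positivity
      _ = _ := by simp; ring
  rw [Finset.sum_sub_distrib, ← Finset.mul_sum] at h3
  unfold energy
  have := mul_le_mul_of_nonneg_left h1 (by linarith : 0 ≤ 2 + x)
  linarith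

theorem exists_energy_max {P : ℝ} (hP : 0 < P) {G : Finset (Finset V)} {S : Finset V}
    (hS : IndepIn G S) :
    ∃ μ, IsMeasureOn G μ ∧ ∀ ν, IsMeasureOn G ν → energy P S ν ≤ energy P S μ := by
  set M : ℝ := 9 / 4 * (P * Fintype.card V) with hM
  have hM0 : 0 ≤ M := by positivity
  let B : Finset V → ℝ := fun E => if E ∈ G then M else 0
  have hB : 0 ≤ B := fun E => by simp only [B]; split_ifs; exacts [hM0, le_rfl]
  have hcont : Continuous (energy P S) := by
    unfold energy crossForm degAll
    fun_prop
  obtain ⟨μ, hμ, hmax⟩ := (isCompact_Icc (a := (0 : Finset V → ℝ)) (b := B)).exists_isMaxOn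
    ⟨0, le_rfl, hB⟩ hcont.continuousOn
  refine ⟨μ, ⟨hμ.1, fun E hE => le_antisymm ?_ (hμ.1 E)⟩, fun ν hν => ?_⟩
  · simpa [B, hE] using hμ.2 E
  · by_cases h : ν ≤ B
    · exact hmax ⟨hν.1, h⟩
    · obtain ⟨E, hE⟩ := not_forall.1 h
      have hEG : E ∈ G := by
        by_contra hEG
        simp [B, hEG, hν.2 E hEG] at hE
      have h1 : M < ν E := by simpa [B, hEG] using hE
      have h2 : ν E ≤ degAll ν ∅ := by
        rw [degAll_empty]
        exact Finset.single_le_sum (fun E _ => hν.1 E) (Finset.mem_univ E)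
      have h3 := energy_le hP hS hν zero_le_one
      have h4 : energy P S 0 ≤ energy P S μ := hmax ⟨le_rfl, hB⟩
      have h5 : energy P S (0 : Finset V → ℝ) = 0 := by
        simp [energy, crossForm, degAll]
      norm_num at h3
      linarith

theorem nonpos_of_forall_small {a b : ℝ} (h : ∀ t : ℝ, 0 < t → t ≤ 1 → 2 * t * a ≤ t ^ 2 * b) :
    a ≤ 0 := by
  by_contra! ha
  have hb : 0 < b := by linarith [h 1 one_pos le_rfl]
  have h1 := h (min 1 (a / b)) (by positivity) (min_le_left _ _)
  have ht : 0 < min 1 (a / b) := by positivity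
  have h2 : min 1 (a / b) * b ≤ a := by
    calc _ ≤ a / b * b := by gcongr; exact min_le_right _ _
      _ = a := by field_simp
  nlinarith

theorem le_crossForm_of_max {P : ℝ} {G : Finset (Finset V)} {S : Finset V}
    {μ : Finset V → ℝ} (hμ : IsMeasureOn G μ)
    (hmax : ∀ ν, IsMeasureOn G ν → energy P S ν ≤ energy P S μ)
    {ν : Finset V → ℝ} (hν : IsMeasureOn G ν) : degAll ν ∅ ≤ crossForm P S μ ν := by
  have := nonpos_of_forall_small (a := degAll ν ∅ - crossForm P S μ ν) (b := crossForm P S ν ν)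
    fun t ht _ => by
      have := hmax (fun E => μ E + t * ν E)
        ⟨fun E => add_nonneg (hμ.1 E) (mul_nonneg ht.le (hν.1 E)),
          fun E hE => by simp [hμ.2 E hE, hν.2 E hE]⟩
      rw [energy_add] at this
      linarith
  linarith

theorem eq_crossForm_of_max {P : ℝ} {G : Finset (Finset V)} {S : Finset V}
    {μ : Finset V → ℝ} (hμ : IsMeasureOn G μ)
    (hmax : ∀ ν, IsMeasureOn G ν → energy P S ν ≤ energy P S μ)
    {ν : Finset V → ℝ} (hν : IsMeasureOn G ν) (hle : ∀ E, ν E ≤ μ E) :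
    crossForm P S μ ν = degAll ν ∅ := by
  refine le_antisymm ?_ (le_crossForm_of_max hμ hmax hν)
  have := nonpos_of_forall_small (a := crossForm P S μ ν - degAll ν ∅) (b := crossForm P S ν ν)
    fun t ht ht1 => by
      have := hmax (fun E => μ E + (-t) * ν E)
        ⟨fun E => by nlinarith [hle E, hν.1 E], fun E hE => by simp [hμ.2 E hE, hν.2 E hE]⟩
      rw [energy_add] at this
      linarith
  linarith

end KKT

section Step

variable {V : Type*} [Fintype V]

theorem degAll_restr_mem (ν : Finset V → ℝ) (u : V) (T : Finset V) :
    degAll (restr (fun E => u ∈ E) ν) T = degAll ν (insert u T) := by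
  simp only [degAll, Finset.sum_filter, restr, Finset.insert_subset_iff]
  refine Finset.sum_congr rfl fun E _ => ?_
  by_cases h : u ∈ E <;> simp [h]

theorem avoiding_insert (S : Finset V) (u : V) :
    avoiding (insert u S) = (avoiding S).filter (fun T => u ∉ T) := by
  ext T
  simp only [avoiding, Finset.mem_filter, Finset.mem_univ, true_and, Finset.disjoint_insert_right]
  tauto

theorem crossForm_eq_insert_add (P : ℝ) (S : Finset V) (u : V) (μ ν : Finset V → ℝ) :
    crossForm P S μ ν = crossForm P (insert u S) μ ν +
      ∑ T ∈ (avoiding S).filter (fun T => u ∈ T), degAll μ T * degAll ν T / P ^ T.card := by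
  rw [crossForm, crossForm, avoiding_insert, add_comm, Finset.sum_filter_add_sum_filter_not]

theorem crossForm_insert_restr_le {P : ℝ} (hP : 0 < P) {S : Finset V} {u : V} (hu : u ∉ S)
    (μ : Finset V → ℝ) :
    crossForm P (insert u S) (restr (fun E => u ∈ E) μ) (restr (fun E => u ∈ E) μ) ≤
      P * ∑ T ∈ (avoiding S).filter (fun T => u ∈ T), degAll μ T * degAll μ T / P ^ T.card := by
  have hinj : Set.InjOn (fun T : Finset V => insert u T) (avoiding (insert u S) : Set _) := by
    intro T hT T' hT' h
    simp only [avoiding_insert, Finset.coe_filter, Set.mem_ofPred_eq] at hT hT'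
    rw [← Finset.erase_insert hT.2, ← Finset.erase_insert hT'.2]
    exact congrArg (fun X => X.erase u) h
  have heq : crossForm P (insert u S) (restr (fun E => u ∈ E) μ) (restr (fun E => u ∈ E) μ) =
      P * ∑ T ∈ (avoiding (insert u S)).image (fun T => insert u T),
        degAll μ T * degAll μ T / P ^ T.card := by
    rw [Finset.sum_image hinj, crossForm, Finset.mul_sum]
    refine Finset.sum_congr rfl fun T hT => ?_
    rw [avoiding_insert, Finset.mem_filter] at hT
    rw [degAll_restr_mem, Finset.card_insert_of_notMem hT.2, pow_succ]
    field_simp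
  rw [heq]
  refine mul_le_mul_of_nonneg_left (Finset.sum_le_sum_of_subset_of_nonneg ?_ ?_) hP.le
  · intro T hT
    obtain ⟨T', hT', rfl⟩ := Finset.mem_image.1 hT
    rw [avoiding_insert, Finset.mem_filter, avoiding, Finset.mem_filter] at hT'
    simp only [avoiding, Finset.mem_filter, Finset.mem_univ, true_and, Finset.mem_insert, true_or,
      and_true, Finset.disjoint_insert_left]
    exact ⟨Finset.insert_ne_empty _ _, hu, hT'.1.2.2⟩
  · intro T _ _
    exact div_nonneg (mul_self_nonneg _) (by positivity)

theorem exists_energy_insert_ge {P : ℝ} (hP : 0 < P) {G : Finset (Finset V)} {S : Finset V}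
    {μ : Finset V → ℝ} (hμ : IsMeasureOn G μ)
    (hmax : ∀ ν, IsMeasureOn G ν → energy P S ν ≤ energy P S μ) {u : V} (hu : u ∉ S) :
    ∃ ν, IsMeasureOn G ν ∧
      energy P S μ + (degAll μ {u} / P) ^ 2 ≤ energy P (insert u S) ν := by
  set μu := restr (fun E => u ∈ E) μ with hμu
  set Q := ∑ T ∈ (avoiding S).filter (fun T => u ∈ T), degAll μ T * degAll μ T / P ^ T.card with hQ
  have hmu : IsMeasureOn G μu := restr_isMeasureOn hμ _
  refine ⟨fun E => μ E + 1 / P * μu E, ⟨fun E => ?_, fun E hE => ?_⟩, ?_⟩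
  · have := hμ.1 E
    have := hmu.1 E
    positivity
  · simp [hμ.2 E hE, hmu.2 E hE]
  · have h1 : crossForm P S μ μ = crossForm P (insert u S) μ μ + Q :=
      crossForm_eq_insert_add P S u μ μ
    have h2 : crossForm P S μ μu = crossForm P (insert u S) μ μu + Q := by
      rw [crossForm_eq_insert_add P S u μ μu]
      congr 1
      refine Finset.sum_congr rfl fun T hT => ?_
      rw [hμu, degAll_restr_mem, Finset.insert_eq_of_mem (Finset.mem_filter.1 hT).2]
    have h3 : crossForm P S μ μu = degAll μu ∅ :=
      eq_crossForm_of_max hμ hmax hmu (restr_le hμ.1 _)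
    have h4 : crossForm P (insert u S) μu μu ≤ P * Q := crossForm_insert_restr_le hP hu μ
    have h5 : degAll μ {u} * degAll μ {u} / P ^ ({u} : Finset V).card ≤ Q :=
      Finset.single_le_sum (f := fun T => degAll μ T * degAll μ T / P ^ T.card)
        (fun T _ => div_nonneg (mul_self_nonneg _) (by positivity))
        (by simp [avoiding, hu])
    rw [Finset.card_singleton, pow_one] at h5
    have hQ0 : 0 ≤ Q := le_trans (div_nonneg (mul_self_nonneg _) hP.le) h5
    have h6 : (degAll μ {u} / P) ^ 2 ≤ 1 / P * Q := by
      calc _ = 1 / P * (degAll μ {u} * degAll μ {u} / P) := by field_simp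
        _ ≤ _ := by gcongr
    have h7 : (1 / P) ^ 2 * crossForm P (insert u S) μu μu ≤ 1 / P * Q := by
      calc _ ≤ (1 / P) ^ 2 * (P * Q) := by gcongr
        _ = _ := by field_simp
    rw [energy_add]
    have h8 : degAll μu ∅ - crossForm P (insert u S) μ μu = Q := by linarith
    rw [h8]
    unfold energy
    linarith

/-- The vertices of `S` together with those outside `S` of small degree in `μ`. -/
def lowDegree (s : ℕ) (P : ℝ) (μ : Finset V → ℝ) (S : Finset V) : Finset V :=
  Finset.univ.filter fun u => u ∈ S ∨ degAll μ {u} / P ≤ 1 / (2 * s)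

theorem sq_degAll_le_of_subset_lowDegree {s : ℕ} (hs : 0 < s) {P : ℝ} (hP : 0 < P)
    {G : Finset (Finset V)} (hunif : ∀ E ∈ G, E.card = s) {S : Finset V} (hS : IndepIn G S)
    {μ : Finset V → ℝ} (hμ : IsMeasureOn G μ)
    (hmax : ∀ ν, IsMeasureOn G ν → energy P S ν ≤ energy P S μ)
    {ν : Finset V → ℝ} (hν : IsMeasureOn G ν)
    (hsupp : ∀ E, ν E ≠ 0 → E ⊆ lowDegree s P μ S) :
    degAll ν ∅ ^ 2 ≤ 4 * (P * Fintype.card V) * lamAll P ν := by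
  have hs' : (0 : ℝ) < s := by exact_mod_cast hs
  have h1 := le_crossForm_of_max hμ hmax hν
  set A := (avoiding S).filter (fun T => 2 ≤ T.card) with hA
  set B := (avoiding S).filter (fun T => ¬ 2 ≤ T.card) with hB
  have h2 : crossForm P S μ ν = (∑ T ∈ A, degAll μ T * degAll ν T / P ^ T.card) +
      ∑ T ∈ B, degAll μ T * degAll ν T / P ^ T.card :=
    (Finset.sum_filter_add_sum_filter_not _ _ _).symm
  have hBeq : B = (Finset.univ.filter (fun u => u ∉ S)).image (fun u => ({u} : Finset V)) := by
    ext T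
    simp only [hB, avoiding, Finset.mem_filter, Finset.mem_univ, true_and, Finset.mem_image]
    constructor
    · rintro ⟨⟨hT, hd⟩, hc⟩
      have : T.card = 1 := by
        have := Finset.card_pos.2 (Finset.nonempty_iff_ne_empty.2 hT)
        omega
      obtain ⟨u, rfl⟩ := Finset.card_eq_one.1 this
      exact ⟨u, by simpa using hd, rfl⟩
    · rintro ⟨u, hu, rfl⟩
      simpa using hu
  have h3 : ∑ T ∈ B, degAll μ T * degAll ν T / P ^ T.card ≤ degAll ν ∅ / 2 := by
    rw [hBeq, Finset.sum_image (fun a _ b _ h => Finset.singleton_injective h)]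
    calc _ ≤ ∑ u ∈ Finset.univ.filter (fun u => u ∉ S), 1 / (2 * (s : ℝ)) * degAll ν {u} := by
          refine Finset.sum_le_sum fun u hu => ?_
          have huS : u ∉ S := by simpa using hu
          rw [Finset.card_singleton, pow_one]
          by_cases hux : degAll μ {u} / P ≤ 1 / (2 * s)
          · calc _ = degAll μ {u} / P * degAll ν {u} := by ring
              _ ≤ _ := mul_le_mul_of_nonneg_right hux (degAll_nonneg hν.1 _)
          · have : degAll ν {u} = 0 := by
              rw [degAll_singleton]
              refine Finset.sum_eq_zero fun E _ => ?_
              by_contra hne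
              rw [ite_eq_right_iff] at hne
              push Not at hne
              have := hsupp E hne.2 hne.1
              simp only [lowDegree, Finset.mem_filter] at this
              tauto
            simp [this]
      _ ≤ ∑ u : V, 1 / (2 * (s : ℝ)) * degAll ν {u} :=
          Finset.sum_le_sum_of_subset_of_nonneg (Finset.filter_subset _ _) fun u _ _ =>
            mul_nonneg (by positivity) (degAll_nonneg hν.1 _)
      _ = _ := by
          rw [← Finset.mul_sum, sum_degAll_singleton (s := s)
            (fun E hE => hunif E (by_contra fun h => hE (hν.2 E h)))]
          field_simp
  have h4 : degAll ν ∅ / 2 ≤ ∑ T ∈ A, degAll μ T * degAll ν T / P ^ T.card := by linarith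
  have h5 : (∑ T ∈ A, degAll μ T * degAll ν T / P ^ T.card) ^ 2 ≤
      (∑ T ∈ A, degAll μ T ^ 2 / P ^ T.card) * ∑ T ∈ A, degAll ν T ^ 2 / P ^ T.card := by
    apply Finset.sum_sq_le_sum_mul_sum_of_sq_le_mul
    · intro T _; positivity
    · intro T _; positivity
    · intro T _; exact le_of_eq (by ring)
  have h6 : ∑ T ∈ A, degAll ν T ^ 2 / P ^ T.card ≤ lamAll P ν := by
    apply Finset.sum_le_sum_of_subset_of_nonneg
    · exact Finset.filter_subset_filter _ (Finset.subset_univ _)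
    · intro T _ _; positivity
  have h7 : ∑ T ∈ A, degAll μ T ^ 2 / P ^ T.card ≤ P * Fintype.card V := by
    have h8 : ∑ T ∈ A, degAll μ T ^ 2 / P ^ T.card ≤ crossForm P S μ μ := by
      simp only [crossForm, ← pow_two]
      apply Finset.sum_le_sum_of_subset_of_nonneg (Finset.filter_subset _ _)
      intro T _ _; positivity
    have h9 := eq_crossForm_of_max hμ hmax hμ (fun _ => le_rfl)
    have h10 := energy_le hP hS hμ le_rfl
    unfold energy at h10
    linarith
  have h0 := degAll_nonneg hν.1 ∅
  have h11 : (degAll ν ∅ / 2) ^ 2 ≤ (P * Fintype.card V) * lamAll P ν := by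
    calc _ ≤ _ := pow_le_pow_left₀ (by positivity) h4 2
      _ ≤ _ := h5
      _ ≤ _ := by
        gcongr
  linarith

/-- Containers for the independent sets of a uniform hypergraph. -/
theorem exists_containers_of_indep {s : ℕ} (hs : 0 < s) {P : ℝ} (hP : 0 < P)
    {G : Finset (Finset V)} (hunif : ∀ E ∈ G, E.card = s) :
    ∃ c : Finset V → Finset V, ∀ L, IndepIn G L → ∃ S ⊆ L,
      (S.card : ℝ) ≤ 4 * (s : ℝ) ^ 2 * (P * Fintype.card V) ∧ L ⊆ c S ∧
      ∀ ν, IsMeasureOn G ν → (∀ E, ν E ≠ 0 → E ⊆ c S) →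
        degAll ν ∅ ^ 2 ≤ 4 * (P * Fintype.card V) * lamAll P ν := by
  have hs' : (0 : ℝ) < s := by exact_mod_cast hs
  have hex : ∀ S : Finset V, ∃ μ, IndepIn G S → IsMeasureOn G μ ∧
      ∀ ν, IsMeasureOn G ν → energy P S ν ≤ energy P S μ := by
    intro S
    by_cases hS : IndepIn G S
    · obtain ⟨μ, hμ⟩ := exists_energy_max hP hS
      exact ⟨μ, fun _ => hμ⟩
    · exact ⟨0, fun h => absurd h hS⟩
  choose μ hμ using hex
  refine ⟨fun S => lowDegree s P (μ S) S, fun L hL => ?_⟩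
  obtain ⟨S, hSL, hSmax⟩ := Finset.exists_max_image L.powerset
    (fun S => energy P S (μ S) - S.card / (4 * (s : ℝ) ^ 2)) ⟨∅, Finset.empty_mem_powerset L⟩
  rw [Finset.mem_powerset] at hSL
  have hSi := hL.mono hSL
  have hm := hμ S hSi
  refine ⟨S, hSL, ?_, ?_, fun ν hν hsupp =>
    sq_degAll_le_of_subset_lowDegree hs hP hunif hSi hm.1 hm.2 hν hsupp⟩
  · have h1 := hSmax ∅ (Finset.empty_mem_powerset L)
    have h2 := energy_le hP hSi hm.1 le_rfl
    have h3 : energy P ∅ 0 ≤ energy P ∅ (μ ∅) :=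
      (hμ ∅ (hL.mono (Finset.empty_subset L))).2 _ ⟨fun _ => le_rfl, fun _ _ => rfl⟩
    have h5 : energy P ∅ (0 : Finset V → ℝ) = 0 := by
      simp [energy, crossForm, degAll]
    simp only [Finset.card_empty, Nat.cast_zero, zero_div, sub_zero] at h1
    have h6 : S.card / (4 * (s : ℝ) ^ 2) ≤ P * Fintype.card V := by linarith
    rw [div_le_iff₀ (by positivity)] at h6
    linarith
  · intro u hu
    simp only [lowDegree, Finset.mem_filter, Finset.mem_univ, true_and]
    by_contra! hcon
    obtain ⟨huS, hlt⟩ := hcon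
    obtain ⟨ν, hν, h1⟩ := exists_energy_insert_ge hP hm.1 hm.2 huS
    have hins : insert u S ⊆ L := Finset.insert_subset hu hSL
    have h2 := (hμ _ (hL.mono hins)).2 ν hν
    have h3 := hSmax _ (Finset.mem_powerset.2 hins)
    rw [Finset.card_insert_of_notMem huS] at h3
    push_cast at h3
    rw [add_div] at h3
    have h4 : (1 / (2 * (s : ℝ))) ^ 2 < (degAll (μ S) {u} / P) ^ 2 :=
      pow_lt_pow_left₀ hlt (by positivity) two_ne_zero
    have h5 : (1 / (2 * (s : ℝ))) ^ 2 = 1 / (4 * (s : ℝ) ^ 2) := by ring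
    linarith

end Step

section RandomSets

variable {V : Type*}

/-- The indicator of membership of `S ∪ W` in the family `F`. -/
def unionInd (F : Finset V → Prop) (S W : Finset V) : ℝ := if F (S ∪ W) then 1 else 0

theorem unionInd_nonneg (F : Finset V → Prop) (S W : Finset V) : 0 ≤ unionInd F S W := by
  unfold unionInd
  split_ifs <;> norm_num

theorem unionInd_le_one (F : Finset V → Prop) (S W : Finset V) : unionInd F S W ≤ 1 := by
  unfold unionInd
  split_ifs <;> norm_num

theorem unionInd_antitone {F : Finset V → Prop} (hF : ∀ A B, A ⊆ B → F B → F A)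
    {S T : Finset V} (h : S ⊆ T) (W : Finset V) : unionInd F T W ≤ unionInd F S W := by
  unfold unionInd
  split_ifs with h1 h2 h2
  · exact le_rfl
  · exact absurd (hF _ _ (Finset.union_subset_union_left h) h1) h2
  · norm_num
  · exact le_rfl

variable [Fintype V]

/-- The probability that a `q`-random subset of the vertex set equals `W`. -/
def binomWt (q : ℝ) (W : Finset V) : ℝ := q ^ W.card * (1 - q) ^ (Fintype.card V - W.card)

theorem binomWt_nonneg {q : ℝ} (h0 : 0 ≤ q) (h1 : q ≤ 1) (W : Finset V) : 0 ≤ binomWt q W := by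
  have : 0 ≤ 1 - q := by linarith
  unfold binomWt
  positivity

theorem binomWt_mul_of_notMem (q : ℝ) {u : V} {W : Finset V} (hu : u ∉ W) :
    binomWt q (insert u W) = q * (binomWt q W + binomWt q (insert u W)) := by
  have hc : W.card + 1 ≤ Fintype.card V := by
    rw [← Finset.card_insert_of_notMem hu]
    exact Finset.card_le_univ _
  obtain ⟨k, hk⟩ := Nat.exists_eq_add_of_le hc
  have h1 : Fintype.card V - W.card = k + 1 := by omega
  have h2 : Fintype.card V - (W.card + 1) = k := by omega
  simp only [binomWt, Finset.card_insert_of_notMem hu, h1, h2]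
  ring

theorem sum_eq_sum_erase (u : V) (f : Finset V → ℝ) :
    ∑ W, f W = ∑ W ∈ (Finset.univ.erase u).powerset, (f W + f (insert u W)) := by
  rw [← Finset.powerset_univ, ← Finset.insert_erase (Finset.mem_univ u),
    Finset.sum_powerset_insert (Finset.notMem_erase u _), Finset.sum_add_distrib,
    Finset.insert_erase (Finset.mem_univ u)]

theorem sum_binomWt_ite_mem (q : ℝ) (u : V) (f : Finset V → ℝ) :
    ∑ W, binomWt q W * (if u ∈ W then f W else 0) = q * ∑ W, binomWt q W * f (insert u W) := by
  rw [sum_eq_sum_erase u, sum_eq_sum_erase u, Finset.mul_sum]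
  refine Finset.sum_congr rfl fun W hW => ?_
  have hu : u ∉ W := fun h => Finset.notMem_erase u _ (Finset.mem_powerset.1 hW h)
  rw [if_neg hu, if_pos (Finset.mem_insert_self u W), Finset.insert_idem, ← add_mul, ← mul_assoc,
    ← binomWt_mul_of_notMem q hu, mul_zero, zero_add]

theorem sum_binomWt_ite_subset (q : ℝ) (A : Finset V) (f : Finset V → ℝ) :
    ∑ W, binomWt q W * (if A ⊆ W then f W else 0) =
      q ^ A.card * ∑ W, binomWt q W * f (A ∪ W) := by
  induction A using Finset.induction_on generalizing f with
  | empty => simp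
  | insert u A hu ih =>
    have h1 : ∀ W : Finset V, (if insert u A ⊆ W then f W else 0) =
        if u ∈ W then (if A ⊆ W then f W else 0) else 0 := by
      intro W
      rw [← ite_and]
      simp only [Finset.insert_subset_iff]
    have h2 : ∀ W : Finset V, A ⊆ insert u W ↔ A ⊆ W :=
      fun W => Finset.subset_insert_iff_of_notMem hu
    simp only [h1, sum_binomWt_ite_mem, h2]
    rw [ih (fun W => f (insert u W)), Finset.card_insert_of_notMem hu, pow_succ]
    simp only [Finset.insert_union]
    ring

theorem sum_binomWt (q : ℝ) : ∑ W : Finset V, binomWt q W = 1 := by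
  have := Finset.sum_pow_mul_eq_add_pow q (1 - q) (Finset.univ : Finset V)
  simpa [binomWt] using this

/-- The probability that `S ∪ W` lies in `F` for a `q`-random set `W`. -/
def unionProb (F : Finset V → Prop) (q : ℝ) (S : Finset V) : ℝ :=
  ∑ W, binomWt q W * unionInd F S W

theorem unionProb_antitone {F : Finset V → Prop} (hF : ∀ A B, A ⊆ B → F B → F A) {q : ℝ}
    (h0 : 0 ≤ q) (h1 : q ≤ 1) {S T : Finset V} (h : S ⊆ T) :
    unionProb F q T ≤ unionProb F q S :=
  Finset.sum_le_sum fun W _ =>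
    mul_le_mul_of_nonneg_left (unionInd_antitone hF h W) (binomWt_nonneg h0 h1 W)

theorem unionProb_nonneg (F : Finset V → Prop) {q : ℝ} (h0 : 0 ≤ q) (h1 : q ≤ 1)
    (S : Finset V) : 0 ≤ unionProb F q S :=
  Finset.sum_nonneg fun W _ => mul_nonneg (binomWt_nonneg h0 h1 W) (unionInd_nonneg F S W)

theorem unionProb_le_one (F : Finset V → Prop) {q : ℝ} (h0 : 0 ≤ q) (h1 : q ≤ 1)
    (S : Finset V) : unionProb F q S ≤ 1 := by
  rw [← sum_binomWt (V := V) q]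
  refine Finset.sum_le_sum fun W _ => ?_
  exact mul_le_of_le_one_right (binomWt_nonneg h0 h1 W) (unionInd_le_one F S W)

theorem pow_le_unionProb {F : Finset V → Prop} {q : ℝ} (h0 : 0 ≤ q) (h1 : q ≤ 1)
    {S : Finset V} (hS : F S) : (1 - q) ^ Fintype.card V ≤ unionProb F q S := by
  have := Finset.single_le_sum (f := fun W => binomWt q W * unionInd F S W)
    (fun W _ => mul_nonneg (binomWt_nonneg h0 h1 W) (unionInd_nonneg F S W))
    (Finset.mem_univ ∅)
  simpa [unionProb, binomWt, unionInd, hS] using this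

theorem sum_binomWt_unionInd_subset (F : Finset V → Prop) (q : ℝ) (S E : Finset V) :
    ∑ W, binomWt q W * (if E ⊆ S ∪ W then unionInd F S W else 0) =
      q ^ (E \ S).card * unionProb F q (S ∪ E) := by
  have h : ∀ W, E ⊆ S ∪ W ↔ E \ S ⊆ W := fun W => sdiff_le_iff.symm
  simp only [h]
  rw [sum_binomWt_ite_subset]
  congr 1
  refine Finset.sum_congr rfl fun W _ => ?_
  simp only [unionInd, ← Finset.union_assoc, Finset.union_sdiff_self_eq_union]

/-- An edge is good for `S` if adding it to `S` does not reduce `unionProb` too much. -/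
def GoodFor (F : Finset V → Prop) (q : ℝ) (S E : Finset V) : Prop :=
  (2 / 3) ^ (E \ S).card * unionProb F q S ≤ unionProb F q (S ∪ E)

theorem exists_subset_forall_goodFor {F : Finset V → Prop} (hF : ∀ A B, A ⊆ B → F B → F A)
    {q : ℝ} (h0 : 0 ≤ q) (h1 : q ≤ 1 / 16) {L : Finset V} (hL : F L) :
    ∃ S ⊆ L, (S.card : ℝ) ≤ 4 * q * Fintype.card V ∧ ∀ E ⊆ L, GoodFor F q S E := by
  obtain ⟨S, hSL, hSmin⟩ := Finset.exists_min_image L.powerset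
    (fun S => unionProb F q S * (3 / 2) ^ S.card) ⟨∅, Finset.empty_mem_powerset L⟩
  rw [Finset.mem_powerset] at hSL
  refine ⟨S, hSL, ?_, fun E hE => ?_⟩
  · have h2 := hSmin ∅ (Finset.empty_mem_powerset L)
    have h3 := unionProb_le_one F h0 (by linarith) (∅ : Finset V)
    have h4 := pow_le_unionProb h0 (by linarith) (hF _ _ hSL hL)
    simp only [Finset.card_empty, pow_zero, mul_one] at h2
    have hq : 0 < 1 - q := by linarith
    have h5 : (1 - q) ^ Fintype.card V * (3 / 2) ^ S.card ≤ 1 :=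
      (mul_le_mul_of_nonneg_right h4 (by positivity)).trans (h2.trans h3)
    have h6 := Real.log_le_log (by positivity) h5
    rw [Real.log_one, Real.log_mul (by positivity) (by positivity), Real.log_pow,
      Real.log_pow] at h6
    have h7 : 1 - (3 / 2 : ℝ)⁻¹ ≤ Real.log (3 / 2) := Real.one_sub_inv_le_log_of_pos (by norm_num)
    have h8 : 1 - (1 - q)⁻¹ ≤ Real.log (1 - q) := Real.one_sub_inv_le_log_of_pos hq
    have h9 : -(16 / 15 * q) ≤ 1 - (1 - q)⁻¹ := by
      have : (1 - q)⁻¹ ≤ 1 + 16 / 15 * q := by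
        rw [inv_le_iff_one_le_mul₀ hq]
        nlinarith
      linarith
    have h10 : (Fintype.card V : ℝ) * -(16 / 15 * q) ≤ Fintype.card V * Real.log (1 - q) := by
      gcongr
      linarith
    have h11 : (S.card : ℝ) * (1 / 3) ≤ S.card * Real.log (3 / 2) := by
      gcongr
      norm_num at h7 ⊢
      linarith
    have h12 : 0 ≤ q * Fintype.card V := by positivity
    nlinarith
  · have h2 := hSmin (S ∪ E) (Finset.mem_powerset.2 (Finset.union_subset hSL hE))
    rw [← Finset.union_sdiff_self_eq_union, Finset.card_union_of_disjoint Finset.disjoint_sdiff,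
      Finset.union_sdiff_self_eq_union, pow_add] at h2
    have h3 : unionProb F q S ≤ unionProb F q (S ∪ E) * (3 / 2) ^ (E \ S).card := by
      have : (0 : ℝ) < (3 / 2) ^ S.card := by positivity
      nlinarith
    unfold GoodFor
    calc _ ≤ (2 / 3 : ℝ) ^ (E \ S).card * (unionProb F q (S ∪ E) * (3 / 2) ^ (E \ S).card) := by
          gcongr
      _ = unionProb F q (S ∪ E) * ((2 / 3 : ℝ) * (3 / 2)) ^ (E \ S).card := by
          rw [mul_pow]; ring
      _ = _ := by norm_num

end RandomSets

section Averaging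

variable {V : Type*}

/-- The sum of `p^{-|T|}` over subsets `T` of `I` with at least two elements. -/
def pairKernel (p : ℝ) (I : Finset V) : ℝ :=
  ∑ T ∈ I.powerset.filter (fun T => 2 ≤ T.card), (p ^ T.card)⁻¹

theorem pairKernel_nonneg {p : ℝ} (hp : 0 < p) (I : Finset V) : 0 ≤ pairKernel p I :=
  Finset.sum_nonneg fun T _ => by positivity

theorem pairKernel_div_le {p q : ℝ} (hp : 0 < p) (hq : 0 < q) {s : ℕ} {I : Finset V}
    (hI : I.card ≤ s) :
    pairKernel (p / q) I * (q ^ I.card)⁻¹ ≤ (1 + p / q) ^ s * pairKernel p I := by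
  by_cases h2 : 2 ≤ I.card
  · have h3 : pairKernel (p / q) I ≤ (1 + q / p) ^ I.card := by
      have h4 := Finset.sum_pow_mul_eq_add_pow (q / p) 1 I
      simp only [one_pow, mul_one] at h4
      rw [add_comm 1, ← h4, pairKernel]
      refine (Finset.sum_le_sum_of_subset_of_nonneg (Finset.filter_subset _ _) ?_).trans_eq ?_
      · intro T _ _; positivity
      · refine Finset.sum_congr rfl fun T _ => ?_
        rw [← inv_pow, inv_div]
    have h5 : (p ^ I.card)⁻¹ ≤ pairKernel p I :=
      Finset.single_le_sum (f := fun T : Finset V => (p ^ T.card)⁻¹)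
        (fun T _ => by positivity) (by simpa using h2)
    calc _ ≤ (1 + q / p) ^ I.card * (q ^ I.card)⁻¹ := by gcongr
      _ = (1 + p / q) ^ I.card * (p ^ I.card)⁻¹ := by
        rw [← inv_pow, ← inv_pow, ← mul_pow, ← mul_pow]
        congr 1
        field_simp
        ring
      _ ≤ (1 + p / q) ^ s * pairKernel p I := by
        gcongr
        have : 0 < p / q := by positivity
        linarith
  · have h3 : pairKernel (p / q) I = 0 := by
      refine Finset.sum_eq_zero fun T hT => ?_
      rw [Finset.mem_filter, Finset.mem_powerset] at hT
      have := Finset.card_le_card hT.1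
      omega
    rw [h3, zero_mul]
    exact mul_nonneg (by positivity) (pairKernel_nonneg hp I)

variable [Fintype V]

theorem lamAll_eq_sum (p : ℝ) (ν : Finset V → ℝ) :
    lamAll p ν = ∑ E, ∑ E', ν E * ν E' * pairKernel p (E ∩ E') := by
  have h1 : ∀ T, degAll ν T ^ 2 / p ^ T.card =
      ∑ E, ∑ E', ν E * ν E' * if T ⊆ E ∩ E' then (p ^ T.card)⁻¹ else 0 := by
    intro T
    rw [pow_two, degAll, Finset.sum_filter, Finset.sum_mul_sum, div_eq_mul_inv, Finset.sum_mul]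
    refine Finset.sum_congr rfl fun E _ => ?_
    rw [Finset.sum_mul]
    refine Finset.sum_congr rfl fun E' _ => ?_
    by_cases hE : T ⊆ E <;> by_cases hE' : T ⊆ E' <;> simp [hE, hE', Finset.subset_inter_iff]
  have h2 : ∀ I : Finset V, pairKernel p I =
      ∑ T ∈ (Finset.univ : Finset (Finset V)).filter (fun T => 2 ≤ T.card),
        if T ⊆ I then (p ^ T.card)⁻¹ else 0 := by
    intro I
    rw [← Finset.sum_filter, Finset.filter_filter, pairKernel]
    refine Finset.sum_congr ?_ fun _ _ => rfl
    ext T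
    simp [and_comm]
  simp only [lamAll, h1, h2, Finset.mul_sum]
  rw [Finset.sum_comm]
  refine Finset.sum_congr rfl fun E _ => ?_
  rw [Finset.sum_comm]

/-- The restriction of `ν` to edges inside `S ∪ W`, reweighted to be unbiased when `W` is a
`q`-random set. -/
def sampled (q : ℝ) (S : Finset V) (ν : Finset V → ℝ) (W E : Finset V) : ℝ :=
  if E ⊆ S ∪ W then ν E * (q ^ (E \ S).card)⁻¹ else 0

theorem average_degAll_sampled {q : ℝ} (hq : 0 < q) (F : Finset V → Prop) (S : Finset V)
    (ν : Finset V → ℝ) :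
    ∑ W, binomWt q W * unionInd F S W * degAll (sampled q S ν W) ∅ =
      ∑ E, ν E * unionProb F q (S ∪ E) := by
  simp only [degAll_empty, Finset.mul_sum]
  rw [Finset.sum_comm]
  refine Finset.sum_congr rfl fun E _ => ?_
  calc _ = ∑ W, (ν E * (q ^ (E \ S).card)⁻¹) *
        (binomWt q W * (if E ⊆ S ∪ W then unionInd F S W else 0)) := by
        refine Finset.sum_congr rfl fun W _ => ?_
        unfold sampled
        split_ifs <;> ring
    _ = _ := by
      rw [← Finset.mul_sum, sum_binomWt_unionInd_subset]
      field_simp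

theorem average_lamAll_sampled_le {p q : ℝ} (hp : 0 < p) (hq : 0 < q) (hq1 : q ≤ 1)
    {F : Finset V → Prop} (hF : ∀ A B, A ⊆ B → F B → F A) (S : Finset V)
    {s : ℕ} {ν : Finset V → ℝ} (hν : ∀ E, 0 ≤ ν E) (hs : ∀ E, ν E ≠ 0 → E.card = s) :
    ∑ W, binomWt q W * unionInd F S W * lamAll (p / q) (sampled q S ν W) ≤
      unionProb F q S * ((1 + p / q) ^ s * lamAll p ν) := by
  simp only [lamAll_eq_sum, Finset.mul_sum]
  rw [Finset.sum_comm]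
  refine Finset.sum_le_sum fun E _ => ?_
  rw [Finset.sum_comm]
  refine Finset.sum_le_sum fun E' _ => ?_
  have h1 : ∑ W, binomWt q W * unionInd F S W *
      (sampled q S ν W E * sampled q S ν W E' * pairKernel (p / q) (E ∩ E')) =
      (ν E * ν E' * pairKernel (p / q) (E ∩ E')) * ((q ^ (E \ S).card)⁻¹ * (q ^ (E' \ S).card)⁻¹ *
        (q ^ ((E ∪ E') \ S).card * unionProb F q (S ∪ (E ∪ E')))) := by
    rw [← sum_binomWt_unionInd_subset, Finset.mul_sum, Finset.mul_sum]
    refine Finset.sum_congr rfl fun W _ => ?_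
    unfold sampled
    by_cases hE : E ⊆ S ∪ W <;> by_cases hE' : E' ⊆ S ∪ W <;>
      simp [hE, hE', Finset.union_subset_iff]
    ring
  rw [h1]
  by_cases h0 : ν E = 0
  · simp [h0]
  have h2 : ((E ∪ E') \ S).card + ((E ∩ E') \ S).card = (E \ S).card + (E' \ S).card := by
    have h3 : (E ∩ E') \ S = (E \ S) ∩ (E' \ S) := by
      ext
      simp only [Finset.mem_sdiff, Finset.mem_inter]
      tauto
    rw [Finset.union_sdiff_distrib, h3]
    exact Finset.card_union_add_card_inter _ _
  have h3 : (q ^ (E \ S).card)⁻¹ * (q ^ (E' \ S).card)⁻¹ * q ^ ((E ∪ E') \ S).card ≤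
      (q ^ (E ∩ E').card)⁻¹ := by
    have h4 : q ^ ((E ∪ E') \ S).card * q ^ ((E ∩ E') \ S).card =
        q ^ (E \ S).card * q ^ (E' \ S).card := by
      rw [← pow_add, ← pow_add, h2]
    calc _ = (q ^ ((E ∩ E') \ S).card)⁻¹ := by
          field_simp
          linarith
      _ ≤ _ := by
          gcongr ?_⁻¹
          exact pow_le_pow_of_le_one hq.le hq1 (Finset.card_le_card Finset.sdiff_subset)
  have h5 : unionProb F q (S ∪ (E ∪ E')) ≤ unionProb F q S :=
    unionProb_antitone hF hq.le hq1 Finset.subset_union_left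
  have h6 : 0 ≤ unionProb F q S := unionProb_nonneg F hq.le hq1 S
  have h6' : 0 ≤ unionProb F q (S ∪ (E ∪ E')) := unionProb_nonneg F hq.le hq1 _
  have h7 : (E ∩ E').card ≤ s := by
    rw [← hs E h0]
    exact Finset.card_le_card Finset.inter_subset_left
  have h8 := pairKernel_div_le hp hq h7
  have h9 := pairKernel_nonneg (div_pos hp hq) (E ∩ E')
  have hE := hν E
  have hE' := hν E'
  calc _ = (ν E * ν E' * pairKernel (p / q) (E ∩ E')) * ((q ^ (E \ S).card)⁻¹ *
        (q ^ (E' \ S).card)⁻¹ * q ^ ((E ∪ E') \ S).card * unionProb F q (S ∪ (E ∪ E'))) := by ring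
    _ ≤ (ν E * ν E' * pairKernel (p / q) (E ∩ E')) *
        ((q ^ (E ∩ E').card)⁻¹ * unionProb F q S) := by gcongr
    _ = unionProb F q S * (ν E * ν E') * (pairKernel (p / q) (E ∩ E') * (q ^ (E ∩ E').card)⁻¹) := by
        ring
    _ ≤ unionProb F q S * (ν E * ν E') * ((1 + p / q) ^ s * pairKernel p (E ∩ E')) := by gcongr
    _ = _ := by ring

theorem sq_degAll_le_of_goodFor {p q : ℝ} (hp : 0 < p) (hq : 0 < q) (hq1 : q < 1)
    {F : Finset V → Prop} (hF : ∀ A B, A ⊆ B → F B → F A) {S : Finset V} (hS : F S)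
    {s : ℕ} {ν : Finset V → ℝ} (hν : ∀ E, 0 ≤ ν E) (hs : ∀ E, ν E ≠ 0 → E.card = s)
    (hgood : ∀ E, ν E ≠ 0 → GoodFor F q S E) {a : ℝ} (ha : 0 ≤ a)
    (hbound : ∀ W, F (S ∪ W) →
      degAll (sampled q S ν W) ∅ ^ 2 ≤ a * lamAll (p / q) (sampled q S ν W)) :
    (4 / 9) ^ s * degAll ν ∅ ^ 2 ≤ a * ((1 + p / q) ^ s * lamAll p ν) := by
  set Φ := unionProb F q S with hΦ
  have hΦ0 : 0 < Φ :=
    (pow_pos (by linarith : 0 < 1 - q) _).trans_le (pow_le_unionProb hq.le hq1.le hS)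
  have hw : ∀ W, 0 ≤ binomWt q W * unionInd F S W := fun W =>
    mul_nonneg (binomWt_nonneg hq.le hq1.le W) (unionInd_nonneg F S W)
  have h1 : (2 / 3) ^ s * degAll ν ∅ * Φ ≤
      ∑ W, binomWt q W * unionInd F S W * degAll (sampled q S ν W) ∅ := by
    rw [average_degAll_sampled hq, degAll_empty, Finset.mul_sum, Finset.sum_mul]
    refine Finset.sum_le_sum fun E _ => ?_
    by_cases h0 : ν E = 0
    · simp [h0]
    · have h2 := hgood E h0
      have h3 : (2 / 3 : ℝ) ^ s ≤ (2 / 3) ^ (E \ S).card := by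
        rw [← hs E h0]
        exact pow_le_pow_of_le_one (by norm_num) (by norm_num)
          (Finset.card_le_card Finset.sdiff_subset)
      have hE := hν E
      calc _ = ν E * ((2 / 3) ^ s * Φ) := by ring
        _ ≤ ν E * ((2 / 3) ^ (E \ S).card * Φ) := by gcongr
        _ ≤ _ := by gcongr; exact h2
  have h2 : (∑ W, binomWt q W * unionInd F S W * degAll (sampled q S ν W) ∅) ^ 2 ≤
      Φ * ∑ W, binomWt q W * unionInd F S W * degAll (sampled q S ν W) ∅ ^ 2 := by
    apply Finset.sum_sq_le_sum_mul_sum_of_sq_le_mul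
    · exact fun W _ => hw W
    · exact fun W _ => mul_nonneg (hw W) (sq_nonneg _)
    · exact fun W _ => le_of_eq (by ring)
  have h3 : ∑ W, binomWt q W * unionInd F S W * degAll (sampled q S ν W) ∅ ^ 2 ≤
      a * ∑ W, binomWt q W * unionInd F S W * lamAll (p / q) (sampled q S ν W) := by
    rw [Finset.mul_sum]
    refine Finset.sum_le_sum fun W _ => ?_
    by_cases hW : F (S ∪ W)
    · calc _ ≤ _ := mul_le_mul_of_nonneg_left (hbound W hW) (hw W)
        _ = _ := by ring
    · simp [unionInd, hW]
  have h4 := average_lamAll_sampled_le hp hq hq1.le hF S hν hs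
  have h5 : 0 ≤ degAll ν ∅ := degAll_nonneg hν ∅
  have h6 : ((2 / 3) ^ s * degAll ν ∅ * Φ) ^ 2 ≤
      Φ * (a * (Φ * ((1 + p / q) ^ s * lamAll p ν))) := by
    calc _ ≤ _ := pow_le_pow_left₀ (by positivity) h1 2
      _ ≤ _ := h2
      _ ≤ _ := by
        refine mul_le_mul_of_nonneg_left (h3.trans ?_) hΦ0.le
        exact mul_le_mul_of_nonneg_left h4 ha
  have h7 : ((2 / 3 : ℝ) ^ s) ^ 2 = (4 / 9) ^ s := by
    rw [← pow_mul, mul_comm, pow_mul]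
    norm_num
  have h8 : Φ ^ 2 * ((4 / 9) ^ s * degAll ν ∅ ^ 2) ≤
      Φ ^ 2 * (a * ((1 + p / q) ^ s * lamAll p ν)) := by
    rw [← h7]
    linarith
  exact le_of_mul_le_mul_left h8 (by positivity)

end Averaging

section Conclusion

variable {V : Type*}

theorem sampled_isMeasureOn {q : ℝ} (hq : 0 < q) (S W : Finset V) {H : Finset (Finset V)}
    {ν : Finset V → ℝ} (hν : IsMeasureOn H ν) :
    IsMeasureOn (indHG H (S ∪ W)) (sampled q S ν W) := by
  constructor
  · intro E
    have := hν.1 E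
    unfold sampled
    split_ifs <;> positivity
  · intro E hE
    rw [indHG, Finset.mem_filter] at hE
    unfold sampled
    split_ifs with h
    · rw [hν.2 E fun hE' => hE ⟨hE', h⟩, zero_mul]
    · rfl

variable [Fintype V]

theorem card_small_le {q : ℝ} (hq : 0 < q) (hq16 : q ≤ 1 / 16) :
    ((((Finset.univ : Finset (Finset V)).filter
      fun S => (S.card : ℝ) ≤ 4 * q * Fintype.card V).card : ℕ) : ℝ) ≤
      (2 / q) ^ (4 * q * (Fintype.card V : ℝ)) := by
  set n := Fintype.card V
  set small := (Finset.univ : Finset (Finset V)).filter fun S => (S.card : ℝ) ≤ 4 * q * n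
  have hx0 : 0 < 4 * q := by linarith
  have h1 : ∑ S : Finset V, (4 * q) ^ S.card = (1 + 4 * q) ^ n := by
    have := Finset.sum_pow_mul_eq_add_pow (4 * q) 1 (Finset.univ : Finset V)
    simpa [add_comm] using this
  have h2 : (small.card : ℝ) * (4 * q) ^ (4 * q * n) ≤ (1 + 4 * q) ^ n := by
    rw [← h1, ← nsmul_eq_mul, ← Finset.sum_const]
    refine (Finset.sum_le_sum fun S hS => ?_).trans
      (Finset.sum_le_sum_of_subset_of_nonneg (Finset.filter_subset _ _) fun S _ _ => by positivity)
    rw [← Real.rpow_natCast]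
    exact Real.rpow_le_rpow_of_exponent_ge hx0 (by linarith) (Finset.mem_filter.1 hS).2
  have h3 : (1 + 4 * q) ^ n ≤ Real.exp 1 ^ (4 * q * n) := by
    rw [Real.exp_one_rpow, mul_comm _ (n : ℝ), Real.exp_nat_mul]
    gcongr
    linarith [Real.add_one_le_exp (4 * q)]
  have h4 : Real.exp 1 ^ (4 * q * n) ≤ (2 / q * (4 * q)) ^ (4 * q * n) := by
    have : 2 / q * (4 * q) = 8 := by field_simp; norm_num
    rw [this]
    gcongr
    linarith [Real.exp_one_lt_d9]
  rw [Real.mul_rpow (by positivity) hx0.le] at h4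
  exact le_of_mul_le_mul_right (h2.trans (h3.trans h4)) (by positivity)

theorem degAll_restr_add_degAll_restr_not (A : Finset V → Prop) (ν : Finset V → ℝ) (T : Finset V) :
    degAll (restr A ν) T + degAll (restr (fun E => ¬ A E) ν) T = degAll ν T := by
  rw [degAll, degAll, ← Finset.sum_add_distrib]
  refine Finset.sum_congr rfl fun E _ => ?_
  by_cases h : A E <;> simp [restr, h]

theorem IsJanson.mono {p R : ℝ} {H : Finset (Finset V)} {A B : Finset V} (hAB : A ⊆ B)
    (h : IsJanson p R (indHG H A)) : IsJanson p R (indHG H B) := by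
  intro hR
  rw [isJanson_iff hR] at h
  obtain ⟨ν, hν, hlt⟩ := h
  refine (isJanson_iff hR).2 ⟨ν, ⟨hν.1, fun E hE => hν.2 E fun hE' => hE ?_⟩, hlt⟩ hR
  rw [indHG, Finset.mem_filter] at hE' ⊢
  exact ⟨hE'.1, hE'.2.trans hAB⟩

theorem not_isJanson_of_bad_bound {s : ℕ} {p q R : ℝ} (hp : 0 < p) (hq : 0 < q) (hR : 0 < R)
    (hq1 : q < 1) (hpq : p / q ≤ 7 / 9) {H : Finset (Finset V)} (hunif : ∀ E ∈ H, E.card = s)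
    {F : Finset V → Prop}
    (hF : F = fun L => ¬ IsJanson (p / q) ((1 / 2 ^ (2 * s + 2)) * R) (indHG H L))
    {S X : Finset V} (hS : F S)
    (hbad : ∀ ν, IsMeasureOn (H.filter fun E => ¬ GoodFor F q S E) ν →
      (∀ E, ν E ≠ 0 → E ⊆ X) → degAll ν ∅ ^ 2 ≤ R / 4 * lamAll p ν) :
    ¬ IsJanson p R (indHG H X) := by
  have hη : (0 : ℝ) < (1 / 2 ^ (2 * s + 2)) * R := by positivity
  have hdown : ∀ A B, A ⊆ B → F B → F A := by
    subst hF
    exact fun A B hAB hB hA => hB (hA.mono hAB)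
  rw [isJanson_iff hR]
  rintro ⟨ν, hν, hlt⟩
  have hsub : ∀ E, ν E ≠ 0 → E ∈ H ∧ E ⊆ X := fun E hE => by
    have : E ∈ indHG H X := by_contra fun h => hE (hν.2 E h)
    rwa [indHG, Finset.mem_filter] at this
  have hνH : IsMeasureOn H ν := ⟨hν.1, fun E hE => by_contra fun h => hE (hsub E h).1⟩
  have hrestr : ∀ {A : Finset V → Prop} {E}, restr A ν E ≠ 0 → A E ∧ ν E ≠ 0 := by
    intro A E hE
    unfold restr at hE
    rwa [ite_ne_right_iff] at hE
  set good := restr (GoodFor F q S) ν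
  set bad := restr (fun E => ¬ GoodFor F q S E) ν
  have hsplit : degAll good ∅ + degAll bad ∅ = degAll ν ∅ := degAll_restr_add_degAll_restr_not _ ν ∅
  have hgood : IsMeasureOn H good := restr_isMeasureOn hνH _
  have hbadm : IsMeasureOn H bad := restr_isMeasureOn hνH _
  have hb := hbad bad ⟨hbadm.1, fun E hE => by_contra fun h => hE (Finset.mem_filter.2
    ⟨(hsub E (hrestr h).2).1, (hrestr h).1⟩)⟩ fun E hE => (hsub E (hrestr hE).2).2
  have hg := sq_degAll_le_of_goodFor hp hq hq1 hdown hS hgood.1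
    (fun E hE => hunif E (hsub E (hrestr hE).2).1) (fun E hE => (hrestr hE).1) hη.le
    fun W hW => by
      rw [hF] at hW
      rw [isJanson_iff hη] at hW
      push Not at hW
      exact hW _ (sampled_isMeasureOn hq S W hgood)
  have hlg : lamAll p good ≤ lamAll p ν := lamAll_mono hp hgood.1 (restr_le hν.1 _)
  have hlb : lamAll p bad ≤ lamAll p ν := lamAll_mono hp hbadm.1 (restr_le hν.1 _)
  have he := degAll_nonneg hν.1 ∅
  have hb2 : degAll bad ∅ < degAll ν ∅ / 2 := by
    refine lt_of_pow_lt_pow_left₀ 2 (by positivity) ?_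
    have := mul_le_mul_of_nonneg_left hlb hR.le
    linarith
  have hg2 : (degAll ν ∅ / 2) ^ 2 ≤ degAll good ∅ ^ 2 :=
    pow_le_pow_left₀ (by positivity) (by linarith) 2
  have hpq0 : 0 < p / q := by positivity
  have hc : (1 / 2 ^ (2 * s + 2)) * (1 + p / q) ^ s ≤ 1 / 4 * (4 / 9 : ℝ) ^ s := by
    have h1 : (1 / 2 ^ (2 * s + 2) : ℝ) = 1 / 4 * (1 / 4) ^ s := by
      rw [pow_add, pow_mul, one_div_pow]
      norm_num
    rw [h1, mul_assoc, ← mul_pow]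
    gcongr
    linarith
  have h1 : (1 / 2 ^ (2 * s + 2)) * R * ((1 + p / q) ^ s * lamAll p good) <
      (1 / 2 ^ (2 * s + 2)) * (1 + p / q) ^ s * degAll ν ∅ ^ 2 := by
    calc _ = (1 / 2 ^ (2 * s + 2)) * (1 + p / q) ^ s * (R * lamAll p good) := by ring
      _ < _ := by
        gcongr
        exact (mul_le_mul_of_nonneg_left hlg hR.le).trans_lt hlt
  have h2 := mul_le_mul_of_nonneg_right hc (sq_nonneg (degAll ν ∅))
  have h3 := mul_le_mul_of_nonneg_left hg2 (by positivity : (0 : ℝ) ≤ (4 / 9) ^ s)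
  linarith

end Conclusion

/-- **Theorem 4.1 (container theorem for non-Janson sets, general form).**
Let `s ≤ n`, `q ≤ 1/16`, `p ≤ q/(2^{10}s²)`, `R ≥ 2^{-6}pn` and `η = 2^{-2s-2}`.  For every
`s`-uniform hypergraph `ℋ` on `n` vertices there is a family `𝒳` of at most `4(2/q)^{8qn}`
subsets of `V` such that (i) every `L` with `ℋ[L]` not `(p/q,ηR)`-Janson is contained in some
`X ∈ 𝒳`, and (ii) `ℋ[X]` is not `(p,R)`-Janson for every `X ∈ 𝒳`. -/
theorem containers_for_non_janson_general
    {V : Type*} [Fintype V] (s n : ℕ) (hsn : s ≤ n) (hn : Fintype.card V = n)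
    (p q R : ℝ) (hp : 0 < p) (hq : 0 < q) (hR : 0 < R)
    (hq16 : q ≤ 1 / 16) (hpq : p ≤ q / (2 ^ 10 * (s : ℝ) ^ 2))
    (hRn : p * (n : ℝ) / 2 ^ 6 ≤ R)
    (H : Finset (Finset V)) (hunif : ∀ E ∈ H, E.card = s) :
    ∃ X : Finset (Finset V),
      (X.card : ℝ) ≤ 4 * (2 / q) ^ (8 * q * (n : ℝ)) ∧
      (∀ L : Finset V,
        ¬ IsJanson (p / q) ((1 / 2 ^ (2 * s + 2)) * R) (indHG H L) → ∃ x ∈ X, L ⊆ x) ∧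
      (∀ x ∈ X, ¬ IsJanson p R (indHG H x)) := by
  subst hn
  have hs : 0 < s := by
    rcases Nat.eq_zero_or_pos s with rfl | hs
    · simp at hpq
      linarith
    · exact hs
  have hs1 : (1 : ℝ) ≤ s := by exact_mod_cast hs
  rw [le_div_iff₀ (by positivity)] at hpq
  set F : Finset V → Prop :=
    fun L => ¬ IsJanson (p / q) ((1 / 2 ^ (2 * s + 2)) * R) (indHG H L) with hF
  have hdown : ∀ A B, A ⊆ B → F B → F A := fun A B hAB hB hA => hB (hA.mono hAB)
  have hP : 0 < 2 ^ 10 * p := by positivity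
  choose c hc using fun S => exists_containers_of_indep hs hP
    (G := H.filter fun E => ¬ GoodFor F q S E) fun E hE => hunif E (Finset.mem_filter.1 hE).1
  set small := (Finset.univ : Finset (Finset V)).filter
    fun S => (S.card : ℝ) ≤ 4 * q * Fintype.card V with hsmall
  refine ⟨((small ×ˢ small).image fun S => c S.1 S.2).filter
    fun x => ¬ IsJanson p R (indHG H x), ?_, ?_, fun x hx => (Finset.mem_filter.1 hx).2⟩
  · have h1 : (small.card : ℝ) ≤ (2 / q) ^ (4 * q * (Fintype.card V : ℝ)) :=
      card_small_le hq hq16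
    have h2 : (((small ×ˢ small).image fun S => c S.1 S.2).filter
        fun x => ¬ IsJanson p R (indHG H x)).card ≤ small.card * small.card := by
      rw [← Finset.card_product]
      exact (Finset.card_filter_le _ _).trans Finset.card_image_le
    have h3 : (2 / q) ^ (8 * q * (Fintype.card V : ℝ)) =
        (2 / q) ^ (4 * q * (Fintype.card V : ℝ)) * (2 / q) ^ (4 * q * (Fintype.card V : ℝ)) := by
      rw [← Real.rpow_add (by positivity)]
      ring_nf
    have h4 : (0 : ℝ) ≤ (2 / q) ^ (8 * q * (Fintype.card V : ℝ)) := by positivity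
    calc _ ≤ (small.card : ℝ) * small.card := by exact_mod_cast h2
      _ ≤ (2 / q) ^ (8 * q * (Fintype.card V : ℝ)) := by
        rw [h3]
        gcongr
      _ ≤ _ := by linarith
  · intro L hL
    obtain ⟨S, hSL, hScard, hSgood⟩ := exists_subset_forall_goodFor hdown hq.le hq16 hL
    obtain ⟨T, -, hTcard, hLT, hT⟩ := hc S L fun E hE hEL =>
      (Finset.mem_filter.1 hE).2 (hSgood E hEL)
    have hTcard' : (T.card : ℝ) ≤ 4 * q * Fintype.card V := by
      have := mul_le_mul_of_nonneg_right hpq (Nat.cast_nonneg (α := ℝ) (Fintype.card V))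
      linarith
    refine ⟨c S T, Finset.mem_filter.2 ⟨Finset.mem_image.2 ⟨(S, T), ?_, rfl⟩, ?_⟩, hLT⟩
    · simp [hsmall, hScard, hTcard']
    · refine not_isJanson_of_bad_bound hp hq hR (by linarith) ?_ hunif hF (hdown S L hSL hL)
        fun ν hν hsupp => ?_
      · rw [div_le_iff₀ hq]
        have := mul_le_mul_of_nonneg_left (one_le_pow₀ (n := 2) hs1) hp.le
        linarith
      · have h1 := hT ν hν hsupp
        have h2 := lamAll_mul_le hp (by norm_num : (1 : ℝ) ≤ 2 ^ 10) ν
        have h3 := lamAll_nonneg hp ν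
        calc _ ≤ _ := h1
          _ ≤ 4 * (2 ^ 10 * p * Fintype.card V) * (lamAll p ν / (2 ^ 10) ^ 2) := by gcongr
          _ = (p * Fintype.card V / 2 ^ 6) / 4 * lamAll p ν := by ring
          _ ≤ _ := by gcongr

end
end
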